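/- Every three-dimensional lattice polytope P with exactly two interior lattice points satisfies |P ∩ ℤ³| ≤ 55, and equality holds if and only if P is unimodular equivalent to the simplex S₂³ = conv{(0,0,0),(2,0,0),(0,3,0),(0,0,18)}. -/

import Mathlib

open Set MeasureTheory

noncomputable section

/-- The canonical embedding of lattice points `ℤ^d` into `ℝ^d`. -/
def castPt {d : ℕ} (v : Fin d → ℤ) : Fin d → ℝ := fun i => (v i : ℝ)

/-- A lattice polytope: the convex hull of a nonempty finite set of lattice points. -/
def IsLatticePolytope {d : ℕ} (P : Set (Fin d → ℝ)) : Prop :=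
  ∃ V : Finset (Fin d → ℤ), V.Nonempty ∧
    P = convexHull ℝ (castPt '' (V : Set (Fin d → ℤ)))

/-- The interior lattice points of a full-dimensional polytope `P`. -/
def intLatPts {d : ℕ} (P : Set (Fin d → ℝ)) : Set (Fin d → ℤ) :=
  {x | castPt x ∈ interior P}

/-- Unimodular equivalence: an affine lattice automorphism in `GL_d(ℤ) ⋉ ℤ^d` maps `P` onto `Q`. -/
def UnimodEquiv {d : ℕ} (P Q : Set (Fin d → ℝ)) : Prop :=
  ∃ (A : Matrix (Fin d) (Fin d) ℤ) (b : Fin d → ℤ), IsUnit A.det ∧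
    (fun x : Fin d → ℝ => (A.map (Int.cast : ℤ → ℝ)).mulVec x + castPt b) '' P = Q

/-- A three-dimensional lattice polytope with exactly `k` interior lattice points. -/
def IsKPoint3Polytope (k : ℕ) (P : Set (Fin 3 → ℝ)) : Prop :=
  IsLatticePolytope P ∧ affineSpan ℝ P = ⊤ ∧ (intLatPts P).ncard = k

/-- The polytopes satisfying `Q` form exactly `n` unimodular equivalence classes: there are
`n` representatives and every polytope satisfying `Q` is equivalent to exactly one of them. -/
def HasNClassesUpToEquiv (Q : Set (Fin 3 → ℝ) → Prop) (n : ℕ) : Prop :=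
  ∃ S : Finset (Set (Fin 3 → ℝ)), S.card = n ∧ (∀ P ∈ S, Q P) ∧
    ∀ P, Q P → ∃! R, R ∈ S ∧ UnimodEquiv P R

/-- The simplex `S₂³ = conv{(0,0,0),(2,0,0),(0,3,0),(0,0,18)}`. -/
def S23 : Set (Fin 3 → ℝ) :=
  convexHull ℝ {![0,0,0], ![2,0,0], ![0,3,0], ![0,0,18]}

/-- Data of the projection of a polytope along a lattice direction: `F x y l` says that the fibre
over `(x,y)` contains a segment of length `l`; `I` is the interior of the projection; `n` counts
lattice points in lattice fibres. -/
structure Dat where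
  F : ℝ → ℝ → ℝ → Prop
  I : ℝ → ℝ → Prop
  n : ℤ → ℤ → ℕ
  sa1 : ℤ
  sa2 : ℤ
  sb1 : ℤ
  sb2 : ℤ
  nonneg : ∀ {x y l : ℝ}, F x y l → 0 ≤ l
  mono : ∀ {x y l l' : ℝ}, F x y l → 0 ≤ l' → l' ≤ l → F x y l'
  conv : ∀ {x y l x' y' l' s t : ℝ}, F x y l → F x' y' l' → 0 ≤ s → 0 ≤ t → s + t = 1 →
    F (s * x + t * x') (s * y + t * y') (s * l + t * l')
  imix : ∀ {x y x' y' l' s t : ℝ}, I x y → F x' y' l' → 0 < s → 0 ≤ t → s + t = 1 →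
    I (s * x + t * x') (s * y + t * y')
  ipos : ∀ {x y : ℝ}, I x y → ∃ l, 0 < l ∧ F x y l
  supp : ∀ {x y : ℝ}, ¬ I x y → ∃ α β : ℝ, ∀ x' y', I x' y' → α * x' + β * y' < α * x + β * y
  push : ∀ {x y α β : ℝ}, I x y → (α ≠ 0 ∨ β ≠ 0) →
    ∃ p q : ℤ, F p q 0 ∧ α * x + β * y < α * p + β * q
  cap : ∀ {x y : ℤ} {l : ℝ}, I x y → F x y l →
    l ≤ 1 + (if x = sa1 ∧ y = sa2 then 1 else 0) + (if x = sb1 ∧ y = sb2 then 1 else 0)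
  isa : I sa1 sa2
  len : ∀ {x y : ℝ}, F x y 0 → ∃ l, F x y l ∧ ∀ l', F x y l' → l' ≤ l
  nF : ∀ {x y : ℤ}, 1 ≤ n x y → F x y ((n x y : ℝ) - 1)
  fin : {w : ℤ × ℤ | F w.1 w.2 0}.Finite

/-- Integral unimodular affine maps of the plane. -/
structure Aff where
  a : ℤ
  b : ℤ
  c : ℤ
  d : ℤ
  e : ℤ
  f : ℤ
  det : a * d - b * c = 1 ∨ a * d - b * c = -1

namespace Aff

/-- first coordinate -/
def X (ψ : Aff) (x y : ℤ) : ℤ := ψ.a * x + ψ.b * y + ψ.e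
/-- second coordinate -/
def Y (ψ : Aff) (x y : ℤ) : ℤ := ψ.c * x + ψ.d * y + ψ.f
/-- first coordinate of the inverse -/
def X' (ψ : Aff) (x y : ℤ) : ℤ := (ψ.a * ψ.d - ψ.b * ψ.c) * (ψ.d * (x - ψ.e) - ψ.b * (y - ψ.f))
/-- second coordinate of the inverse -/
def Y' (ψ : Aff) (x y : ℤ) : ℤ := (ψ.a * ψ.d - ψ.b * ψ.c) * (-ψ.c * (x - ψ.e) + ψ.a * (y - ψ.f))

lemma sq (ψ : Aff) : (ψ.a * ψ.d - ψ.b * ψ.c) * (ψ.a * ψ.d - ψ.b * ψ.c) = 1 := by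
  rcases ψ.det with h | h <;> rw [h] <;> norm_num

lemma XX' (ψ : Aff) (x y : ℤ) : ψ.X (ψ.X' x y) (ψ.Y' x y) = x := by
  have := ψ.sq
  unfold X X' Y'
  linear_combination (x - ψ.e) * this

lemma YY' (ψ : Aff) (x y : ℤ) : ψ.Y (ψ.X' x y) (ψ.Y' x y) = y := by
  have := ψ.sq
  unfold Y X' Y'
  linear_combination (y - ψ.f) * this

lemma X'X (ψ : Aff) (x y : ℤ) : ψ.X' (ψ.X x y) (ψ.Y x y) = x := by
  have := ψ.sq
  unfold X' X Y
  linear_combination x * this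

lemma Y'Y (ψ : Aff) (x y : ℤ) : ψ.Y' (ψ.X x y) (ψ.Y x y) = y := by
  have := ψ.sq
  unfold Y' X Y
  linear_combination y * this

/-- the lattice bijection -/
def equiv (ψ : Aff) : ℤ × ℤ ≃ ℤ × ℤ where
  toFun w := (ψ.X w.1 w.2, ψ.Y w.1 w.2)
  invFun w := (ψ.X' w.1 w.2, ψ.Y' w.1 w.2)
  left_inv w := by ext <;> simp [X'X, Y'Y]
  right_inv w := by ext <;> simp [XX', YY']

/-- composition: first `φ`, then `ψ` -/
def comp (ψ φ : Aff) : Aff where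
  a := ψ.a * φ.a + ψ.b * φ.c
  b := ψ.a * φ.b + ψ.b * φ.d
  c := ψ.c * φ.a + ψ.d * φ.c
  d := ψ.c * φ.b + ψ.d * φ.d
  e := ψ.a * φ.e + ψ.b * φ.f + ψ.e
  f := ψ.c * φ.e + ψ.d * φ.f + ψ.f
  det := by
    have h : (ψ.a * φ.a + ψ.b * φ.c) * (ψ.c * φ.b + ψ.d * φ.d) -
      (ψ.a * φ.b + ψ.b * φ.d) * (ψ.c * φ.a + ψ.d * φ.c) =
      (ψ.a * ψ.d - ψ.b * ψ.c) * (φ.a * φ.d - φ.b * φ.c) := by ring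
    rw [h]
    rcases ψ.det with h1 | h1 <;> rcases φ.det with h2 | h2 <;> rw [h1, h2] <;> norm_num

lemma comp_X (ψ φ : Aff) (x y : ℤ) : (ψ.comp φ).X x y = ψ.X (φ.X x y) (φ.Y x y) := by
  unfold comp X Y; ring

lemma comp_Y (ψ φ : Aff) (x y : ℤ) : (ψ.comp φ).Y x y = ψ.Y (φ.X x y) (φ.Y x y) := by
  unfold comp X Y; ring

end Aff

namespace Dat

variable (D : Dat)

lemma mix2 {x y l x' y' l' s t X Y L : ℝ} (h : D.F x y l) (h' : D.F x' y' l')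
    (hs : 0 ≤ s) (ht : 0 ≤ t) (hst : s + t = 1) (hX : X = s * x + t * x')
    (hY : Y = s * y + t * y') (h0 : 0 ≤ L) (hL : L ≤ s * l + t * l') : D.F X Y L := by
  subst hX hY
  exact D.mono (D.conv h h' hs ht hst) h0 hL

lemma imix2 {x y x' y' l' s t X Y : ℝ} (h : D.I x y) (h' : D.F x' y' l')
    (hs : 0 < s) (ht : 0 ≤ t) (hst : s + t = 1) (hX : X = s * x + t * x')
    (hY : Y = s * y + t * y') : D.I X Y := by
  subst hX hY
  exact D.imix h h' hs ht hst

lemma zero {x y l : ℝ} (h : D.F x y l) : D.F x y 0 := D.mono h le_rfl (D.nonneg h)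

lemma iF {x y : ℝ} (h : D.I x y) : D.F x y 0 := by
  obtain ⟨l, _, hl⟩ := D.ipos h
  exact D.zero hl

lemma mix3 {x y l x' y' l' x'' y'' l'' s t u X Y L : ℝ} (h : D.F x y l) (h' : D.F x' y' l')
    (h'' : D.F x'' y'' l'')
    (hs : 0 ≤ s) (ht : 0 ≤ t) (hu : 0 ≤ u) (hst : s + t + u = 1)
    (hX : X = s * x + t * x' + u * x'')
    (hY : Y = s * y + t * y' + u * y'') (h0 : 0 ≤ L) (hL : L ≤ s * l + t * l' + u * l'') :
    D.F X Y L := by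
  by_cases hz : s + t = 0
  · have hs0 : s = 0 := by linarith
    have ht0 : t = 0 := by linarith
    have hu1 : u = 1 := by linarith
    subst hs0 ht0 hu1
    simp at hX hY hL
    subst hX hY
    exact D.mono h'' h0 hL
  · have hp : 0 < s + t := lt_of_le_of_ne (by linarith) (Ne.symm hz)
    have h1 := D.conv h h' (s := s / (s + t)) (t := t / (s + t)) (by positivity) (by positivity)
      (by field_simp)
    refine D.mix2 h1 h'' (s := s + t) (t := u) hp.le hu hst ?_ ?_ h0 ?_
    · rw [hX]; field_simp
    · rw [hY]; field_simp
    · refine hL.trans (le_of_eq ?_); field_simp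

lemma imix3 {x y x' y' l' x'' y'' l'' s t u X Y : ℝ} (h : D.I x y) (h' : D.F x' y' l')
    (h'' : D.F x'' y'' l'')
    (hs : 0 < s) (ht : 0 ≤ t) (hu : 0 ≤ u) (hst : s + t + u = 1)
    (hX : X = s * x + t * x' + u * x'')
    (hY : Y = s * y + t * y' + u * y'') : D.I X Y := by
  have hp : 0 < s + t := by linarith
  have h1 := D.imix h h' (s := s / (s + t)) (t := t / (s + t)) (by positivity) (by positivity)
    (by field_simp)
  refine D.imix2 h1 h'' (s := s + t) (t := u) hp hu hst ?_ ?_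
  · rw [hX]; field_simp
  · rw [hY]; field_simp

lemma cap3 {x y : ℤ} {l : ℝ} (h : D.I x y) (hF : D.F x y l) : l ≤ 3 := by
  have := D.cap h hF
  split_ifs at this <;> linarith

lemma capsum2 {x y x' y' : ℤ} {l l' : ℝ} (h : D.I x y) (hF : D.F x y l)
    (h' : D.I x' y') (hF' : D.F x' y' l') (hne : x ≠ x' ∨ y ≠ y') : l + l' ≤ 4 := by
  have h1 := D.cap h hF
  have h2 := D.cap h' hF'
  split_ifs at h1 h2 <;> first | linarith | (exfalso; omega)

lemma capsum3 {x y x' y' x'' y'' : ℤ} {l l' l'' : ℝ} (h : D.I x y) (hF : D.F x y l)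
    (h' : D.I x' y') (hF' : D.F x' y' l') (h'' : D.I x'' y'') (hF'' : D.F x'' y'' l'')
    (hne : x ≠ x' ∨ y ≠ y') (hne' : x ≠ x'' ∨ y ≠ y'') (hne'' : x' ≠ x'' ∨ y' ≠ y'') :
    l + l' + l'' ≤ 5 := by
  have h1 := D.cap h hF
  have h2 := D.cap h' hF'
  have h3 := D.cap h'' hF''
  split_ifs at h1 h2 h3 <;> first | linarith | (exfalso; omega)

/-- if one fibre is longer than two, every other one has length at most one -/
lemma ex21 {x y x' y' : ℤ} {l l' : ℝ} (h : D.I x y) (hF : D.F x y l)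
    (h' : D.I x' y') (hF' : D.F x' y' l') (hne : x ≠ x' ∨ y ≠ y') (h2 : 2 < l) : l' ≤ 1 := by
  have h1 := D.cap h hF
  have h2 := D.cap h' hF'
  split_ifs at h1 h2 <;> first | linarith | (exfalso; omega)

/-- pullback along a unimodular affine map -/
def map (ψ : Aff) : Dat where
  F x y l := D.F (ψ.a * x + ψ.b * y + ψ.e) (ψ.c * x + ψ.d * y + ψ.f) l
  I x y := D.I (ψ.a * x + ψ.b * y + ψ.e) (ψ.c * x + ψ.d * y + ψ.f)
  n x y := D.n (ψ.X x y) (ψ.Y x y)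
  sa1 := ψ.X' D.sa1 D.sa2
  sa2 := ψ.Y' D.sa1 D.sa2
  sb1 := ψ.X' D.sb1 D.sb2
  sb2 := ψ.Y' D.sb1 D.sb2
  nonneg h := D.nonneg h
  mono h h0 hl := D.mono h h0 hl
  conv h h' hs ht hst := D.mix2 h h' hs ht hst
    (by linear_combination (-(ψ.e : ℝ)) * hst) (by linear_combination (-(ψ.f : ℝ)) * hst)
    (add_nonneg (mul_nonneg hs (D.nonneg h)) (mul_nonneg ht (D.nonneg h'))) le_rfl
  imix h h' hs ht hst := D.imix2 h h' hs ht hst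
    (by linear_combination (-(ψ.e : ℝ)) * hst) (by linear_combination (-(ψ.f : ℝ)) * hst)
  ipos h := D.ipos h
  supp {x y} h := by
    obtain ⟨α, β, hab⟩ := D.supp h
    refine ⟨α * ψ.a + β * ψ.c, α * ψ.b + β * ψ.d, fun x' y' h' => ?_⟩
    have := hab _ _ h'
    nlinarith
  push {x y α β} h hab := by
    have hsq : ((ψ.a : ℝ) * ψ.d - ψ.b * ψ.c) * (ψ.a * ψ.d - ψ.b * ψ.c) = 1 := by
      exact_mod_cast ψ.sq
    set δ : ℝ := (ψ.a : ℝ) * ψ.d - ψ.b * ψ.c with hδ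
    have hne : δ * (α * ψ.d - β * ψ.c) ≠ 0 ∨ δ * (-α * ψ.b + β * ψ.a) ≠ 0 := by
      by_contra hcon
      push Not at hcon
      obtain ⟨h1, h2⟩ := hcon
      have ha : α = 0 := by
        linear_combination ψ.a * h1 + ψ.c * h2 - α * hsq + α * δ * hδ
      have hb : β = 0 := by
        linear_combination ψ.b * h1 + ψ.d * h2 - β * hsq + β * δ * hδ
      rcases hab with h | h <;> contradiction
    obtain ⟨p, q, hF, hlt⟩ := D.push h hne
    have e1 : (ψ.a : ℝ) * (ψ.X' p q : ℤ) + ψ.b * (ψ.Y' p q : ℤ) + ψ.e = p := by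
      exact_mod_cast ψ.XX' p q
    have e2 : (ψ.c : ℝ) * (ψ.X' p q : ℤ) + ψ.d * (ψ.Y' p q : ℤ) + ψ.f = q := by
      exact_mod_cast ψ.YY' p q
    refine ⟨ψ.X' p q, ψ.Y' p q, ?_, ?_⟩
    · rw [e1, e2]; exact hF
    · rw [← e1, ← e2] at hlt
      generalize ((ψ.X' p q : ℤ) : ℝ) = P at *
      generalize ((ψ.Y' p q : ℤ) : ℝ) = Q at *
      have k1 : ∀ u v : ℝ, δ * (α * ψ.d - β * ψ.c) * (ψ.a * u + ψ.b * v + ψ.e) +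
          δ * (-α * ψ.b + β * ψ.a) * (ψ.c * u + ψ.d * v + ψ.f) = α * u + β * v +
          (δ * (α * ψ.d - β * ψ.c) * ψ.e + δ * (-α * ψ.b + β * ψ.a) * ψ.f) := by
        intro u v
        linear_combination (α * u + β * v) * hsq - δ * (α * u + β * v) * hδ
      rw [k1, k1] at hlt
      linarith
  cap {x y l} h hF := by
    have e1 : (ψ.a : ℝ) * x + ψ.b * y + ψ.e = (ψ.X x y : ℤ) := by simp [Aff.X]
    have e2 : (ψ.c : ℝ) * x + ψ.d * y + ψ.f = (ψ.Y x y : ℤ) := by simp [Aff.Y]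
    rw [e1, e2] at h hF
    have := D.cap h hF
    have key : ∀ u v : ℤ, (x = ψ.X' u v ∧ y = ψ.Y' u v) ↔ (ψ.X x y = u ∧ ψ.Y x y = v) := by
      intro u v
      constructor
      · rintro ⟨rfl, rfl⟩; exact ⟨ψ.XX' u v, ψ.YY' u v⟩
      · rintro ⟨rfl, rfl⟩; exact ⟨(ψ.X'X x y).symm, (ψ.Y'Y x y).symm⟩
    simp only [key]
    exact this
  isa := by
    have e1 : (ψ.a : ℝ) * (ψ.X' D.sa1 D.sa2 : ℤ) + ψ.b * (ψ.Y' D.sa1 D.sa2 : ℤ) + ψ.e = D.sa1 := by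
      exact_mod_cast ψ.XX' _ _
    have e2 : (ψ.c : ℝ) * (ψ.X' D.sa1 D.sa2 : ℤ) + ψ.d * (ψ.Y' D.sa1 D.sa2 : ℤ) + ψ.f = D.sa2 := by
      exact_mod_cast ψ.YY' _ _
    rw [e1, e2]; exact D.isa
  len h := D.len h
  nF {x y} h := by
    have e1 : (ψ.a : ℝ) * x + ψ.b * y + ψ.e = (ψ.X x y : ℤ) := by simp [Aff.X]
    have e2 : (ψ.c : ℝ) * x + ψ.d * y + ψ.f = (ψ.Y x y : ℤ) := by simp [Aff.Y]
    rw [e1, e2]; exact D.nF h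
  fin := by
    have := D.fin.preimage (f := ψ.equiv) ψ.equiv.injective.injOn
    refine this.subset ?_
    intro w hw
    simp only [mem_preimage, Set.mem_ofPred_eq, Aff.equiv, Equiv.coe_fn_mk] at hw ⊢
    convert hw using 1 <;> simp [Aff.X, Aff.Y]

/-- number of lattice points -/
def N : ℕ := ∑ᶠ w : ℤ × ℤ, D.n w.1 w.2

/-- number of lattice points having another one five steps below -/
def big : ℕ := ∑ᶠ w : ℤ × ℤ, (D.n w.1 w.2 - 5)

lemma map_N (ψ : Aff) : (D.map ψ).N = D.N := by
  unfold N
  exact finsum_comp_equiv ψ.equiv (f := fun w : ℤ × ℤ => D.n w.1 w.2)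

lemma map_big (ψ : Aff) : (D.map ψ).big = D.big := by
  unfold big
  exact finsum_comp_equiv ψ.equiv (f := fun w : ℤ × ℤ => D.n w.1 w.2 - 5)

lemma map_F (ψ : Aff) (x y : ℤ) (l : ℝ) :
    (D.map ψ).F x y l ↔ D.F (ψ.X x y : ℤ) (ψ.Y x y : ℤ) l := by
  have e1 : (ψ.a : ℝ) * x + ψ.b * y + ψ.e = (ψ.X x y : ℤ) := by simp [Aff.X]
  have e2 : (ψ.c : ℝ) * x + ψ.d * y + ψ.f = (ψ.Y x y : ℤ) := by simp [Aff.Y]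
  show D.F _ _ _ ↔ _
  rw [e1, e2]

lemma map_I (ψ : Aff) (x y : ℤ) :
    (D.map ψ).I x y ↔ D.I (ψ.X x y : ℤ) (ψ.Y x y : ℤ) := by
  have e1 : (ψ.a : ℝ) * x + ψ.b * y + ψ.e = (ψ.X x y : ℤ) := by simp [Aff.X]
  have e2 : (ψ.c : ℝ) * x + ψ.d * y + ψ.f = (ψ.Y x y : ℤ) := by simp [Aff.Y]
  show D.I _ _ ↔ _
  rw [e1, e2]

lemma map_n (ψ : Aff) (x y : ℤ) : (D.map ψ).n x y = D.n (ψ.X x y) (ψ.Y x y) := rfl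

/-- points of the projection satisfy supporting inequalities weakly -/
lemma supp' {x y : ℝ} (h : ¬ D.I x y) : ∃ α β : ℝ,
    (∀ x' y', D.I x' y' → α * x' + β * y' < α * x + β * y) ∧
    (∀ x' y' l, D.F x' y' l → α * x' + β * y' ≤ α * x + β * y) := by
  obtain ⟨α, β, hab⟩ := D.supp h
  refine ⟨α, β, hab, fun x' y' l hF => ?_⟩
  by_contra hcon
  push Not at hcon
  have h0 := hab _ _ D.isa
  set c := α * x + β * y
  set u := α * D.sa1 + β * D.sa2 with hu
  set v := α * x' + β * y' with hv
  have hd : 0 < v - u := by linarith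
  have := hab _ _ (D.imix D.isa hF (s := (v - c) / (v - u)) (t := (c - u) / (v - u))
    (div_pos (by linarith) hd) (div_nonneg (by linarith) hd.le) (by field_simp; ring))
  have e : α * ((v - c) / (v - u) * D.sa1 + (c - u) / (v - u) * x') +
      β * ((v - c) / (v - u) * D.sa2 + (c - u) / (v - u) * y') =
      (v - c) / (v - u) * u + (c - u) / (v - u) * v := by rw [hu, hv]; ring
  rw [e] at this
  have e2 : (v - c) / (v - u) * u + (c - u) / (v - u) * v = c := by field_simp; ring
  linarith

/-- a point strictly inside a horizontal row with points above and below is interior -/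
lemma rowInt {L R m y : ℝ} {l1 l2 : ℝ} (hL : D.F L y l1) (hR : D.F R y l2) (h1 : L < m)
    (h2 : m < R) {u1 u2 d1 d2 l3 l4 : ℝ} (hu : D.F u1 u2 l3) (hu2 : y < u2)
    (hd : D.F d1 d2 l4) (hd2 : d2 < y) : D.I m y := by
  by_contra h
  obtain ⟨α, β, hI, hF⟩ := D.supp' h
  have a1 := hF _ _ _ hL
  have a2 := hF _ _ _ hR
  have hα : α = 0 := by
    rcases lt_trichotomy α 0 with h | h | h
    · nlinarith
    · exact h
    · nlinarith
  subst hα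
  have a3 := hF _ _ _ hu
  have a4 := hF _ _ _ hd
  have hβ : β = 0 := by
    rcases lt_trichotomy β 0 with h | h | h
    · nlinarith
    · exact h
    · nlinarith
  subst hβ
  have := hI _ _ D.isa
  simp at this

/-- lattice points of the projection lie in three consecutive lattice lines -/
def W2 : Prop := ∃ ψ : Aff, ∀ x y : ℤ, (D.map ψ).F x y 0 → 0 ≤ x ∧ x ≤ 2

lemma W2_of_y (ψ : Aff) (c : ℤ) (h : ∀ x y : ℤ, (D.map ψ).F x y 0 → c ≤ y ∧ y ≤ c + 2) :
    D.W2 := by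
  let φ : Aff := ⟨0, 1, 1, 0, 0, c, by norm_num⟩
  refine ⟨ψ.comp φ, fun x y hF => ?_⟩
  rw [map_F, Aff.comp_X, Aff.comp_Y, ← map_F] at hF
  have := h _ _ hF
  simp [φ, Aff.Y] at this
  omega

lemma W2_map (ψ : Aff) (h : (D.map ψ).W2) : D.W2 := by
  obtain ⟨φ, hφ⟩ := h
  refine ⟨ψ.comp φ, fun x y hF => hφ x y ?_⟩
  rw [map_F, Aff.comp_X, Aff.comp_Y] at hF
  rw [map_F, map_F]; exact hF

end Dat

/-- coordinates in which two given lattice points lie on the first axis -/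
lemma exists_aff (p q r s : ℤ) (h : p ≠ r ∨ q ≠ s) : ∃ (ψ : Aff) (g : ℤ), 0 < g ∧
    ψ.X 0 0 = p ∧ ψ.Y 0 0 = q ∧ ψ.X g 0 = r ∧ ψ.Y g 0 = s := by
  have hg : 0 < Int.gcd (r - p) (s - q) := by
    rw [Nat.pos_iff_ne_zero, Ne, Int.gcd_eq_zero_iff]
    rintro ⟨h1, h2⟩
    rcases h with h | h <;> apply h <;> omega
  obtain ⟨u, hu⟩ := Int.gcd_dvd_left (a := r - p) (b := s - q)
  obtain ⟨v, hv⟩ := Int.gcd_dvd_right (a := r - p) (b := s - q)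
  have hb := Int.gcd_eq_gcd_ab (r - p) (s - q)
  set g : ℤ := ((Int.gcd (r - p) (s - q) : ℕ) : ℤ) with hgdef
  have hg0 : 0 < g := Int.natCast_pos.2 hg
  set A := Int.gcdA (r - p) (s - q)
  set B := Int.gcdB (r - p) (s - q)
  have hone : u * A + v * B = 1 := by
    have : g * (u * A + v * B) = g * 1 := by
      rw [hu, hv] at hb
      linear_combination -hb
    exact mul_left_cancel₀ hg0.ne' this
  refine ⟨⟨u, -B, v, A, p, q, Or.inl (by linear_combination hone)⟩, g, hg0, ?_, ?_, ?_, ?_⟩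
  · simp [Aff.X]
  · simp [Aff.Y]
  · simp only [Aff.X]; linear_combination -hu
  · simp only [Aff.Y]; linear_combination -hv

lemma tri_aux (g a d : ℤ) (hg : 0 < g) (h : 2 ≤ |g * d|) : ∃ (x y : ℤ) (α β : ℝ), 0 ≤ α ∧ 0 ≤ β ∧
    α + β ≤ 1 ∧ (x : ℝ) = α * g + β * a ∧ (y : ℝ) = β * d ∧
    ¬ (x = 0 ∧ y = 0) ∧ ¬ (x = g ∧ y = 0) ∧ ¬ (x = a ∧ y = d) := by
  have hd0 : d ≠ 0 := by rintro rfl; simp at h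
  by_cases hg2 : 2 ≤ g
  · have hgr : (2 : ℝ) ≤ g := by exact_mod_cast hg2
    refine ⟨1, 0, 1 / g, 0, by positivity, le_rfl, ?_, ?_, by simp, by omega, by omega, by omega⟩
    · rw [add_zero, div_le_one (by linarith)]; linarith
    · field_simp; simp
  · have hg1 : g = 1 := by omega
    subst hg1
    rw [one_mul] at h
    obtain ⟨e, m, he, hm, hme⟩ : ∃ e m : ℤ, (e = 1 ∨ e = -1) ∧ 2 ≤ m ∧ d = e * m := by
      rcases le_total 0 d with h0 | h0
      · exact ⟨1, d, Or.inl rfl, by rwa [abs_of_nonneg h0] at h, by ring⟩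
      · exact ⟨-1, -d, Or.inr rfl, by rwa [abs_of_nonpos h0] at h, by ring⟩
    have h1 := Int.emod_nonneg (-a) (b := m) (by omega)
    have h2 := Int.emod_lt_of_pos (-a) (b := m) (by omega)
    have h3 := Int.mul_ediv_add_emod (-a) m
    set r := (-a) % m
    set x := -((-a) / m) with hx
    have hr : r = m * x - a := by rw [hx]; linear_combination h3
    have hmr : (2 : ℝ) ≤ m := by exact_mod_cast hm
    have hrr : (r : ℝ) = m * x - a := by exact_mod_cast hr
    have h1r : (0 : ℝ) ≤ r := by exact_mod_cast h1
    have h2r : (r : ℝ) + 1 ≤ m := by exact_mod_cast h2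
    have hm0 : (0 : ℝ) < m := by linarith
    refine ⟨x, e, r / m, 1 / m, by positivity, by positivity, ?_, ?_, ?_, by omega, by omega, ?_⟩
    · rw [← add_div, div_le_one hm0]; exact h2r
    · rw [hrr]; field_simp; push_cast; ring
    · rw [hme]; push_cast; field_simp
    · rintro ⟨-, h5⟩
      rcases he with rfl | rfl <;> omega

/-- a lattice triangle of normalised area at least two contains a further lattice point -/
lemma tri (p q r s : ℤ) (h : 2 ≤ |p * s - q * r|) : ∃ (x y : ℤ) (α β : ℝ), 0 ≤ α ∧ 0 ≤ β ∧
    α + β ≤ 1 ∧ (x : ℝ) = α * p + β * r ∧ (y : ℝ) = α * q + β * s ∧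
    ¬ (x = 0 ∧ y = 0) ∧ ¬ (x = p ∧ y = q) ∧ ¬ (x = r ∧ y = s) := by
  have hne : (0 : ℤ) ≠ p ∨ (0 : ℤ) ≠ q := by
    by_contra hcon
    push Not at hcon
    rw [← hcon.1, ← hcon.2] at h
    simp at h
  obtain ⟨ψ, g, hg, h1, h2, h3, h4⟩ := exists_aff 0 0 p q hne
  have he : ψ.e = 0 := by simpa [Aff.X] using h1
  have hf : ψ.f = 0 := by simpa [Aff.Y] using h2
  have hr := ψ.XX' r s
  have hs := ψ.YY' r s
  set a := ψ.X' r s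
  set d := ψ.Y' r s
  have hdet : |g * d| = |p * s - q * r| := by
    have : p * s - q * r = (ψ.a * ψ.d - ψ.b * ψ.c) * (g * d) := by
      rw [← h3, ← h4, ← hr, ← hs]; simp only [Aff.X, Aff.Y, he, hf]; ring
    rw [this, abs_mul]
    rcases ψ.det with h | h <;> rw [h] <;> simp
  obtain ⟨x, y, α, β, hα, hβ, hab, hx, hy, n1, n2, n3⟩ := tri_aux g a d hg (by rw [hdet]; exact h)
  refine ⟨ψ.X x y, ψ.Y x y, α, β, hα, hβ, hab, ?_, ?_, ?_, ?_, ?_⟩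
  · rw [← h3, ← hr]; simp only [Aff.X, he]; push_cast; rw [hx, hy]; ring
  · rw [← h4, ← hs]; simp only [Aff.Y, hf]; push_cast; rw [hx, hy]; ring
  · rintro ⟨e1, e2⟩
    apply n1
    have := ψ.X'X x y; have h' := ψ.Y'Y x y
    have := ψ.X'X 0 0; have := ψ.Y'Y 0 0
    simp_all
  · rintro ⟨e1, e2⟩
    apply n2
    have := ψ.X'X x y; have h' := ψ.Y'Y x y
    have := ψ.X'X g 0; have := ψ.Y'Y g 0
    simp_all
  · rintro ⟨e1, e2⟩
    apply n3
    have := ψ.X'X x y; have h' := ψ.Y'Y x y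
    constructor
    · rw [← this, e1, e2]
    · rw [← h', e1, e2]

lemma ex_int (L : ℝ) : ∃ m : ℤ, L < m ∧ (m : ℝ) ≤ L + 1 := by
  refine ⟨⌊L⌋ + 1, ?_, ?_⟩
  · push_cast; exact Int.lt_floor_add_one L
  · push_cast; linarith [Int.floor_le L]

namespace Dat

variable (D : Dat)

lemma W2_of_y' (c : ℤ) (h : ∀ x y : ℤ, D.F x y 0 → c ≤ y ∧ y ≤ c + 2) : D.W2 := by
  refine D.W2_of_y ⟨1, 0, 0, 1, 0, 0, by norm_num⟩ c fun x y hF => h x y ?_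
  rw [map_F] at hF
  simpa [Aff.X, Aff.Y] using hF

/-- reflection in the first axis -/
def rY : Aff := ⟨1, 0, 0, -1, 0, 0, by norm_num⟩

/-- exchange of coordinates -/
def sw : Aff := ⟨0, 1, 1, 0, 0, 0, by norm_num⟩

lemma rY_F (x y l : ℝ) : (D.map rY).F x y l ↔ D.F x (-y) l := by
  simp [map, rY]

lemma rY_I (x y : ℝ) : (D.map rY).I x y ↔ D.I x (-y) := by
  simp [map, rY]

lemma sw_F (x y l : ℝ) : (D.map sw).F x y l ↔ D.F y x l := by
  simp [map, sw]

lemma sw_I (x y : ℝ) : (D.map sw).I x y ↔ D.I y x := by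
  simp [map, sw]

/-- rows are convex -/
lemma rowF {A B x y l : ℝ} (hA : D.F A y l) (hB : D.F B y l) (h1 : A ≤ x) (h2 : x ≤ B) :
    D.F x y l := by
  rcases eq_or_lt_of_le (h1.trans h2) with h | h
  · have : x = A := by linarith
    rwa [this]
  · have hp : 0 < B - A := by linarith
    refine D.mix2 hA hB (s := (B - x) / (B - A)) (t := (x - A) / (B - A))
      (div_nonneg (by linarith) hp.le) (div_nonneg (by linarith) hp.le) ?_ ?_ ?_ (D.nonneg hA) ?_
    · field_simp; ring
    · field_simp; ring
    · field_simp; ring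
    · apply le_of_eq; field_simp; ring

/-- tent bound -/
lemma tent {L R c x y h θ : ℝ} (hL : D.F L y 0) (hR : D.F R y 0) (hc : D.F c y h)
    (h0 : 0 ≤ θ) (h1 : θ ≤ 1)
    (hx1 : L + θ * (c - L) ≤ x) (hx2 : x ≤ R - θ * (R - c)) : D.F x y (θ * h) := by
  have hn := D.nonneg hc
  refine D.rowF (A := L + θ * (c - L)) (B := R - θ * (R - c)) ?_ ?_ hx1 hx2
  · exact D.mix2 hL hc (s := 1 - θ) (t := θ) (by linarith) h0 (by ring) (by ring) (by ring)
      (by positivity) (by linarith)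
  · exact D.mix2 hR hc (s := 1 - θ) (t := θ) (by linarith) h0 (by ring) (by ring) (by ring)
      (by positivity) (by linarith)

lemma row_false {L R c : ℝ} {y : ℤ} (hL : D.F L y 0) (hR : D.F R y 0) (hc : D.F c y (10 / 3))
    (hLR : 10 / 3 ≤ R - L) {u1 u2 d1 d2 l3 l4 : ℝ} (hu : D.F u1 u2 l3) (hu2 : y < u2)
    (hd : D.F d1 d2 l4) (hd2 : d2 < y) : False := by
  wlog hcL : L ≤ c generalizing L
  · exact this (D.zero hc) (by linarith) le_rfl
  wlog hcR : c ≤ R generalizing R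
  · exact this (D.zero hc) (by linarith) le_rfl
  have hi : ∀ m : ℤ, L < m → (m : ℝ) < R → D.I m y :=
    fun m h1 h2 => D.rowInt hL hR h1 h2 hu hu2 hd hd2
  obtain ⟨m, hm1, hm2⟩ := ex_int (L + 33 / 100 * (c - L))
  obtain ⟨k, hk1, hk2⟩ := ex_int (L + 62 / 100 * (c - L))
  have f1 : D.F m y (33 / 100 * (10 / 3)) := D.tent hL hR hc (by norm_num) (by norm_num)
    hm1.le (by linarith)
  have f2 : D.F (m + 1 : ℤ) y (33 / 100 * (10 / 3)) := by
    push_cast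
    exact D.tent hL hR hc (by norm_num) (by norm_num) (by linarith) (by linarith)
  have f3 : D.F k y (62 / 100 * (10 / 3)) := D.tent hL hR hc (by norm_num) (by norm_num)
    hk1.le (by linarith)
  have i1 : D.I m y := hi m (by linarith) (by linarith)
  have i2 : D.I (m + 1 : ℤ) y := hi (m + 1) (by push_cast; linarith) (by push_cast; linarith)
  have i3 : D.I k y := hi k (by linarith) (by linarith)
  by_cases hkm : k = m
  · have := D.ex21 i3 f3 i2 f2 (Or.inl (by omega)) (by norm_num)
    norm_num at this
  · have := D.ex21 i3 f3 i1 f1 (Or.inl hkm) (by norm_num)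
    norm_num at this

/-- in a row with a long fibre at a lattice point, next to a long stretch -/
lemma step_right {x0 : ℤ} {R h : ℝ} {y : ℤ} (hz : D.F x0 y 5) (hR : D.F R y 0)
    (hh : x0 + h ≤ R) (h1 : 1 < h) {u1 u2 d1 d2 l3 l4 : ℝ} (hu : D.F u1 u2 l3) (hu2 : y < u2)
    (hd : D.F d1 d2 l4) (hd2 : d2 < y) :
    D.I (x0 + 1 : ℤ) y ∧ D.F (x0 + 1 : ℤ) y (5 * (1 - 1 / h)) := by
  have hp : 0 < R - x0 := by linarith
  constructor
  · refine D.rowInt hz hR ?_ ?_ hu hu2 hd hd2 <;> push_cast <;> linarith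
  · refine D.mix2 hz hR (s := 1 - 1 / (R - x0)) (t := 1 / (R - x0)) ?_ (by positivity) (by ring)
      ?_ (by ring) ?_ ?_
    · rw [sub_nonneg, div_le_one hp]; linarith
    · push_cast; field_simp; ring
    · have : 1 / h ≤ 1 := by rw [div_le_one (by linarith)]; exact h1.le
      linarith
    · have : 1 / (R - x0) ≤ 1 / h := one_div_le_one_div_of_le (by linarith) (by linarith)
      linarith

lemma step_left {x0 : ℤ} {L h : ℝ} {y : ℤ} (hz : D.F x0 y 5) (hL : D.F L y 0)
    (hh : L + h ≤ x0) (h1 : 1 < h) {u1 u2 d1 d2 l3 l4 : ℝ} (hu : D.F u1 u2 l3) (hu2 : y < u2)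
    (hd : D.F d1 d2 l4) (hd2 : d2 < y) :
    D.I (x0 - 1 : ℤ) y ∧ D.F (x0 - 1 : ℤ) y (5 * (1 - 1 / h)) := by
  have hp : 0 < x0 - L := by linarith
  constructor
  · refine D.rowInt hL hz ?_ ?_ hu hu2 hd hd2 <;> push_cast <;> linarith
  · refine D.mix2 hz hL (s := 1 - 1 / (x0 - L)) (t := 1 / (x0 - L)) ?_ (by positivity) (by ring)
      ?_ (by ring) ?_ ?_
    · rw [sub_nonneg, div_le_one hp]; linarith
    · push_cast; field_simp; ring
    · have : 1 / h ≤ 1 := by rw [div_le_one (by linarith)]; exact h1.le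
      linarith
    · have : 1 / (x0 - L) ≤ 1 / h := one_div_le_one_div_of_le (by linarith) (by linarith)
      linarith

/-- the segment of length five seen from a point of height `H`, in row one -/
lemma shrink {p H : ℝ} (h0 : D.F 0 0 0) (h5 : D.F 5 0 0) (hp : D.F p H 0) (hH : 1 ≤ H) :
    D.F (p / H) 1 0 ∧ D.F (p / H + 5 * (1 - 1 / H)) 1 0 := by
  have hH0 : 0 < H := by linarith
  have hi : 1 / H ≤ 1 := by rw [div_le_one hH0]; exact hH
  constructor
  · exact D.mix2 h0 hp (s := 1 - 1 / H) (t := 1 / H) (by linarith) (by positivity) (by ring)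
      (by field_simp; ring) (by field_simp; ring) le_rfl (by simp)
  · exact D.mix2 h5 hp (s := 1 - 1 / H) (t := 1 / H) (by linarith) (by positivity) (by ring)
      (by field_simp; ring) (by field_simp; ring) le_rfl (by simp)

lemma inv3 {H : ℝ} (h : 3 ≤ H) : 1 / H ≤ 1 / 3 :=
  one_div_le_one_div_of_le (by norm_num) h

lemma np_i_side {x0 : ℤ} (h0 : D.F 0 0 0) (h5 : D.F 5 0 0) (hz : D.F x0 0 5) {p H : ℝ}
    (hp : D.F p H 0) (hH : 3 ≤ H) : False := by
  obtain ⟨a, b⟩ := D.shrink h0 h5 hp (by linarith)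
  have hi := inv3 hH
  have hi0 : 0 < 1 / H := by positivity
  have c : D.F (p / H + x0 * (1 - 1 / H)) 1 (10 / 3) :=
    D.mix2 hz hp (s := 1 - 1 / H) (t := 1 / H) (by linarith) (by positivity) (by ring)
      (by ring) (by field_simp; ring) (by norm_num) (by linarith)
  have e1 : ((1 : ℤ) : ℝ) = 1 := by norm_num
  rw [← e1] at a b c
  exact D.row_false a b c (by linarith) hp (by push_cast; linarith) h0 (by norm_num)

lemma np_i {x0 : ℤ} (h0 : D.F 0 0 0) (h5 : D.F 5 0 0) (hz : D.F x0 0 5) : D.W2 := by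
  have up : ∀ x y : ℤ, D.F x y 0 → y ≤ 2 := by
    intro x y h
    by_contra hc
    have : (3 : ℝ) ≤ y := by exact_mod_cast (by omega : (3 : ℤ) ≤ y)
    exact D.np_i_side h0 h5 hz h this
  have dn : ∀ x y : ℤ, D.F x y 0 → -2 ≤ y := by
    intro x y h
    by_contra hc
    have : (3 : ℝ) ≤ -y := by exact_mod_cast (by omega : (3 : ℤ) ≤ -y)
    refine (D.map rY).np_i_side (x0 := x0) (p := x) (H := -y) ?_ ?_ ?_ ?_ this <;>
      rw [rY_F] <;> simpa
  by_cases hU : ∃ x y : ℤ, D.F x y 0 ∧ 0 < y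
  · by_cases hD : ∃ x y : ℤ, D.F x y 0 ∧ y < 0
    · exfalso
      obtain ⟨u1, u2, hu, hu2⟩ := hU
      obtain ⟨d1, d2, hd, hd2⟩ := hD
      have hu2' : ((0 : ℤ) : ℝ) < u2 := by exact_mod_cast hu2
      have hd2' : (d2 : ℝ) < ((0 : ℤ) : ℝ) := by exact_mod_cast hd2
      have e1 : ((0 : ℤ) : ℝ) = 0 := by norm_num
      have hz' : D.F x0 (0 : ℤ) 5 := by rwa [e1]
      rcases le_or_gt x0 2 with hx | hx
      · have hx' : (x0 : ℝ) ≤ 2 := by exact_mod_cast hx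
        obtain ⟨i, f⟩ := D.step_right (R := 5) (h := 3) hz' (by rwa [e1]) (by linarith)
          (by norm_num) hu hu2' hd hd2'
        have := D.cap3 i f
        norm_num at this
      · have hx' : (3 : ℝ) ≤ x0 := by exact_mod_cast hx
        obtain ⟨i, f⟩ := D.step_left (L := 0) (h := 3) hz' (by rw [e1]; exact h0) (by linarith)
          (by norm_num) hu hu2' hd hd2'
        have := D.cap3 i f
        norm_num at this
    · push Not at hD
      exact D.W2_of_y' 0 fun x y h => ⟨hD x y h, by linarith [up x y h]⟩
  · push Not at hU
    exact D.W2_of_y' (-2) fun x y h => ⟨dn x y h, by linarith [hU x y h]⟩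

lemma np_ii {x0 h0 : ℤ} (h00 : D.F 0 0 0) (h5 : D.F 5 0 0) (hz : D.F x0 h0 5) (hh : 2 ≤ h0) :
    False := by
  have key : ∀ (j : ℤ) (t : ℝ), 0 < t → t < 1 → t * h0 = j → ∀ x : ℤ, t * x0 < x →
      (x : ℝ) < t * x0 + 5 * (1 - t) → D.I x j ∧ D.F x j (5 * t) := by
    intro j t ht0 ht1 hj x hx1 hx2
    have a : D.F (t * x0) j (5 * t) := D.mix2 h00 hz (s := 1 - t) (t := t) (by linarith) ht0.le
      (by ring) (by ring) (by linarith) (by linarith) (by linarith)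
    have b : D.F (t * x0 + 5 * (1 - t)) j (5 * t) := D.mix2 h5 hz (s := 1 - t) (t := t)
      (by linarith) ht0.le (by ring) (by ring) (by linarith) (by linarith) (by linarith)
    have hhr : (2 : ℝ) ≤ h0 := by exact_mod_cast hh
    refine ⟨D.rowInt a b hx1 hx2 hz ?_ h00 ?_, D.rowF a b hx1.le hx2.le⟩
    · rw [← hj]; nlinarith
    · rw [← hj]; nlinarith
  have two : ∀ (j : ℤ) (t : ℝ), 1 / 2 ≤ t → t ≤ 4 / 7 → t * h0 = j → False := by
    intro j t h1 h2 hj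
    obtain ⟨m, hm1, hm2⟩ := ex_int (t * x0)
    obtain ⟨i1, f1⟩ := key j t (by linarith) (by linarith) hj m hm1 (by linarith)
    obtain ⟨i2, f2⟩ := key j t (by linarith) (by linarith) hj (m + 1) (by push_cast; linarith)
      (by push_cast; linarith)
    have := D.capsum2 i1 f1 i2 f2 (Or.inl (by omega))
    linarith
  rcases Int.even_or_odd' h0 with ⟨k, hk | hk⟩
  · refine two k (1 / 2) le_rfl (by norm_num) ?_
    rw [hk]; push_cast; ring
  · have hk1 : 1 ≤ k := by omega
    by_cases hk3 : 3 ≤ k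
    · have hkr : (3 : ℝ) ≤ k := by exact_mod_cast hk3
      refine two (k + 1) ((k + 1) / (2 * k + 1)) ?_ ?_ ?_
      · rw [div_le_div_iff₀ (by norm_num) (by linarith)]; linarith
      · rw [div_le_div_iff₀ (by linarith) (by norm_num)]; linarith
      · rw [hk]; push_cast; field_simp
    · obtain rfl | rfl : k = 1 ∨ k = 2 := by omega
      · obtain ⟨m, hm1, hm2⟩ := ex_int (2 / 3 * x0)
        obtain ⟨i1, f1⟩ := key 2 (2 / 3) (by norm_num) (by norm_num) (by rw [hk]; norm_num) m hm1
          (by linarith)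
        have := D.cap3 i1 f1
        norm_num at this
      · obtain ⟨m, hm1, hm2⟩ := ex_int (3 / 5 * x0)
        obtain ⟨i1, f1⟩ := key 3 (3 / 5) (by norm_num) (by norm_num) (by rw [hk]; norm_num) m hm1
          (by linarith)
        obtain ⟨k, hk1, hk2⟩ := ex_int (2 / 5 * x0)
        obtain ⟨i2, f2⟩ := key 2 (2 / 5) (by norm_num) (by norm_num) (by rw [hk]; norm_num) k hk1
          (by linarith)
        obtain ⟨i3, f3⟩ := key 2 (2 / 5) (by norm_num) (by norm_num) (by rw [hk]; norm_num) (k + 1)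
          (by push_cast; linarith) (by push_cast; linarith)
        have := D.capsum3 i1 f1 i2 f2 i3 f3 (Or.inr (by norm_num)) (Or.inr (by norm_num))
          (Or.inl (by omega))
        norm_num at this

/-- case of height one: the stretch in row one leads to a long fibre next to `x0` -/
lemma np_iii_row1 {x0 : ℤ} (h00 : D.F 0 0 0) (h5 : D.F 5 0 0) (hz : D.F x0 1 5) {p H h : ℝ}
    (hp : D.F p H 0) (hH : 1 < H) (h1 : 1 < h) (hh : h ≤ 5 * (1 - 1 / H)) :
    ∃ m : ℤ, D.I m (1 : ℤ) ∧ D.F m (1 : ℤ) (5 * (1 - 1 / h)) := by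
  obtain ⟨a, b⟩ := D.shrink h00 h5 hp hH.le
  have e1 : ((1 : ℤ) : ℝ) = 1 := by norm_num
  replace a : D.F (p / H) ((1 : ℤ) : ℝ) 0 := by rw [e1]; exact a
  replace b : D.F (p / H + 5 * (1 - 1 / H)) ((1 : ℤ) : ℝ) 0 := by rw [e1]; exact b
  rw [← e1] at hz
  have hu2 : ((1 : ℤ) : ℝ) < H := by rw [e1]; exact hH
  have hd2 : (0 : ℝ) < ((1 : ℤ) : ℝ) := by norm_num
  rcases le_or_gt (x0 : ℝ) (p / H) with hx | hx
  · exact ⟨x0 + 1, D.step_right hz b (by linarith) h1 hp hu2 h00 hd2⟩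
  · rcases lt_or_ge (x0 : ℝ) (p / H + 5 * (1 - 1 / H)) with hx2 | hx2
    · exfalso
      have := D.cap3 (D.rowInt a b hx hx2 hp hu2 h00 hd2) hz
      norm_num at this
    · exact ⟨x0 - 1, D.step_left hz a (by linarith) h1 hp hu2 h00 hd2⟩

lemma np_iii {x0 : ℤ} (h00 : D.F 0 0 0) (h5 : D.F 5 0 0) (hz : D.F x0 1 5) : D.W2 := by
  have up : ∀ x y : ℤ, D.F x y 0 → y ≤ 2 := by
    intro x y h
    by_contra hc
    have hy : (3 : ℝ) ≤ y := by exact_mod_cast (by omega : (3 : ℤ) ≤ y)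
    have := inv3 hy
    obtain ⟨m, i, f⟩ := D.np_iii_row1 h00 h5 hz (h := 10 / 3) h (by linarith) (by norm_num)
      (by linarith)
    have := D.cap3 i f
    norm_num at this
  have e0 : ((0 : ℤ) : ℝ) = 0 := by norm_num
  have dn : ∀ x y : ℤ, D.F x y 0 → -1 ≤ y := by
    intro x y h
    by_contra hc
    have hy : (2 : ℝ) ≤ -y := by exact_mod_cast (by omega : (2 : ℤ) ≤ -y)
    set k : ℝ := -y with hk
    have hc : D.F ((k * x0 + x) / (k + 1)) 0 (10 / 3) := by
      refine D.mix2 hz h (s := k / (k + 1)) (t := 1 / (k + 1)) (by positivity) (by positivity)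
        (by field_simp) ?_ ?_ (by norm_num) ?_
      · field_simp
      · have : (y : ℝ) = -k := by rw [hk]; ring
        rw [this]; field_simp; ring
      · have : (2 : ℝ) / 3 ≤ k / (k + 1) := by
          rw [div_le_div_iff₀ (by norm_num) (by linarith)]; linarith
        linarith
    rw [← e0] at hc
    refine D.row_false (L := 0) (R := 5) (by rw [e0]; exact h00) (by rw [e0]; exact h5) hc
      (by norm_num) hz (by norm_num) h (by rw [e0]; linarith)
  by_cases hU : ∃ x y : ℤ, D.F x y 0 ∧ y = 2
  · by_cases hD : ∃ x y : ℤ, D.F x y 0 ∧ y = -1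
    · exfalso
      obtain ⟨p, _, hp, rfl⟩ := hU
      obtain ⟨q, _, hq, rfl⟩ := hD
      obtain ⟨m, i1, f1⟩ := D.np_iii_row1 h00 h5 hz (h := 5 / 2) hp (by norm_num) (by norm_num)
        (by norm_num)
      have hc : D.F ((x0 + q) / 2) (0 : ℤ) (5 / 2) := D.mix2 hz hq (s := 1 / 2) (t := 1 / 2)
        (by norm_num) (by norm_num) (by norm_num) (by ring) (by push_cast; norm_num) (by norm_num)
        (by norm_num)
      have hi : ∃ (L R : ℝ), D.F L (0 : ℤ) 0 ∧ D.F R (0 : ℤ) 0 ∧ L ≤ (x0 + q) / 2 ∧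
          (x0 + q) / 2 ≤ R ∧ 5 ≤ R - L := by
        rcases le_or_gt ((x0 + q : ℝ) / 2) 0 with h | h
        · exact ⟨_, 5, D.zero hc, by rw [e0]; exact h5, le_rfl, by linarith, by linarith⟩
        · rcases le_or_gt ((x0 + q : ℝ) / 2) 5 with h' | h'
          · exact ⟨0, 5, by rw [e0]; exact h00, by rw [e0]; exact h5, h.le, h', by linarith⟩
          · exact ⟨0, _, by rw [e0]; exact h00, D.zero hc, h.le, le_rfl, by linarith⟩
      obtain ⟨L, R, hL, hR, hl, hr, hlr⟩ := hi
      set c : ℝ := (x0 + q) / 2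
      have hi : ∀ m : ℤ, L + 42 / 100 * (c - L) < m → (m : ℝ) < R - 42 / 100 * (R - c) →
          D.I m (0 : ℤ) ∧ D.F m (0 : ℤ) (42 / 100 * (5 / 2)) := by
        intro m h1 h2
        refine ⟨D.rowInt hL hR (by linarith) (by linarith) hz (by norm_num) hq (by norm_num), ?_⟩
        exact D.tent hL hR hc (by norm_num) (by norm_num) h1.le h2.le
      obtain ⟨k, hk1, hk2⟩ := ex_int (L + 42 / 100 * (c - L))
      obtain ⟨i2, f2⟩ := hi k hk1 (by linarith)
      obtain ⟨i3, f3⟩ := hi (k + 1) (by push_cast; linarith) (by push_cast; linarith)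
      have := D.capsum3 i1 f1 i2 f2 i3 f3 (Or.inr (by norm_num)) (Or.inr (by norm_num))
          (Or.inl (by omega))
      norm_num at this
    · push Not at hD
      refine D.W2_of_y' 0 fun x y h => ⟨?_, by linarith [up x y h]⟩
      have := dn x y h
      have := hD x y h
      omega
  · push Not at hU
    refine D.W2_of_y' (-1) fun x y h => ⟨dn x y h, ?_⟩
    have := up x y h
    have := hU x y h
    omega

lemma np0 {x0 h0 : ℤ} (h00 : D.F 0 0 0) (h5 : D.F 5 0 0) (hz : D.F x0 h0 5) (hh : 0 ≤ h0) :
    D.W2 := by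
  obtain rfl | rfl | h : h0 = 0 ∨ h0 = 1 ∨ 2 ≤ h0 := by omega
  · exact D.np_i h00 h5 (by simpa using hz)
  · exact D.np_iii h00 h5 (by simpa using hz)
  · exact (D.np_ii h00 h5 hz h).elim

lemma np1 {x0 h0 : ℤ} (h00 : D.F 0 0 0) (h5 : D.F 5 0 0) (hz : D.F x0 h0 5) :
    D.W2 := by
  rcases le_total 0 h0 with h | h
  · exact D.np0 h00 h5 hz h
  · refine D.W2_map rY ((D.map rY).np0 (x0 := x0) (h0 := -h0) ?_ ?_ ?_ (by omega))
    · rw [rY_F]; simpa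
    · rw [rY_F]; simpa
    · rw [rY_F]; simpa

/-- Step 2 (a) -/
theorem nonpar {p q r s x0 h0 u v : ℤ} (hp : D.F p q 0) (hr : D.F r s 0) (hu : r = p + 5 * u)
    (hv : s = q + 5 * v) (hne : u ≠ 0 ∨ v ≠ 0) (hz : D.F x0 h0 5) : D.W2 := by
  obtain ⟨ψ, g, hg, h1, h2, h3, h4⟩ := exists_aff p q r s (by omega)
  have h5 : 5 ≤ g := by
    have : (5 : ℤ) ∣ g := by
      have ea : ψ.a * g = 5 * u := by
        simp only [Aff.X] at h1 h3; linear_combination h3 - h1 + hu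
      have ec : ψ.c * g = 5 * v := by
        simp only [Aff.Y] at h2 h4; linear_combination h4 - h2 + hv
      refine ⟨(ψ.a * ψ.d - ψ.b * ψ.c) * (ψ.d * u - ψ.b * v), ?_⟩
      have := ψ.sq
      linear_combination (-g) * this + (ψ.a * ψ.d - ψ.b * ψ.c) * (ψ.d * ea - ψ.b * ec)
    exact Int.le_of_dvd hg this
  have h5r : (5 : ℝ) ≤ g := by exact_mod_cast h5
  apply D.W2_map ψ
  have a : (D.map ψ).F (0 : ℤ) (0 : ℤ) 0 := by rw [map_F, h1, h2]; exact hp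
  have b : (D.map ψ).F g (0 : ℤ) 0 := by rw [map_F, h3, h4]; exact hr
  refine (D.map ψ).np1 (x0 := ψ.X' x0 h0) (h0 := ψ.Y' x0 h0) ?_ ?_ ?_
  · simpa using a
  · have := (D.map ψ).rowF a b (x := 5) (by norm_num) h5r
    simpa using this
  · rw [map_F, ψ.XX', ψ.YY']; exact hz

/-- Step 2 (b), normalised -/
lemma par2_side (h0 : D.F 0 0 5) (h2 : D.F 2 0 5) {p H : ℝ}
    (hp : D.F p H 0) (hH : 3 ≤ H) : False := by
  have hi := inv3 hH
  have hi0 : 0 < 1 / H := by positivity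
  have a : D.F (p / H) 1 (10 / 3) := D.mix2 h0 hp (s := 1 - 1 / H) (t := 1 / H) (by linarith)
    (by positivity) (by ring) (by field_simp; ring) (by field_simp; ring) (by norm_num)
    (by linarith)
  have b : D.F (p / H + 2 * (1 - 1 / H)) 1 (10 / 3) := D.mix2 h2 hp (s := 1 - 1 / H) (t := 1 / H)
    (by linarith) (by positivity) (by ring) (by field_simp; ring) (by field_simp; ring)
    (by norm_num) (by linarith)
  obtain ⟨m, hm1, hm2⟩ := ex_int (p / H)
  have e1 : ((1 : ℤ) : ℝ) = 1 := by norm_num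
  rw [← e1] at a b
  have i := D.rowInt a b hm1 (by linarith) hp (by push_cast; linarith) h0 (by norm_num)
  have := D.cap3 i (D.rowF a b hm1.le (by linarith))
  norm_num at this

lemma par2_0 (h0 : D.F 0 0 5) (h2 : D.F 2 0 5) : D.W2 := by
  have up : ∀ x y : ℤ, D.F x y 0 → y ≤ 2 := by
    intro x y h
    by_contra hc
    have : (3 : ℝ) ≤ y := by exact_mod_cast (by omega : (3 : ℤ) ≤ y)
    exact D.par2_side h0 h2 h this
  have dn : ∀ x y : ℤ, D.F x y 0 → -2 ≤ y := by
    intro x y h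
    by_contra hc
    have : (3 : ℝ) ≤ -y := by exact_mod_cast (by omega : (3 : ℤ) ≤ -y)
    refine (D.map rY).par2_side (p := x) (H := -y) ?_ ?_ ?_ this <;>
      rw [rY_F] <;> simpa
  by_cases hU : ∃ x y : ℤ, D.F x y 0 ∧ 0 < y
  · by_cases hD : ∃ x y : ℤ, D.F x y 0 ∧ y < 0
    · exfalso
      obtain ⟨u1, u2, hu, hu2⟩ := hU
      obtain ⟨d1, d2, hd, hd2⟩ := hD
      have i := D.rowInt h0 h2 (m := 1) (by norm_num) (by norm_num) hu (by exact_mod_cast hu2) hd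
        (by exact_mod_cast hd2)
      have f := D.rowF h0 h2 (x := 1) (by norm_num) (by norm_num)
      have := D.cap3 (x := 1) (y := 0) (l := 5) (by simpa using i) (by simpa using f)
      norm_num at this
    · push Not at hD
      exact D.W2_of_y' 0 fun x y h => ⟨hD x y h, by linarith [up x y h]⟩
  · push Not at hU
    exact D.W2_of_y' (-2) fun x y h => ⟨dn x y h, by linarith [hU x y h]⟩

/-- Step 2 (b) -/
theorem par2 {p q r s u v : ℤ} (hp : D.F p q 5) (hr : D.F r s 5) (hu : r = p + 2 * u)
    (hv : s = q + 2 * v) (hne : u ≠ 0 ∨ v ≠ 0) : D.W2 := by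
  obtain ⟨ψ, g, hg, h1, h2, h3, h4⟩ := exists_aff p q r s (by omega)
  have h5 : 2 ≤ g := by
    have : (2 : ℤ) ∣ g := by
      have ea : ψ.a * g = 2 * u := by
        simp only [Aff.X] at h1 h3; linear_combination h3 - h1 + hu
      have ec : ψ.c * g = 2 * v := by
        simp only [Aff.Y] at h2 h4; linear_combination h4 - h2 + hv
      refine ⟨(ψ.a * ψ.d - ψ.b * ψ.c) * (ψ.d * u - ψ.b * v), ?_⟩
      have := ψ.sq
      linear_combination (-g) * this + (ψ.a * ψ.d - ψ.b * ψ.c) * (ψ.d * ea - ψ.b * ec)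
    exact Int.le_of_dvd hg this
  have h5r : (2 : ℝ) ≤ g := by exact_mod_cast h5
  apply D.W2_map ψ
  have a : (D.map ψ).F (0 : ℤ) (0 : ℤ) 5 := by rw [map_F, h1, h2]; exact hp
  have b : (D.map ψ).F g (0 : ℤ) 5 := by rw [map_F, h3, h4]; exact hr
  refine (D.map ψ).par2_0 ?_ ?_
  · simpa using a
  · have := (D.map ψ).rowF a b (x := 2) (by norm_num) h5r
    simpa using this

end Dat

namespace Dat

variable (D : Dat)

/-- interior lattice points of the projection are collinear -/
def Coll : Prop := ∀ x y x' y' x'' y'' : ℤ, D.I x y → D.I x' y' → D.I x'' y'' →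
  (x' - x) * (y'' - y) = (x'' - x) * (y' - y)

lemma Coll_map (ψ : Aff) (h : (D.map ψ).Coll) : D.Coll := by
  intro x y x' y' x'' y'' h1 h2 h3
  have k : ∀ u v : ℤ, D.I u v → (D.map ψ).I (ψ.X' u v : ℤ) (ψ.Y' u v : ℤ) := by
    intro u v huv
    rw [map_I, ψ.XX', ψ.YY']; exact huv
  have := h _ _ _ _ _ _ (k _ _ h1) (k _ _ h2) (k _ _ h3)
  have e := ψ.sq
  simp only [Aff.X', Aff.Y'] at this
  set δ := ψ.a * ψ.d - ψ.b * ψ.c with hδ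
  have h2 : δ * (δ * (δ * ((x' - x) * (y'' - y) - (x'' - x) * (y' - y)))) = 0 := by
    linear_combination this +
      δ ^ 2 * ((x' - x) * (y'' - y) - (x'' - x) * (y' - y)) * hδ
  have hd : δ ≠ 0 := by rintro h0; rw [h0] at e; simp at e
  have h3 := (mul_eq_zero.1 ((mul_eq_zero.1 ((mul_eq_zero.1 h2).resolve_left hd)).resolve_left
    hd)).resolve_left hd
  linarith

lemma cap3r (x y : ℤ) {X Y l : ℝ} (hi : D.I X Y) (hf : D.F X Y l) (hX : X = x) (hY : Y = y) :
    l ≤ 3 := by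
  subst hX hY; exact D.cap3 hi hf

lemma capsum2r (x y x' y' : ℤ) {X Y X' Y' l l' : ℝ} (hi : D.I X Y) (hf : D.F X Y l)
    (hi' : D.I X' Y') (hf' : D.F X' Y' l') (hX : X = x) (hY : Y = y) (hX' : X' = x') (hY' : Y' = y')
    (hne : x ≠ x' ∨ y ≠ y') :
    l + l' ≤ 4 := by
  subst hX hY hX' hY'; exact D.capsum2 hi hf hi' hf' hne

/-- coordinates from a unimodular triple -/
def triAff (p q r s u v : ℤ) (h : (r - p) * (v - q) - (u - p) * (s - q) = 1 ∨
    (r - p) * (v - q) - (u - p) * (s - q) = -1) : Aff :=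
  ⟨r - p, u - p, s - q, v - q, p, q, h⟩

/-! ### A very long fibre -/

lemma d_L1 (h0 : D.F 0 0 9) (h2 : D.I 0 1) {x y : ℤ} (hpI : D.I x y)
    (hn : 2 ≤ x + y) : 1 ≤ y := by
  have hp := D.iF hpI
  by_contra hy
  push Not at hy
  obtain ⟨n, hnd⟩ : ∃ n, n = x + y := ⟨_, rfl⟩
  have hn2 : 2 ≤ n := by omega
  have hxn : n ≤ x := by omega
  set k := x / n with hk
  have hk1 : 1 ≤ k := by
    rw [hk, Int.le_ediv_iff_mul_le (by omega)]; omega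
  have hkl : n * k ≤ x := Int.mul_ediv_self_le (by omega)
  have hku : x < n * k + n := by
    have := Int.lt_ediv_add_one_mul_self x (b := n) (by omega)
    rw [← hk] at this
    linarith
  have hnr : (2 : ℝ) ≤ n := by exact_mod_cast hn2
  have hkr : (1 : ℝ) ≤ k := by exact_mod_cast hk1
  have hxr : (n : ℝ) ≤ x := by exact_mod_cast hxn
  have hx0 : (0 : ℝ) < x := by linarith
  have hklr : (n : ℝ) * k ≤ x := by exact_mod_cast hkl
  have hkur : (x : ℝ) + 1 ≤ n * k + n := by exact_mod_cast hku
  have hyr : (y : ℝ) = n - x := by rw [hnd]; push_cast; ring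
  obtain ⟨ε, hε, hF2⟩ := D.ipos h2
  -- the point `(k, 1 - k)`
  have hw : 0 ≤ 1 - n * k / (x : ℝ) := by rw [sub_nonneg, div_le_one hx0]; exact hklr
  have hw2 : 0 ≤ k * ((n : ℝ) - 1) / x := by
    apply div_nonneg _ hx0.le
    apply mul_nonneg <;> linarith
  have f : D.F k (1 - k) ((1 - n * k / (x : ℝ)) * ε + 9 * (k * (n - 1) / x)) := by
    refine D.mix3 hF2 hp h0 (s := 1 - n * k / (x : ℝ)) (t := k / x) (u := k * (n - 1) / x)
      hw (by positivity) hw2 ?_ ?_ ?_ (by positivity) (by linarith)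
    · field_simp; ring
    · field_simp; ring
    · rw [hyr]; field_simp; ring
  have i : D.I k (1 - k) := by
    refine D.imix3 hpI hF2 h0 (s := k / x) (t := 1 - n * k / (x : ℝ)) (u := k * (n - 1) / x)
      (by positivity) hw hw2 ?_ ?_ ?_
    · field_simp; ring
    · field_simp; ring
    · rw [hyr]; field_simp; ring
  have hc := D.cap3r k (1 - k) i f (by norm_num) (by push_cast; ring)
  by_cases hx : n * k = x
  · have hx' : (n : ℝ) * k = x := by exact_mod_cast hx
    have : 9 * (k * ((n : ℝ) - 1) / x) = 9 * (1 - 1 / n) := by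
      rw [← hx']; field_simp
    have hin : 1 / (n : ℝ) ≤ 1 / 2 := one_div_le_one_div_of_le (by norm_num) hnr
    have : 0 ≤ (1 - n * k / (x : ℝ)) * ε := mul_nonneg hw hε.le
    linarith
  · have hx' : (n : ℝ) * k < x := by
      exact_mod_cast lt_of_le_of_ne hkl hx
    have hw' : 0 < 1 - n * k / (x : ℝ) := by rw [sub_pos, div_lt_one hx0]; exact hx'
    have : 3 ≤ 9 * (k * ((n : ℝ) - 1) / x) := by
      rw [← mul_div_assoc, le_div_iff₀ hx0]
      nlinarith [mul_nonneg (by linarith : (0 : ℝ) ≤ n - 2) (by linarith : (0 : ℝ) ≤ k - 1)]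
    nlinarith [mul_pos hw' hε]

lemma d_L2 (h0 : D.F 0 0 9) (h1 : D.I 1 0) (h3 : D.I 1 1) {x y : ℤ} (hp : D.F x y 0)
    (hn : 2 ≤ x + y) : 1 ≤ y := by
  by_contra hy
  have hyr : (y : ℝ) ≤ 0 := by exact_mod_cast (by omega : y ≤ 0)
  have hnr : (2 : ℝ) ≤ x + y := by exact_mod_cast hn
  have hp' : (0 : ℝ) < x - y := by linarith
  have f : D.F 1 0 (9 / 2) := by
    refine D.mix3 hp (D.iF h3) h0 (s := 1 / (x - y)) (t := -y / (x - y)) (u := (x - 1) / (x - y))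
      (by positivity) (div_nonneg (by linarith) hp'.le) (div_nonneg (by linarith) hp'.le)
      ?_ ?_ ?_ (by norm_num) ?_
    · field_simp; ring
    · field_simp; ring
    · field_simp; ring
    · have : 1 / 2 ≤ ((x : ℝ) - 1) / (x - y) := by
        rw [div_le_div_iff₀ (by norm_num) hp']; linarith
      linarith
  have := D.cap3r 1 0 h1 f (by norm_num) (by norm_num)
  norm_num at this

/-- lattice points on the line `x + y = 1`, given a point of height at least three -/
lemma d_L3 (h0 : D.F 0 0 9) (h1 : D.I 1 0) {x y : ℤ} (hp : D.F x y 0)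
    (hn : 3 ≤ x + y) (hx : 1 ≤ x) (hy : 1 ≤ y) {k : ℤ} (hk : D.F k (1 - k) 0) : k ≤ 1 := by
  by_contra hc
  have hkr : (2 : ℝ) ≤ k := by exact_mod_cast (by omega : 2 ≤ k)
  have hnr : (3 : ℝ) ≤ x + y := by exact_mod_cast hn
  have hxr : (1 : ℝ) ≤ x := by exact_mod_cast hx
  have hyr : (1 : ℝ) ≤ y := by exact_mod_cast hy
  set n : ℝ := x + y with hnd
  have hden : 0 < k * n - x := by nlinarith
  have f : D.F 1 0 (9 * ((k - 1) * (n - 1) / (k * n - x))) := by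
    have hw : 0 ≤ (k - 1) * (n - 1) / (k * n - x) := by
      apply div_nonneg _ hden.le; apply mul_nonneg <;> linarith
    refine D.mix3 hp hk h0 (s := (k - 1) / (k * n - x)) (t := (n - x) / (k * n - x))
      (u := (k - 1) * (n - 1) / (k * n - x))
      (div_nonneg (by linarith) hden.le) (div_nonneg (by linarith) hden.le) hw
      ?_ ?_ ?_ (by positivity) (by linarith)
    · rw [← add_div, ← add_div, div_eq_one_iff_eq hden.ne']; ring
    · have : (k - 1) / (k * n - x) * x + (n - x) / (k * n - x) * k +
        (k - 1) * (n - 1) / (k * n - x) * 0 = ((k - 1) * x + (n - x) * k) / (k * n - x) := by ring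
      rw [this, eq_comm, div_eq_one_iff_eq hden.ne']; ring
    · have : (k - 1) / (k * n - x) * y + (n - x) / (k * n - x) * (1 - k) +
        (k - 1) * (n - 1) / (k * n - x) * 0 = ((k - 1) * y + (n - x) * (1 - k)) / (k * n - x) := by
          ring
      rw [this, eq_comm, div_eq_zero_iff]; left; rw [hnd]; ring
  have := D.cap3r 1 0 h1 f (by norm_num) (by norm_num)
  have h3 : 3 < 9 * ((k - 1) * (n - 1) / (k * n - x)) := by
    rw [← mul_div_assoc, lt_div_iff₀ hden]
    nlinarith [mul_nonneg (by linarith : (0 : ℝ) ≤ k - 2) (by linarith : (0 : ℝ) ≤ n - 3)]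
  linarith

lemma d_fib (h0 : D.F 0 0 9) (hm : D.F 1 (-1) 0) {x y : ℤ} (hp : D.F x y 0)
    (hx : 1 ≤ x) (hy : 1 ≤ y) : D.F 1 0 (9 * ((x - 1) / (x + y))) := by
  have hxr : (1 : ℝ) ≤ x := by exact_mod_cast hx
  have hyr : (1 : ℝ) ≤ y := by exact_mod_cast hy
  have hw : 0 ≤ ((x : ℝ) - 1) / (x + y) := div_nonneg (by linarith) (by linarith)
  refine D.mix3 hp hm h0 (s := 1 / (x + y)) (t := y / (x + y)) (u := (x - 1) / (x + y))
    (by positivity) (by positivity) hw ?_ ?_ ?_ (by positivity) (by linarith)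
  · field_simp; ring
  · field_simp; ring
  · field_simp; ring

/-- everything except the choice between `(2,1)` and `(1,2)` -/
lemma d_struct (h0 : D.F 0 0 9) (h1 : D.I 1 0) (h2 : D.I 0 1) (h3 : D.I 1 1) :
    (∀ x y : ℤ, D.F x y 0 → 2 ≤ x + y → 1 ≤ x ∧ 1 ≤ y) ∧
    (∀ x y : ℤ, D.F x y 0 → x + y = 1 → 0 ≤ x ∧ 0 ≤ y) ∧
    (∀ x y : ℤ, D.F x y 0 → 0 ≤ x + y) ∧ D.F 1 (-1) 0 ∧ D.F (-1) 1 0 ∧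
    (∀ x y : ℤ, D.F x y 0 → 3 ≤ x + y → x + y = 3) ∧
    (D.F 2 1 0 ∨ D.F 1 2 0) := by
  have A : ∀ x y : ℤ, D.F x y 0 → 2 ≤ x + y → 1 ≤ x ∧ 1 ≤ y := by
    intro x y h hn
    refine ⟨?_, D.d_L2 h0 h1 h3 h hn⟩
    exact (D.map sw).d_L2 (x := y) (y := x) (by rw [sw_F]; exact h0) (by rw [sw_I]; exact h2)
      (by rw [sw_I]; exact h3) (by rw [sw_F]; exact h) (by omega)
  obtain ⟨p1, p2, hp, hplt⟩ := D.push (α := 1) (β := 1) h3 (by norm_num)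
  have hp3 : 3 ≤ p1 + p2 := by
    have : (2 : ℝ) < p1 + p2 := by linarith
    have : (2 : ℤ) < p1 + p2 := by exact_mod_cast this
    omega
  obtain ⟨hpx, hpy⟩ := A p1 p2 hp (by omega)
  have B : ∀ x y : ℤ, D.F x y 0 → x + y = 1 → 0 ≤ x ∧ 0 ≤ y := by
    intro x y h hn
    have e1 : (y : ℝ) = 1 - x := by
      have : (x : ℝ) + y = 1 := by exact_mod_cast hn
      linarith
    have a : x ≤ 1 := D.d_L3 h0 h1 hp hp3 hpx hpy (k := x) (by rw [← e1]; exact h)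
    have b : y ≤ 1 := by
      refine (D.map sw).d_L3 (x := p2) (y := p1) (by rw [sw_F]; exact h0) (by rw [sw_I]; exact h2)
        (by rw [sw_F]; exact hp) (by omega) hpy hpx (k := y) ?_
      rw [sw_F]
      have : (1 : ℝ) - y = x := by linarith
      rw [this]; exact h
    omega
  have hni : ¬ D.I 0 0 := by
    intro h
    have := D.cap3r 0 0 h h0 (by norm_num) (by norm_num)
    norm_num at this
  obtain ⟨q1, q2, hq, hqlt⟩ := D.push (α := 0) (β := -1) h1 (by norm_num)
  obtain ⟨r1, r2, hr, hrlt⟩ := D.push (α := -1) (β := 0) h2 (by norm_num)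
  have hq2 : q2 < 0 := by
    have : (q2 : ℝ) < 0 := by linarith
    exact_mod_cast this
  have hr1 : r1 < 0 := by
    have : (r1 : ℝ) < 0 := by linarith
    exact_mod_cast this
  have hqn : q1 + q2 ≤ 0 := by
    by_contra hc
    rcases (by omega : q1 + q2 = 1 ∨ 2 ≤ q1 + q2) with h | h
    · have := B _ _ hq h; omega
    · have := A _ _ hq h; omega
  have hrn : r1 + r2 ≤ 0 := by
    by_contra hc
    rcases (by omega : r1 + r2 = 1 ∨ 2 ≤ r1 + r2) with h | h
    · have := B _ _ hr h; omega
    · have := A _ _ hr h; omega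
  obtain ⟨α, β, hI, hF⟩ := D.supp' hni
  have a1 := hI _ _ h1
  have a2 := hI _ _ h2
  have a3 := hF _ _ _ hq
  have a4 := hF _ _ _ hr
  have hq2r : (q2 : ℝ) < 0 := by exact_mod_cast hq2
  have hr1r : (r1 : ℝ) < 0 := by exact_mod_cast hr1
  have hqnr : (q1 : ℝ) + q2 ≤ 0 := by exact_mod_cast hqn
  have hrnr : (r1 : ℝ) + r2 ≤ 0 := by exact_mod_cast hrn
  have hab : α = β := by
    apply le_antisymm
    · by_contra hc
      push Not at hc
      nlinarith [mul_nonneg (by linarith : 0 ≤ -α) (by linarith : (0 : ℝ) ≤ -(q1 + q2)),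
        mul_pos (by linarith : 0 < α - β) (by linarith : (0 : ℝ) < -q2)]
    · by_contra hc
      push Not at hc
      nlinarith [mul_nonneg (by linarith : 0 ≤ -β) (by linarith : (0 : ℝ) ≤ -(r1 + r2)),
        mul_pos (by linarith : 0 < β - α) (by linarith : (0 : ℝ) < -r1)]
  subst hab
  have hα : α < 0 := by linarith
  have C : ∀ x y : ℤ, D.F x y 0 → 0 ≤ x + y := by
    intro x y h
    have := hF _ _ _ h
    have : (0 : ℝ) ≤ x + y := by nlinarith
    exact_mod_cast this
  have hm : D.F 1 (-1) 0 := by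
    have e : q1 = -q2 := by have := C _ _ hq; omega
    have e' : (q1 : ℝ) = -q2 := by exact_mod_cast e
    have hq1 : (q2 : ℝ) ≤ -1 := by exact_mod_cast (by omega : q2 ≤ -1)
    have hne : (q2 : ℝ) ≠ 0 := by linarith
    refine D.mix2 (D.zero h0) hq (s := 1 + 1 / q2) (t := -1 / q2) ?_ ?_ (by ring) ?_ ?_ le_rfl
      (by simp)
    · have : -1 ≤ 1 / (q2 : ℝ) := by
        rw [le_div_iff_of_neg hq2r]; linarith
      linarith
    · exact div_nonneg_of_nonpos (by norm_num) hq2r.le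
    · rw [e']; field_simp; ring
    · field_simp; ring
  have hm' : D.F (-1) 1 0 := by
    have e : r2 = -r1 := by have := C _ _ hr; omega
    have e' : (r2 : ℝ) = -r1 := by exact_mod_cast e
    have hq1 : (r1 : ℝ) ≤ -1 := by exact_mod_cast (by omega : r1 ≤ -1)
    have hne : (r1 : ℝ) ≠ 0 := by linarith
    refine D.mix2 (D.zero h0) hr (s := 1 + 1 / r1) (t := -1 / r1) ?_ ?_ (by ring) ?_ ?_ le_rfl
      (by simp)
    · have : -1 ≤ 1 / (r1 : ℝ) := by
        rw [le_div_iff_of_neg hr1r]; linarith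
      linarith
    · exact div_nonneg_of_nonpos (by norm_num) hr1r.le
    · field_simp; ring
    · rw [e']; field_simp; ring
  have E : ∀ x y : ℤ, D.F x y 0 → 3 ≤ x + y → x + y = 3 := by
    intro x y h hn
    obtain ⟨hx, hy⟩ := A x y h (by omega)
    have f1 := D.d_fib h0 hm h hx hy
    have f2 := (D.map sw).d_fib (by rw [sw_F]; exact h0) (by rw [sw_F]; exact hm')
      (x := y) (y := x) (by rw [sw_F]; exact h) hy hx
    rw [sw_F] at f2
    have := D.capsum2r 1 0 0 1 h1 f1 h2 f2 (by norm_num) (by norm_num) (by norm_num) (by norm_num)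
      (by norm_num)
    have hnr : (3 : ℝ) ≤ x + y := by exact_mod_cast hn
    have e : 9 * (((x : ℝ) - 1) / (x + y)) + 9 * ((y - 1) / (y + x)) =
        9 * (x + y - 2) / (x + y) := by
      rw [add_comm (y : ℝ) x]; ring
    rw [e, div_le_iff₀ (by linarith)] at this
    have : (x : ℝ) + y < 4 := by linarith
    have : x + y < 4 := by exact_mod_cast this
    omega
  refine ⟨A, B, C, hm, hm', E, ?_⟩
  have := E _ _ hp hp3
  obtain ⟨rfl, rfl⟩ | ⟨rfl, rfl⟩ : (p1 = 2 ∧ p2 = 1) ∨ (p1 = 1 ∧ p2 = 2) := by omega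
  · left; simpa using hp
  · right; simpa using hp

lemma d_21 (h0 : D.F 0 0 9) (h1 : D.I 1 0) (h2 : D.I 0 1) (h3 : D.I 1 1) (h : D.F 2 1 0) :
    False := by
  obtain ⟨A, B, C, hm, hm', E, -⟩ := D.d_struct h0 h1 h2 h3
  have f1 : D.F 1 0 3 := by
    have := D.d_fib h0 hm (x := 2) (y := 1) (by simpa using h) (by norm_num) (by norm_num)
    norm_num at this
    exact this
  have key : ¬ D.F 0 1 3 := by
    intro f2
    have := D.capsum2r 1 0 0 1 h1 f1 h2 f2 (by norm_num) (by norm_num) (by norm_num) (by norm_num)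
      (by norm_num)
    norm_num at this
  obtain ⟨x, y, hF, hlt⟩ := D.push (α := 0) (β := 1) h3 (by norm_num)
  have hy : 2 ≤ y := by
    have : (1 : ℝ) < y := by linarith
    have : (1 : ℤ) < y := by exact_mod_cast this
    omega
  have hn := C _ _ hF
  rcases (by omega : x + y = 0 ∨ x + y = 1 ∨ 2 ≤ x + y) with h' | h' | h'
  · have hyr : (2 : ℝ) ≤ y := by exact_mod_cast hy
    have e : (x : ℝ) = -y := by
      have : (x : ℝ) + y = 0 := by exact_mod_cast h'
      linarith
    have g : D.F (-2) 2 0 := by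
      refine D.mix2 (D.zero h0) hF (s := 1 - 2 / y) (t := 2 / y) ?_ (by positivity) (by ring) ?_ ?_
        le_rfl (by simp)
      · rw [sub_nonneg, div_le_one (by linarith)]; exact hyr
      · rw [e]; field_simp; ring
      · field_simp; ring
    apply key
    refine D.mix3 h0 g h (s := 1 / 3) (t := 1 / 3) (u := 1 / 3) ?_ ?_ ?_ ?_ ?_ ?_ ?_ ?_ <;> norm_num
  · have := B _ _ hF h'; omega
  · obtain ⟨hx, -⟩ := A _ _ hF h'
    have := E _ _ hF (by omega)
    obtain ⟨rfl, rfl⟩ : x = 1 ∧ y = 2 := by omega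
    apply key
    have := (D.map sw).d_fib (by rw [sw_F]; exact h0) (by rw [sw_F]; exact hm')
      (x := 2) (y := 1) (by rw [sw_F]; simpa using hF) (by norm_num) (by norm_num)
    rw [sw_F] at this
    norm_num at this
    exact this

lemma d_111 (h0 : D.F 0 0 9) (h1 : D.I 1 0) (h2 : D.I 0 1) (h3 : D.I 1 1) : False := by
  obtain ⟨A, B, C, hm, hm', E, h | h⟩ := D.d_struct h0 h1 h2 h3
  · exact D.d_21 h0 h1 h2 h3 h
  · refine (D.map sw).d_21 ?_ ?_ ?_ ?_ ?_
    · rw [sw_F]; exact h0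
    · rw [sw_I]; exact h2
    · rw [sw_I]; exact h1
    · rw [sw_I]; exact h3
    · rw [sw_F]; exact h

lemma map_triAff_F {p q r s u v : ℤ} (h) (x y l : ℝ) : (D.map (triAff p q r s u v h)).F x y l ↔
    D.F ((r - p) * x + (u - p) * y + p) ((s - q) * x + (v - q) * y + q) l := by
  simp [map, triAff]

lemma map_triAff_I {p q r s u v : ℤ} (h) (x y : ℝ) : (D.map (triAff p q r s u v h)).I x y ↔
    D.I ((r - p) * x + (u - p) * y + p) ((s - q) * x + (v - q) * y + q) := by
  simp [map, triAff]

lemma d_12 (h0 : D.F 0 0 9) (h1 : D.I 1 0) (h2 : D.I 0 1) {x y : ℤ} (h3 : D.I x y)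
    (hne : x + y ≠ 1) : False := by
  have hni : ¬ D.I 0 0 := by
    intro h
    have := D.cap3r 0 0 h h0 (by norm_num) (by norm_num)
    norm_num at this
  rcases (by omega : 2 ≤ x + y ∨ x + y ≤ 0) with hn | hn
  · have hy := D.d_L1 h0 h2 h3 hn
    have hx := (D.map sw).d_L1 (by rw [sw_F]; exact h0) (by rw [sw_I]; exact h1) (x := y) (y := x)
      (by rw [sw_I]; exact h3) (by omega)
    refine D.d_111 h0 h1 h2 ?_
    have hxr : (1 : ℝ) ≤ x := by exact_mod_cast hx
    have hyr : (1 : ℝ) ≤ y := by exact_mod_cast hy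
    have hp : 0 < (x : ℝ) + y - 1 := by linarith
    refine D.imix3 h3 (D.iF h1) (D.iF h2) (s := 1 / (x + y - 1)) (t := (y - 1) / (x + y - 1))
      (u := (x - 1) / (x + y - 1)) (by positivity) (div_nonneg (by linarith) hp.le)
      (div_nonneg (by linarith) hp.le) ?_ ?_ ?_
    · field_simp; ring
    · field_simp; ring
    · field_simp; ring
  · have hnr : (x : ℝ) + y ≤ 0 := by exact_mod_cast hn
    rcases (by omega : (x ≤ 0 ∧ y ≤ 0) ∨ (1 ≤ x ∧ y ≤ -1) ∨ (x ≤ -1 ∧ 1 ≤ y)) with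
      ⟨hx, hy⟩ | ⟨hx, hy⟩ | ⟨hx, hy⟩
    · apply hni
      have hxr : (x : ℝ) ≤ 0 := by exact_mod_cast hx
      have hyr : (y : ℝ) ≤ 0 := by exact_mod_cast hy
      have hp : 0 < 1 - (x : ℝ) - y := by linarith
      refine D.imix3 h3 (D.iF h1) (D.iF h2) (s := 1 / (1 - x - y)) (t := -x / (1 - x - y))
        (u := -y / (1 - x - y)) (by positivity) (div_nonneg (by linarith) hp.le)
        (div_nonneg (by linarith) hp.le) ?_ ?_ ?_
      · field_simp; ring
      · field_simp; ring
      · field_simp; ring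
    · have hxr : (1 : ℝ) ≤ x := by exact_mod_cast hx
      have hyr : (y : ℝ) ≤ -1 := by exact_mod_cast hy
      have hp : 0 < -(y : ℝ) := by linarith
      have hne : (y : ℝ) ≠ 0 := by linarith
      have i : D.I 1 (-1) := by
        refine D.imix3 h3 (D.iF h1) h0 (s := 1 / (-y)) (t := (-(x + y)) / (-y))
          (u := (x - 1) / (-y)) (by positivity) (div_nonneg (by linarith) hp.le)
          (div_nonneg (by linarith) hp.le) ?_ ?_ ?_
        · field_simp; ring
        · field_simp; ring
        · field_simp; ring
      refine (D.map (triAff 0 0 1 (-1) 0 1 (by norm_num))).d_111 ?_ ?_ ?_ ?_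
      · rw [map_triAff_F]; norm_num; exact h0
      · rw [map_triAff_I]; norm_num; exact i
      · rw [map_triAff_I]; norm_num; exact h2
      · rw [map_triAff_I]; norm_num; exact h1
    · have hxr : (x : ℝ) ≤ -1 := by exact_mod_cast hx
      have hyr : (1 : ℝ) ≤ y := by exact_mod_cast hy
      have hp : 0 < -(x : ℝ) := by linarith
      have hne : (x : ℝ) ≠ 0 := by linarith
      have i : D.I (-1) 1 := by
        refine D.imix3 h3 (D.iF h2) h0 (s := 1 / (-x)) (t := (-(x + y)) / (-x))
          (u := (y - 1) / (-x)) (by positivity) (div_nonneg (by linarith) hp.le)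
          (div_nonneg (by linarith) hp.le) ?_ ?_ ?_
        · field_simp; ring
        · field_simp; ring
        · field_simp; ring
      refine (D.map (triAff 0 0 1 0 (-1) 1 (by norm_num))).d_111 ?_ ?_ ?_ ?_
      · rw [map_triAff_F]; norm_num; exact h0
      · rw [map_triAff_I]; norm_num; exact h1
      · rw [map_triAff_I]; norm_num; exact i
      · rw [map_triAff_I]; norm_num; exact h2

end Dat

namespace Dat

variable (D : Dat)

lemma d_ind (h0 : D.F 0 0 9) (n : ℕ) : ∀ p q r s : ℤ, D.I p q → D.I r s →
    (p * s - q * r).natAbs = n → p * s - q * r ≠ 0 → D.Coll := by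
  induction n using Nat.strong_induction_on with
  | _ n ih =>
  intro p q r s h1 h2 hn hne
  by_cases hone : (p * s - q * r).natAbs = 1
  · have hd : (p - 0) * (s - 0) - (r - 0) * (q - 0) = 1 ∨
        (p - 0) * (s - 0) - (r - 0) * (q - 0) = -1 := by
      have e : (p - 0) * (s - 0) - (r - 0) * (q - 0) = p * s - q * r := by ring
      rw [e]; omega
    apply D.Coll_map (triAff 0 0 p q r s hd)
    have k : ∀ x y : ℤ, (D.map (triAff 0 0 p q r s hd)).I x y → x + y = 1 := by
      intro x y h
      by_contra hc
      refine (D.map (triAff 0 0 p q r s hd)).d_12 ?_ ?_ ?_ h hc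
      · rw [map_triAff_F]; norm_num; exact h0
      · rw [map_triAff_I]; norm_num; exact h1
      · rw [map_triAff_I]; norm_num; exact h2
    intro x y x' y' x'' y'' a b c
    have := k _ _ a; have := k _ _ b; have := k _ _ c
    obtain rfl : y = 1 - x := by omega
    obtain rfl : y' = 1 - x' := by omega
    obtain rfl : y'' = 1 - x'' := by omega
    ring
  · obtain ⟨x, y, α, β, hα, hβ, hab, hx, hy, n1, n2, n3⟩ := tri p q r s (by
      rw [Int.abs_eq_natAbs]; omega)
    have hF := D.iF h1
    have hF' := D.iF h2
    have hβ1 : β < 1 := by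
      by_contra hc
      have e1 : β = 1 := by linarith
      have e2 : α = 0 := by linarith
      rw [e1, e2] at hx hy
      apply n3
      constructor
      · have : (x : ℝ) = r := by linarith
        exact_mod_cast this
      · have : (y : ℝ) = s := by linarith
        exact_mod_cast this
    have hα1 : α < 1 := by
      by_contra hc
      have e1 : α = 1 := by linarith
      have e2 : β = 0 := by linarith
      rw [e1, e2] at hx hy
      apply n2
      constructor
      · have : (x : ℝ) = p := by linarith
        exact_mod_cast this
      · have : (y : ℝ) = q := by linarith
        exact_mod_cast this
    have hd1 : ((p * y - q * x : ℤ) : ℝ) = β * ((p * s - q * r : ℤ) : ℝ) := by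
      push_cast; rw [hx, hy]; ring
    have hd2 : ((x * s - y * r : ℤ) : ℝ) = α * ((p * s - q * r : ℤ) : ℝ) := by
      push_cast; rw [hx, hy]; ring
    have hner : ((p * s - q * r : ℤ) : ℝ) ≠ 0 := by exact_mod_cast hne
    have habs : ∀ (m : ℤ) (γ : ℝ), 0 ≤ γ → γ < 1 → (m : ℝ) = γ * ((p * s - q * r : ℤ) : ℝ) →
        m.natAbs < n := by
      intro m γ g0 g1 hm
      rw [← hn]
      have : |(m : ℝ)| < |((p * s - q * r : ℤ) : ℝ)| := by
        rw [hm, abs_mul, abs_of_nonneg g0]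
        have : 0 < |((p * s - q * r : ℤ) : ℝ)| := abs_pos.2 hner
        nlinarith
      rw [← Int.cast_abs, ← Int.cast_abs] at this
      have : |m| < |p * s - q * r| := by exact_mod_cast this
      rw [Int.abs_eq_natAbs, Int.abs_eq_natAbs] at this
      exact_mod_cast this
    rcases hβ.lt_or_eq with hb | hb
    · have hi : D.I x y := D.imix3 h2 hF h0 (s := β) (t := α) (u := 1 - α - β) hb hα (by linarith)
        (by ring) (by rw [hx]; ring) (by rw [hy]; ring)
      refine ih _ (habs _ _ hβ hβ1 hd1) p q x y h1 hi rfl ?_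
      intro h
      rw [h] at hd1
      simp only [Int.cast_zero] at hd1
      exact (mul_ne_zero hb.ne' hner) hd1.symm
    · have ha : 0 < α := by
        rcases hα.lt_or_eq with ha | ha
        · exact ha
        · exfalso
          rw [← ha, ← hb] at hx hy
          apply n1
          constructor
          · have : (x : ℝ) = 0 := by linarith
            exact_mod_cast this
          · have : (y : ℝ) = 0 := by linarith
            exact_mod_cast this
      have hi : D.I x y := D.imix3 h1 hF' h0 (s := α) (t := β) (u := 1 - α - β) ha hβ (by linarith)
        (by ring) (by rw [hx]; ring) (by rw [hy]; ring)
      refine ih _ (habs _ _ hα hα1 hd2) x y r s hi h2 rfl ?_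
      intro h
      rw [h] at hd2
      simp only [Int.cast_zero] at hd2
      exact (mul_ne_zero ha.ne' hner) hd2.symm

/-- Step 2 (d) -/
theorem coll_of_nine {z1 z2 : ℤ} (h : D.F z1 z2 9) : D.Coll := by
  have hd : ((z1 + 1) - z1) * ((z2 + 1) - z2) - (z1 - z1) * (z2 - z2) = 1 ∨
    ((z1 + 1) - z1) * ((z2 + 1) - z2) - (z1 - z1) * (z2 - z2) = -1 := by left; ring
  apply D.Coll_map (triAff z1 z2 (z1 + 1) z2 z1 (z2 + 1) hd)
  set D' := D.map (triAff z1 z2 (z1 + 1) z2 z1 (z2 + 1) hd) with hD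
  have h0 : D'.F 0 0 9 := by
    rw [hD, map_triAff_F]; norm_num; exact h
  intro x y x' y' x'' y'' a b c
  by_contra hne
  by_cases e1 : x * y' - y * x' = 0
  · by_cases e2 : x * y'' - y * x'' = 0
    · by_cases e3 : x' * y'' - y' * x'' = 0
      · apply hne; linear_combination e3 - e2 + e1
      · exact hne (D'.d_ind h0 _ x' y' x'' y'' b c rfl e3 _ _ _ _ _ _ a b c)
    · exact hne (D'.d_ind h0 _ x y x'' y'' a c rfl e2 _ _ _ _ _ _ a b c)
  · exact hne (D'.d_ind h0 _ x y x' y' a b rfl e1 _ _ _ _ _ _ a b c)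

/-! ### Three long fibres (Step 2 (c)) -/

lemma cR {x y : ℤ} (h00 : D.F 0 0 5) (h10 : D.F 1 0 5) (h01 : D.F 0 1 5) (h : D.I x y) :
    (1 ≤ x ∧ 1 ≤ y) ∨ (1 ≤ x ∧ y ≤ -1 ∧ x + y ≤ 0) ∨ (x ≤ -1 ∧ 1 ≤ y ∧ x + y ≤ 0) := by
  have n0 : ¬ D.I 0 0 := fun h => by
    have := D.cap3r 0 0 h h00 (by norm_num) (by norm_num); norm_num at this
  have n1 : ¬ D.I 1 0 := fun h => by
    have := D.cap3r 1 0 h h10 (by norm_num) (by norm_num); norm_num at this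
  have n2 : ¬ D.I 0 1 := fun h => by
    have := D.cap3r 0 1 h h01 (by norm_num) (by norm_num); norm_num at this
  have a0 : ¬ (x ≤ 0 ∧ y ≤ 0) := by
    rintro ⟨hx, hy⟩
    have hxr : (x : ℝ) ≤ 0 := by exact_mod_cast hx
    have hyr : (y : ℝ) ≤ 0 := by exact_mod_cast hy
    have hp : 0 < 1 - (x : ℝ) - y := by linarith
    apply n0
    refine D.imix3 h h10 h01 (s := 1 / (1 - x - y)) (t := -x / (1 - x - y))
        (u := -y / (1 - x - y)) (by positivity) (div_nonneg (by linarith) hp.le)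
        (div_nonneg (by linarith) hp.le) ?_ ?_ ?_
    · field_simp; ring
    · field_simp; ring
    · field_simp; ring
  have a1 : ¬ (1 ≤ x + y ∧ y ≤ 0) := by
    rintro ⟨hx, hy⟩
    have hxr : 1 ≤ (x : ℝ) + y := by exact_mod_cast hx
    have hyr : (y : ℝ) ≤ 0 := by exact_mod_cast hy
    have hp : 0 < (x : ℝ) := by linarith
    apply n1
    refine D.imix3 h h00 h01 (s := 1 / x) (t := (x + y - 1) / x)
        (u := -y / x) (by positivity) (div_nonneg (by linarith) hp.le)
        (div_nonneg (by linarith) hp.le) ?_ ?_ ?_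
    · field_simp; ring
    · field_simp; ring
    · field_simp; ring
  have a2 : ¬ (1 ≤ x + y ∧ x ≤ 0) := by
    rintro ⟨hx, hy⟩
    have hxr : 1 ≤ (x : ℝ) + y := by exact_mod_cast hx
    have hyr : (x : ℝ) ≤ 0 := by exact_mod_cast hy
    have hp : 0 < (y : ℝ) := by linarith
    apply n2
    refine D.imix3 h h00 h10 (s := 1 / y) (t := (x + y - 1) / y)
        (u := -x / y) (by positivity) (div_nonneg (by linarith) hp.le)
        (div_nonneg (by linarith) hp.le) ?_ ?_ ?_
    · field_simp; ring
    · field_simp; ring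
    · field_simp; ring
  omega

lemma cS {x y x' y' : ℤ} (h00 : D.F 0 0 5) (h10 : D.F 1 0 5) (h : D.I x y) (h' : D.I x' y')
    (hx : 1 ≤ x) (hy : 1 ≤ y) (hx' : 1 ≤ x') (hy' : y' ≤ -1) : False := by
  have n1 : ¬ D.I 1 0 := fun h => by
    have := D.cap3r 1 0 h h10 (by norm_num) (by norm_num); norm_num at this
  have hxr : (1 : ℝ) ≤ x := by exact_mod_cast hx
  have hyr : (1 : ℝ) ≤ y := by exact_mod_cast hy
  have hxr' : (1 : ℝ) ≤ x' := by exact_mod_cast hx'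
  have hyr' : (y' : ℝ) ≤ -1 := by exact_mod_cast hy'
  have hp : 0 < (y : ℝ) - y' := by linarith
  set ξ : ℝ := (-y' / (y - y')) * x + (y / (y - y')) * x' with hξ
  have i : D.I ξ 0 := D.imix2 h (D.iF h') (s := -y' / (y - y')) (t := y / (y - y'))
    (div_pos (by linarith) hp) (div_nonneg (by linarith) hp.le) (by field_simp; ring) hξ
    (by field_simp; ring)
  have hξ1 : 1 ≤ ξ := by
    have : ξ = (-y' * x + y * x') / (y - y') := by rw [hξ]; ring
    rw [this, le_div_iff₀ hp]; nlinarith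
  apply n1
  exact D.imix2 i h00 (s := 1 / ξ) (t := 1 - 1 / ξ) (by positivity)
    (by rw [sub_nonneg, div_le_one (by linarith)]; exact hξ1) (by ring) (by field_simp; ring)
    (by ring)

lemma c_norm (h00 : D.F 0 0 5) (h10 : D.F 1 0 5) (h01 : D.F 0 1 5) (hW : ¬ D.W2)
    (h9 : ∀ x y : ℤ, D.n x y ≤ 9) (hbig : 9 ≤ D.big) {w1 w2 : ℤ} (hw : D.I w1 w2) (hw1 : 1 ≤ w1)
    (hw2 : 1 ≤ w2) : D.Coll := by
  have n1 : ¬ D.I 1 1 ∨ ∀ l, D.F 1 1 l → l ≤ 3 := by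
    by_cases h : D.I 1 1
    · right; intro l hl; exact D.cap3r 1 1 h hl (by norm_num) (by norm_num)
    · exact Or.inl h
  have pos : ∀ x y : ℤ, D.I x y → 1 ≤ x ∧ 1 ≤ y := by
    intro x y h
    rcases D.cR h00 h10 h01 h with h' | ⟨hx, hy, -⟩ | ⟨hx, hy, -⟩
    · exact h'
    · exact (D.cS h00 h10 hw h hw1 hw2 hx hy).elim
    · refine ((D.map sw).cS (x := w2) (y := w1) (x' := y) (y' := x) ?_ ?_ ?_ ?_ hw2 hw1 hy hx).elim
      · rw [sw_F]; exact h00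
      · rw [sw_F]; exact h01
      · rw [sw_I]; exact hw
      · rw [sw_I]; exact h
  have three : ∀ x y : ℤ, D.I x y → x + y ≤ 3 := by
    intro x y h
    obtain ⟨hx, hy⟩ := pos x y h
    by_contra hc
    have hxr : (1 : ℝ) ≤ x := by exact_mod_cast hx
    have hyr : (1 : ℝ) ≤ y := by exact_mod_cast hy
    have hcr : (4 : ℝ) ≤ x + y := by exact_mod_cast (by omega : 4 ≤ x + y)
    have hp : 0 < (x : ℝ) + y - 1 := by linarith
    have i : D.I 1 1 := by
      refine D.imix3 h h10 h01 (s := 1 / (x + y - 1)) (t := (y - 1) / (x + y - 1))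
        (u := (x - 1) / (x + y - 1)) (by positivity) (div_nonneg (by linarith) hp.le)
        (div_nonneg (by linarith) hp.le) ?_ ?_ ?_
      · field_simp; ring
      · field_simp; ring
      · field_simp; ring
    have f : D.F 1 1 (10 / 3) := by
      refine D.mix3 (D.iF h) h10 h01 (s := 1 / (x + y - 1)) (t := (y - 1) / (x + y - 1))
        (u := (x - 1) / (x + y - 1)) (by positivity) (div_nonneg (by linarith) hp.le)
        (div_nonneg (by linarith) hp.le) ?_ ?_ ?_ (by norm_num) ?_
      · field_simp; ring
      · field_simp; ring
      · field_simp; ring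
      · have : 2 / 3 ≤ ((x : ℝ) + y - 2) / (x + y - 1) := by
          rw [div_le_div_iff₀ (by norm_num) hp]; linarith
        have e : ((y : ℝ) - 1) / (x + y - 1) + (x - 1) / (x + y - 1) =
          ((x : ℝ) + y - 2) / (x + y - 1) := by ring
        linarith
    have := D.cap3r 1 1 i f (by norm_num) (by norm_num)
    norm_num at this
  by_cases hA : D.I 2 1
  · by_cases hB : D.I 1 2
    · exfalso
      obtain ⟨ε1, he1, hf1⟩ := D.ipos hA
      obtain ⟨ε2, he2, hf2⟩ := D.ipos hB
      have i11 : D.I 1 1 := D.imix2 hB h10 (s := 1 / 2) (t := 1 / 2) (by norm_num) (by norm_num)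
        (by norm_num) (by norm_num) (by norm_num)
      have c11 : ∀ l, D.F 1 1 l → l ≤ 3 := fun l hl =>
        D.cap3r 1 1 i11 hl (by norm_num) (by norm_num)
      have m10 : D.n 1 0 ≤ 6 := by
        by_contra hc
        have hnr : (7 : ℝ) ≤ (D.n 1 0 : ℝ) := by exact_mod_cast (by omega : 7 ≤ D.n 1 0)
        have := D.nF (x := 1) (y := 0) (by omega)
        have := c11 (3 + ε2 / 2) (D.mix2 hf2 this (s := 1 / 2) (t := 1 / 2) (by norm_num)
          (by norm_num) (by norm_num) (by norm_num) (by norm_num) (by positivity) (by linarith))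
        linarith
      have m01 : D.n 0 1 ≤ 6 := by
        by_contra hc
        have hnr : (7 : ℝ) ≤ (D.n 0 1 : ℝ) := by exact_mod_cast (by omega : 7 ≤ D.n 0 1)
        have := D.nF (x := 0) (y := 1) (by omega)
        have := c11 (3 + ε1 / 2) (D.mix2 hf1 this (s := 1 / 2) (t := 1 / 2) (by norm_num)
          (by norm_num) (by norm_num) (by norm_num) (by norm_num) (by positivity) (by linarith))
        linarith
      have only : ∀ x y : ℤ, D.F x y 5 → (x = 0 ∧ y = 0) ∨ (x = 1 ∧ y = 0) ∨ (x = 0 ∧ y = 1) := by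
        intro x y h
        by_contra hc
        push Not at hc
        have par : ∀ a b : ℤ, D.F a b 5 → (a ≠ x ∨ b ≠ y) → ¬ ((x - a) % 2 = 0 ∧ (y - b) % 2 = 0) := by
          rintro a b hab hne ⟨e1, e2⟩
          apply hW
          refine D.par2 hab h (u := (x - a) / 2) (v := (y - b) / 2) ?_ ?_ ?_ <;> omega
        have p0 := par 0 0 (by simpa using h00) (by omega)
        have p1 := par 1 0 (by simpa using h10) (by omega)
        have p2 := par 0 1 (by simpa using h01) (by omega)
        obtain ⟨X, hX⟩ : ∃ X, x + 1 = 2 * X := ⟨(x + 1) / 2, by omega⟩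
        obtain ⟨Y, hY⟩ : ∃ Y, y + 1 = 2 * Y := ⟨(y + 1) / 2, by omega⟩
        have hXr : (x : ℝ) + 1 = 2 * X := by exact_mod_cast hX
        have hYr : (y : ℝ) + 1 = 2 * Y := by exact_mod_cast hY
        have i : D.I X Y := D.imix2 i11 h (s := 1 / 2) (t := 1 / 2) (by norm_num)
          (by norm_num) (by norm_num) (by linarith) (by linarith)
        have a1 := pos _ _ i
        have a2 := three _ _ i
        obtain ⟨rfl, rfl⟩ | ⟨rfl, rfl⟩ | ⟨rfl, rfl⟩ : (X = 1 ∧ Y = 1) ∨ (X = 2 ∧ Y = 1) ∨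
          (X = 1 ∧ Y = 2) := by omega
        · obtain rfl : x = 1 := by omega
          obtain rfl : y = 1 := by omega
          have := c11 5 (by simpa using h)
          norm_num at this
        · obtain rfl : x = 3 := by omega
          obtain rfl : y = 1 := by omega
          have := c11 5 (D.mix2 h h01 (s := 1 / 3) (t := 2 / 3) (by norm_num)
            (by norm_num) (by norm_num) (by norm_num) (by norm_num) (by norm_num) (by norm_num))
          norm_num at this
        · obtain rfl : x = 1 := by omega
          obtain rfl : y = 3 := by omega
          have := c11 5 (D.mix2 h h10 (s := 1 / 3) (t := 2 / 3) (by norm_num)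
            (by norm_num) (by norm_num) (by norm_num) (by norm_num) (by norm_num) (by norm_num))
          norm_num at this
      have hs : Function.support (fun w : ℤ × ℤ => D.n w.1 w.2 - 5) ⊆
          (({(0, 0), (1, 0), (0, 1)} : Finset (ℤ × ℤ)) : Set (ℤ × ℤ)) := by
        rintro ⟨x, y⟩ hxy
        simp only [Function.mem_support] at hxy
        have h6 : 6 ≤ D.n x y := by omega
        have hr : (6 : ℝ) ≤ D.n x y := by exact_mod_cast h6
        have := only x y (D.mono (D.nF (by omega)) (by norm_num) (by linarith))
        simp only [Finset.coe_insert, Finset.coe_singleton, Set.mem_insert_iff,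
          Set.mem_singleton_iff, Prod.mk.injEq]
        exact this
      have hb : D.big = ∑ w ∈ ({(0, 0), (1, 0), (0, 1)} : Finset (ℤ × ℤ)), (D.n w.1 w.2 - 5) :=
        finsum_eq_sum_of_support_subset _ hs
      rw [Finset.sum_insert (by decide), Finset.sum_insert (by decide), Finset.sum_singleton] at hb
      have := h9 0 0
      simp only at hb
      omega
    · intro x y x' y' x'' y'' a b c
      have k : ∀ x y : ℤ, D.I x y → y = 1 := by
        intro x y h
        have h1 := pos _ _ h
        have h2 := three _ _ h
        by_contra hc
        obtain ⟨rfl, rfl⟩ : x = 1 ∧ y = 2 := by omega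
        exact hB (by simpa using h)
      rw [k _ _ a, k _ _ b, k _ _ c]; ring
  · intro x y x' y' x'' y'' a b c
    have k : ∀ x y : ℤ, D.I x y → x = 1 := by
      intro x y h
      have h1 := pos _ _ h
      have h2 := three _ _ h
      by_contra hc
      obtain ⟨rfl, rfl⟩ : x = 2 ∧ y = 1 := by omega
      exact hA (by simpa using h)
    rw [k _ _ a, k _ _ b, k _ _ c]; ring

lemma c_norm2 (h00 : D.F 0 0 5) (h10 : D.F 1 0 5) (h01 : D.F 0 1 5) (hW : ¬ D.W2)
    (h9 : ∀ x y : ℤ, D.n x y ≤ 9) (hbig : 9 ≤ D.big) : D.Coll := by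
  rcases D.cR h00 h10 h01 D.isa with ⟨hx, hy⟩ | ⟨hx, hy, hs⟩ | ⟨hx, hy, hs⟩
  · exact D.c_norm h00 h10 h01 hW h9 hbig D.isa hx hy
  · have hd : ((0 : ℤ) - 0) * (0 - 1) - (1 - 0) * (0 - 1) = 1 ∨
      ((0 : ℤ) - 0) * (0 - 1) - (1 - 0) * (0 - 1) = -1 := by norm_num
    apply D.Coll_map (triAff 0 1 0 0 1 0 hd)
    refine (D.map (triAff 0 1 0 0 1 0 hd)).c_norm (w1 := 1 - D.sa1 - D.sa2) (w2 := D.sa1)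
      ?_ ?_ ?_ (fun h => hW (D.W2_map _ h)) (fun x y => h9 _ _) (by rwa [map_big]) ?_ (by omega)
      (by omega)
    · rw [map_triAff_F]; norm_num; exact h01
    · rw [map_triAff_F]; norm_num; exact h00
    · rw [map_triAff_F]; norm_num; exact h10
    · rw [map_triAff_I]
      convert D.isa using 1 <;> push_cast <;> ring
  · have hd : ((0 : ℤ) - 1) * (1 - 0) - (0 - 1) * (0 - 0) = 1 ∨
      ((0 : ℤ) - 1) * (1 - 0) - (0 - 1) * (0 - 0) = -1 := by norm_num
    apply D.Coll_map (triAff 1 0 0 0 0 1 hd)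
    refine (D.map (triAff 1 0 0 0 0 1 hd)).c_norm (w1 := 1 - D.sa1 - D.sa2) (w2 := D.sa2)
      ?_ ?_ ?_ (fun h => hW (D.W2_map _ h)) (fun x y => h9 _ _) (by rwa [map_big]) ?_ (by omega)
      (by omega)
    · rw [map_triAff_F]; norm_num; exact h10
    · rw [map_triAff_F]; norm_num; exact h00
    · rw [map_triAff_F]; norm_num; exact h01
    · rw [map_triAff_I]
      convert D.isa using 1 <;> push_cast <;> ring

lemma odd_det {a b c d : ℤ} (h1 : ¬ (a % 2 = 0 ∧ b % 2 = 0)) (h2 : ¬ (c % 2 = 0 ∧ d % 2 = 0))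
    (h3 : ¬ ((a - c) % 2 = 0 ∧ (b - d) % 2 = 0)) : a * d - c * b ≠ 0 := by
  intro h
  have h4 : (a * d - c * b) % 2 = 0 := by rw [h]; rfl
  rw [Int.sub_emod, Int.mul_emod, Int.mul_emod c b] at h4
  rcases Int.emod_two_eq a with e1 | e1 <;> rcases Int.emod_two_eq b with e2 | e2 <;>
  rcases Int.emod_two_eq c with e3 | e3 <;> rcases Int.emod_two_eq d with e4 | e4 <;>
  rw [e1, e2, e3, e4] at h4 <;> first | omega | (norm_num at h4)

lemma c_ind (hW : ¬ D.W2) (h9 : ∀ x y : ℤ, D.n x y ≤ 9) (hbig : 9 ≤ D.big) (n : ℕ) :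
    ∀ p q r s u v : ℤ, D.F p q 5 → D.F r s 5 → D.F u v 5 →
    ((r - p) * (v - q) - (u - p) * (s - q)).natAbs = n →
    (r - p) * (v - q) - (u - p) * (s - q) ≠ 0 → D.Coll := by
  induction n using Nat.strong_induction_on with
  | _ n ih =>
  intro p q r s u v h1 h2 h3 hn hne
  by_cases hone : ((r - p) * (v - q) - (u - p) * (s - q)).natAbs = 1
  · have hd : (r - p) * (v - q) - (u - p) * (s - q) = 1 ∨
        (r - p) * (v - q) - (u - p) * (s - q) = -1 := by omega
    apply D.Coll_map (triAff p q r s u v hd)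
    refine (D.map (triAff p q r s u v hd)).c_norm2 ?_ ?_ ?_ (fun h => hW (D.W2_map _ h))
      (fun x y => h9 _ _) (by rwa [map_big])
    · rw [map_triAff_F]; simpa using h1
    · rw [map_triAff_F]; simpa using h2
    · rw [map_triAff_F]; simpa using h3
  · obtain ⟨x, y, α, β, hα, hβ, hab, hx, hy, n1, n2, n3⟩ := tri (r - p) (s - q) (u - p) (v - q) (by
      rw [Int.abs_eq_natAbs, mul_comm (s - q)]; omega)
    push_cast at hx hy
    have hβ1 : β < 1 := by
      by_contra hc
      have e1 : β = 1 := by linarith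
      have e2 : α = 0 := by linarith
      rw [e1, e2] at hx hy
      apply n3
      constructor
      · have : (x : ℝ) = u - p := by linarith
        exact_mod_cast this
      · have : (y : ℝ) = v - q := by linarith
        exact_mod_cast this
    have hF : D.F (p + x : ℤ) (q + y : ℤ) 5 := by
      refine D.mix3 h1 h2 h3 (s := 1 - α - β) (t := α) (u := β) (by linarith) hα hβ (by ring)
        ?_ ?_ (by norm_num) (by linarith)
      · push_cast; rw [hx]; ring
      · push_cast; rw [hy]; ring
    have par : ∀ a b c d : ℤ, D.F a b 5 → D.F c d 5 → (a ≠ c ∨ b ≠ d) →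
        ¬ ((c - a) % 2 = 0 ∧ (d - b) % 2 = 0) := by
      rintro a b c d hab hcd hne ⟨e1, e2⟩
      apply hW
      refine D.par2 hab hcd (u := (c - a) / 2) (v := (d - b) / 2) ?_ ?_ ?_ <;> omega
    have hd : (r - p) * (q + y - q) - (p + x - p) * (s - q) ≠ 0 := by
      apply odd_det
      · apply par _ _ _ _ h1 h2
        by_contra hc
        push Not at hc
        apply hne
        rw [hc.1, hc.2]; ring
      · exact par _ _ _ _ h1 hF (by omega)
      · have := par _ _ _ _ hF h2 (by omega)
        have e1 : r - p - (p + x - p) = r - (p + x) := by ring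
        have e2 : s - q - (q + y - q) = s - (q + y) := by ring
        rw [e1, e2]; exact this
    refine ih _ ?_ p q r s (p + x) (q + y) h1 h2 hF rfl hd
    rw [← hn]
    set d0 := (r - p) * (v - q) - (u - p) * (s - q) with hd0
    have e : (((r - p) * (q + y - q) - (p + x - p) * (s - q) : ℤ) : ℝ) = β * (d0 : ℝ) := by
      rw [hd0]; push_cast; rw [add_sub_cancel_left, add_sub_cancel_left, hx, hy]; ring
    have hner : (d0 : ℝ) ≠ 0 := by exact_mod_cast hne
    have : |(((r - p) * (q + y - q) - (p + x - p) * (s - q) : ℤ) : ℝ)| < |(d0 : ℝ)| := by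
      rw [e, abs_mul, abs_of_nonneg hβ]
      have : 0 < |(d0 : ℝ)| := abs_pos.2 hner
      nlinarith
    rw [← Int.cast_abs, ← Int.cast_abs] at this
    have : |(r - p) * (q + y - q) - (p + x - p) * (s - q)| < |d0| := by exact_mod_cast this
    rw [Int.abs_eq_natAbs, Int.abs_eq_natAbs] at this
    exact_mod_cast this

/-- Steps 2c and 2d -/
theorem W2_or_Coll (hbig : 9 ≤ D.big) : D.W2 ∨ D.Coll := by
  by_cases hW : D.W2
  · exact Or.inl hW
  right
  by_cases h10 : ∃ x y : ℤ, 10 ≤ D.n x y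
  · obtain ⟨x, y, h⟩ := h10
    have hr : (10 : ℝ) ≤ D.n x y := by exact_mod_cast h
    exact D.coll_of_nine (D.mono (D.nF (by omega)) (by norm_num) (by linarith) : D.F x y 9)
  push Not at h10
  have h9 : ∀ x y : ℤ, D.n x y ≤ 9 := fun x y => by have := h10 x y; omega
  set S : Set (ℤ × ℤ) := Function.support (fun w : ℤ × ℤ => D.n w.1 w.2 - 5) with hS
  have hSF : ∀ w ∈ S, D.F w.1 w.2 5 := by
    intro w hw
    simp only [hS, Function.mem_support] at hw
    have h6 : 6 ≤ D.n w.1 w.2 := by omega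
    have hr : (6 : ℝ) ≤ D.n w.1 w.2 := by exact_mod_cast h6
    exact D.mono (D.nF (by omega)) (by norm_num) (by linarith)
  have hfin : S.Finite := D.fin.subset fun w hw => D.zero (hSF w hw)
  have hb : D.big = ∑ w ∈ hfin.toFinset, (D.n w.1 w.2 - 5) :=
    finsum_eq_sum_of_support_subset _ (by simp [hS])
  have hcard : 2 < hfin.toFinset.card := by
    by_contra hc
    have : ∑ w ∈ hfin.toFinset, (D.n w.1 w.2 - 5) ≤ hfin.toFinset.card • 4 :=
      Finset.sum_le_card_nsmul _ _ _ fun w _ => by have := h9 w.1 w.2; omega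
    simp only [smul_eq_mul] at this
    omega
  obtain ⟨a, b, c, ha, hb', hc, hab, hac, hbc⟩ := Finset.two_lt_card_iff.1 hcard
  rw [Set.Finite.mem_toFinset] at ha hb' hc
  have par : ∀ a b c d : ℤ, D.F a b 5 → D.F c d 5 → (a ≠ c ∨ b ≠ d) →
      ¬ ((c - a) % 2 = 0 ∧ (d - b) % 2 = 0) := by
    rintro a b c d hab hcd hne ⟨e1, e2⟩
    apply hW
    refine D.par2 hab hcd (u := (c - a) / 2) (v := (d - b) / 2) ?_ ?_ ?_ <;> omega
  have ne : ∀ x y : ℤ × ℤ, x ≠ y → x.1 ≠ y.1 ∨ x.2 ≠ y.2 := by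
    intro x y h
    by_contra hc
    push Not at hc
    exact h (Prod.ext hc.1 hc.2)
  refine D.c_ind hW h9 hbig _ a.1 a.2 b.1 b.2 c.1 c.2 (hSF a ha) (hSF b hb') (hSF c hc) rfl ?_
  apply odd_det
  · exact par _ _ _ _ (hSF a ha) (hSF b hb') (ne _ _ hab)
  · exact par _ _ _ _ (hSF a ha) (hSF c hc) (ne _ _ hac)
  · have := par _ _ _ _ (hSF c hc) (hSF b hb') (ne _ _ hbc.symm)
    have e1 : b.1 - a.1 - (c.1 - a.1) = b.1 - c.1 := by ring
    have e2 : b.2 - a.2 - (c.2 - a.2) = b.2 - c.2 := by ring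
    rw [e1, e2]; exact this

end Dat

namespace Dat

variable (D : Dat)

/-- Step 2 (e), normalised -/
lemma e_norm (hC : D.Coll) (h0 : D.I 0 0) (h1 : D.I 1 0) {p q : ℤ} (hp : D.F p q 0) : |q| ≤ 1 := by
  by_contra hc
  obtain ⟨x, y, α, β, hα, hβ, hab, hx, hy, n1, n2, n3⟩ := tri 1 0 p q (by
    rw [one_mul, zero_mul, sub_zero]; omega)
  push_cast at hx hy
  have hβ1 : β < 1 := by
    by_contra hc
    have e1 : β = 1 := by linarith
    have e2 : α = 0 := by linarith
    rw [e1, e2] at hx hy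
    apply n3
    constructor
    · have : (x : ℝ) = p := by linarith
      exact_mod_cast this
    · have : (y : ℝ) = q := by linarith
      exact_mod_cast this
  have hi : D.I x y := by
    rcases hα.lt_or_eq with ha | ha
    · exact D.imix3 h1 hp (D.iF h0) (s := α) (t := β) (u := 1 - α - β) ha hβ (by linarith)
        (by ring) (by rw [hx]; ring) (by rw [hy]; ring)
    · exact D.imix3 h0 hp (D.iF h1) (s := 1 - α - β) (t := β) (u := α) (by linarith) hβ (by linarith)
        (by ring) (by rw [hx]; ring) (by rw [hy]; ring)
  have := hC 0 0 1 0 x y (by simpa using h0) (by simpa using h1) hi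
  have hy0 : y = 0 := by linarith
  subst hy0
  have hq : (q : ℝ) ≠ 0 := by
    have : q ≠ 0 := by rintro rfl; simp at hc
    exact_mod_cast this
  have hb0 : β = 0 := by
    have : β * (q : ℝ) = 0 := by rw [Int.cast_zero] at hy; linarith
    exact (mul_eq_zero.1 this).resolve_right hq
  subst hb0
  have hxa : (x : ℝ) = α := by linarith
  have hx0 : (0 : ℝ) ≤ x := by linarith
  have hx1 : (x : ℝ) ≤ 1 := by linarith
  have hx0 : 0 ≤ x := by exact_mod_cast hx0
  have hx1 : x ≤ 1 := by exact_mod_cast hx1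
  omega

lemma e_main (hC : D.Coll) {x y x' y' : ℤ} (h : D.I x y) (h' : D.I x' y')
    (hne : x ≠ x' ∨ y ≠ y') : D.W2 := by
  obtain ⟨ψ, g, hg, h1, h2, h3, h4⟩ := exists_aff x y x' y' hne
  have hC' : (D.map ψ).Coll := by
    intro a b c d e f i1 i2 i3
    rw [map_I] at i1 i2 i3
    have := hC _ _ _ _ _ _ i1 i2 i3
    have e' : (ψ.a * ψ.d - ψ.b * ψ.c) * ((c - a) * (f - b) - (e - a) * (d - b)) = 0 := by
      simp only [Aff.X, Aff.Y] at this
      linear_combination this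
    have hd : ψ.a * ψ.d - ψ.b * ψ.c ≠ 0 := by
      rcases ψ.det with h | h <;> rw [h] <;> norm_num
    have := (mul_eq_zero.1 e').resolve_left hd
    linarith
  have a : (D.map ψ).I (0 : ℤ) (0 : ℤ) := by rw [map_I, h1, h2]; exact h
  have b : (D.map ψ).I g (0 : ℤ) := by rw [map_I, h3, h4]; exact h'
  have a' : (D.map ψ).I 0 0 := by simpa using a
  have hgr : (1 : ℝ) ≤ g := by exact_mod_cast hg
  have c : (D.map ψ).I 1 0 := (D.map ψ).imix2 b ((D.map ψ).iF a') (s := 1 / g) (t := 1 - 1 / g)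
    (by positivity) (by rw [sub_nonneg, div_le_one (by linarith)]; exact hgr) (by ring)
    (by field_simp; simp) (by simp)
  apply D.W2_map ψ
  refine (D.map ψ).W2_of_y' (-1) fun u v huv => ?_
  have := (D.map ψ).e_norm hC' a' c huv
  rw [abs_le] at this
  omega

/-- only one interior lattice point -/
def Uniq : Prop := ∀ x y : ℤ, D.I x y → x = D.sa1 ∧ y = D.sa2

lemma Uniq_map (ψ : Aff) (h : D.Uniq) : (D.map ψ).Uniq := by
  intro x y hi
  rw [map_I] at hi
  obtain ⟨h1, h2⟩ := h _ _ hi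
  show x = ψ.X' D.sa1 D.sa2 ∧ y = ψ.Y' D.sa1 D.sa2
  rw [← h1, ← h2]
  exact ⟨(ψ.X'X x y).symm, (ψ.Y'Y x y).symm⟩

lemma uniq2 (hU : D.Uniq) {x y x' y' : ℤ} (h : D.I x y) (h' : D.I x' y') : x = x' ∧ y = y' := by
  have := hU _ _ h; have := hU _ _ h'; omega

lemma nb {x y : ℤ} (h : D.F x y 0) : ∃ l, D.F x y l ∧ (D.n x y : ℝ) ≤ l + 1 := by
  by_cases hn : 1 ≤ D.n x y
  · exact ⟨_, D.nF hn, by linarith⟩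
  · refine ⟨0, h, ?_⟩
    have : D.n x y = 0 := by omega
    rw [this]; norm_num

lemma row3_no (hU : D.Uniq) (h0 : D.F 0 0 0) (h3 : D.F 3 0 0) {c : ℝ} (hc : D.I c 0) : False := by
  have i1 : D.I (1 : ℤ) (0 : ℤ) := by
    simp only [Int.cast_one, Int.cast_zero]
    rcases le_or_gt c 1 with h | h
    · exact D.imix2 hc h3 (s := 2 / (3 - c)) (t := 1 - 2 / (3 - c)) (div_pos (by norm_num) (by linarith))
        (by rw [sub_nonneg, div_le_one (by linarith)]; linarith) (by ring)
        (by have : 3 - c ≠ 0 := by linarith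
            field_simp; ring) (by ring)
    · exact D.imix2 hc h0 (s := 1 / c) (t := 1 - 1 / c) (by positivity)
        (by rw [sub_nonneg, div_le_one (by linarith)]; linarith) (by ring) (by field_simp; ring)
        (by ring)
  have i2 : D.I (2 : ℤ) (0 : ℤ) := by
    simp only [Int.cast_ofNat, Int.cast_zero]
    rcases le_or_gt c 2 with h | h
    · exact D.imix2 hc h3 (s := 1 / (3 - c)) (t := 1 - 1 / (3 - c)) (div_pos (by norm_num) (by linarith))
        (by rw [sub_nonneg, div_le_one (by linarith)]; linarith) (by ring)
        (by have : 3 - c ≠ 0 := by linarith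
            field_simp; ring) (by ring)
    · exact D.imix2 hc h0 (s := 2 / c) (t := 1 - 2 / c) (by positivity)
        (by rw [sub_nonneg, div_le_one (by linarith)]; linarith) (by ring) (by field_simp; ring)
        (by ring)
  have := D.uniq2 hU i1 i2
  omega

/-- the triangle with vertices `(0,0)`, `(3,0)`, `(0,3)` -/
lemma s1_tri (hU : D.Uniq) (h0 : D.F 0 0 0) (h3 : D.F 3 0 0) (hp : D.F 0 3 0)
    (hy0 : ∀ x y : ℤ, D.F x y 0 → 0 ≤ y) (hy3 : ∀ x y : ℤ, D.F x y 0 → y ≤ 3)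
    (hrow3 : ∀ x : ℤ, D.F x 3 0 → x = 0) : D.N ≤ 54 := by
  have f01 : D.F 0 1 0 := D.mix2 h0 hp (s := 2 / 3) (t := 1 / 3) (by norm_num) (by norm_num)
    (by norm_num) (by norm_num) (by norm_num) le_rfl (by norm_num)
  have f02 : D.F 0 2 0 := D.mix2 h0 hp (s := 1 / 3) (t := 2 / 3) (by norm_num) (by norm_num)
    (by norm_num) (by norm_num) (by norm_num) le_rfl (by norm_num)
  have f21 : D.F 2 1 0 := D.mix2 h3 hp (s := 2 / 3) (t := 1 / 3) (by norm_num) (by norm_num)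
    (by norm_num) (by norm_num) (by norm_num) le_rfl (by norm_num)
  have f12 : D.F 1 2 0 := D.mix2 h3 hp (s := 1 / 3) (t := 2 / 3) (by norm_num) (by norm_num)
    (by norm_num) (by norm_num) (by norm_num) le_rfl (by norm_num)
  have f10 : D.F 1 0 0 := D.rowF h0 h3 (by norm_num) (by norm_num)
  have f20 : D.F 2 0 0 := D.rowF h0 h3 (by norm_num) (by norm_num)
  have i11 : D.I 1 1 := D.rowInt f01 f21 (by norm_num) (by norm_num) hp (by norm_num) h0
    (by norm_num)
  have noL : ∀ c : ℝ, D.F c 1 0 → 0 ≤ c := by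
    intro c hc
    by_contra hneg
    have := D.rowInt hc f21 (m := 0) (by linarith) (by norm_num) hp (by norm_num) h0
      (by norm_num)
    have := D.uniq2 hU (x := 1) (y := 1) (x' := 0) (y' := 1) (by simpa using i11) (by simpa using this)
    omega
  have noR : ∀ c : ℝ, D.F c 1 0 → c ≤ 2 := by
    intro c hc
    by_contra hneg
    have := D.rowInt f01 hc (m := 2) (by norm_num) (by linarith) hp (by norm_num) h0
      (by norm_num)
    have := D.uniq2 hU (x := 1) (y := 1) (x' := 2) (y' := 1) (by simpa using i11) (by simpa using this)
    omega
  have reg : ∀ x y : ℤ, D.F x y 0 → 0 ≤ x ∧ 0 ≤ y ∧ x + y ≤ 3 := by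
    intro x y h
    have a := hy0 x y h
    have b := hy3 x y h
    obtain rfl | rfl | rfl | rfl : y = 0 ∨ y = 1 ∨ y = 2 ∨ y = 3 := by omega
    · have g : D.F (2 / 3 * x) 1 0 := D.mix2 h hp (s := 2 / 3) (t := 1 / 3) (by norm_num)
        (by norm_num) (by norm_num) (by ring) (by norm_num) le_rfl (by norm_num)
      have g1 := noL _ g
      have g2 := noR _ g
      have g1 : (0 : ℝ) ≤ x := by linarith
      have g2 : (x : ℝ) ≤ 3 := by linarith
      have g1 : 0 ≤ x := by exact_mod_cast g1
      have g2 : x ≤ 3 := by exact_mod_cast g2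
      omega
    · have g1 := noL _ (by simpa using h)
      have g2 := noR _ (by simpa using h)
      have g1 : 0 ≤ x := by exact_mod_cast g1
      have g2 : x ≤ 2 := by exact_mod_cast g2
      omega
    · have g : D.F (1 / 2 * x) 1 0 := D.mix2 h h0 (s := 1 / 2) (t := 1 / 2) (by norm_num)
        (by norm_num) (by norm_num) (by ring) (by norm_num) le_rfl (by norm_num)
      have g' : D.F (1 / 2 * x + 3 / 2) 1 0 := D.mix2 h h3 (s := 1 / 2) (t := 1 / 2) (by norm_num)
        (by norm_num) (by norm_num) (by ring) (by norm_num) le_rfl (by norm_num)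
      have g1 := noL _ g
      have g2 := noR _ g'
      have g1 : (0 : ℝ) ≤ x := by linarith
      have g2 : (x : ℝ) ≤ 1 := by linarith
      have g1 : 0 ≤ x := by exact_mod_cast g1
      have g2 : x ≤ 1 := by exact_mod_cast g2
      omega
    · have := hrow3 x (by simpa using h)
      omega
  set S : Finset (ℤ × ℤ) := {(0, 0), (3, 0), (0, 3), (1, 0), (0, 2), (2, 1), (2, 0), (0, 1), (1, 2),
    (1, 1)} with hS
  have hs : Function.support (fun w : ℤ × ℤ => D.n w.1 w.2) ⊆ (S : Set (ℤ × ℤ)) := by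
    rintro ⟨x, y⟩ hxy
    simp only [Function.mem_support] at hxy
    have := reg x y (D.zero (D.nF (by omega)))
    simp only [hS, Finset.coe_insert, Finset.coe_singleton, Set.mem_insert_iff,
      Set.mem_singleton_iff, Prod.mk.injEq]
    omega
  have hN : D.N = ∑ w ∈ S, D.n w.1 w.2 := finsum_eq_sum_of_support_subset _ hs
  rw [hS, Finset.sum_insert (by decide), Finset.sum_insert (by decide),
    Finset.sum_insert (by decide), Finset.sum_insert (by decide), Finset.sum_insert (by decide),
    Finset.sum_insert (by decide), Finset.sum_insert (by decide), Finset.sum_insert (by decide),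
    Finset.sum_insert (by decide), Finset.sum_singleton] at hN
  simp only at hN
  have c11 : ∀ l, D.F 1 1 l → l ≤ 3 := fun l hl =>
        D.cap3r 1 1 i11 hl (by norm_num) (by norm_num)
  have triple : ∀ a b c d e f : ℤ, D.F a b 0 → D.F c d 0 → D.F e f 0 → a + c + e = 3 →
      b + d + f = 3 → D.n a b + D.n c d + D.n e f ≤ 12 := by
    intro a b c d e f h1 h2 h3 e1 e2
    obtain ⟨l1, g1, b1⟩ := D.nb h1
    obtain ⟨l2, g2, b2⟩ := D.nb h2
    obtain ⟨l3, g3, b3⟩ := D.nb h3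
    have e1r : (a : ℝ) + c + e = 3 := by exact_mod_cast e1
    have e2r : (b : ℝ) + d + f = 3 := by exact_mod_cast e2
    have n1 := D.nonneg g1
    have n2 := D.nonneg g2
    have n3 := D.nonneg g3
    have := c11 ((l1 + l2 + l3) / 3) (D.mix3 g1 g2 g3 (s := 1 / 3) (t := 1 / 3) (u := 1 / 3)
      (by norm_num) (by norm_num) (by norm_num) (by norm_num) (by linarith) (by linarith)
      (by positivity) (by linarith))
    have : (D.n a b : ℝ) + D.n c d + D.n e f ≤ 12 := by linarith
    exact_mod_cast this
  have t1 := triple 0 0 3 0 0 3 (by simpa using h0) (by simpa using h3) (by simpa using hp) (by norm_num)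
    (by norm_num)
  have t2 := triple 1 0 0 2 2 1 (by simpa using f10) (by simpa using f02) (by simpa using f21)
    (by norm_num) (by norm_num)
  have t3 := triple 2 0 0 1 1 2 (by simpa using f20) (by simpa using f01) (by simpa using f12)
    (by norm_num) (by norm_num)
  have i11F := D.iF i11
  have t4 := triple 1 1 1 1 1 1 (by simpa using i11F) (by simpa using i11F) (by simpa using i11F)
    (by norm_num) (by norm_num)
  omega

/-- shear and translation fixing the first axis -/
def shear (k : ℤ) : Aff := ⟨1, k, 0, 1, 0, 0, by norm_num⟩

lemma shear_F (k : ℤ) (x y l : ℝ) : (D.map (shear k)).F x y l ↔ D.F (x + k * y) y l := by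
  simp [map, shear]

lemma shear_I (k : ℤ) (x y : ℝ) : (D.map (shear k)).I x y ↔ D.I (x + k * y) y := by
  simp [map, shear]

lemma s1_norm (hU : D.Uniq) (h0 : D.F 0 0 0) (h3 : D.F 3 0 0) (hs : 0 < D.sa2) :
    D.W2 ∨ D.N ≤ 54 := by
  have hsr : (0 : ℝ) < D.sa2 := by exact_mod_cast hs
  have hy0 : ∀ x y : ℤ, D.F x y 0 → 0 ≤ y := by
    intro x y h
    by_contra hc
    have hyr : (y : ℝ) < 0 := by exact_mod_cast (by omega : y < 0)
    have hp : 0 < (D.sa2 : ℝ) - y := by linarith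
    exact D.row3_no hU h0 h3 (D.imix2 D.isa h (s := -y / (D.sa2 - y)) (t := D.sa2 / (D.sa2 - y))
      (div_pos (by linarith) hp) (div_nonneg hsr.le hp.le) (by field_simp; ring) rfl
      (by field_simp; ring))
  have rows : ∀ (p : ℤ) (H : ℝ), D.F p H 0 → 1 < H → ∀ m : ℤ, p / H < m →
      (m : ℝ) < p / H + 3 * (1 - 1 / H) → D.I m (1 : ℤ) := by
    intro p H h hH m h1 h2
    have hi : 1 / H ≤ 1 := by rw [div_le_one (by linarith)]; exact hH.le
    have a : D.F (p / H) 1 0 := D.mix2 h0 h (s := 1 - 1 / H) (t := 1 / H) (by linarith)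
      (by positivity) (by ring) (by field_simp; ring) (by field_simp; ring) le_rfl (by simp)
    have b : D.F (p / H + 3 * (1 - 1 / H)) 1 0 := D.mix2 h3 h (s := 1 - 1 / H) (t := 1 / H)
      (by linarith) (by positivity) (by ring) (by field_simp; ring) (by field_simp; ring) le_rfl
      (by simp)
    simpa using D.rowInt a b h1 h2 h hH h0 (by norm_num)
  have hy3 : ∀ x y : ℤ, D.F x y 0 → y ≤ 3 := by
    intro x y h
    by_contra hc
    have hyr : (4 : ℝ) ≤ y := by exact_mod_cast (by omega : 4 ≤ y)
    have hi : 1 / (y : ℝ) ≤ 1 / 4 := one_div_le_one_div_of_le (by norm_num) hyr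
    obtain ⟨m, hm1, hm2⟩ := ex_int (x / y)
    have i1 := rows x y h (by linarith) m hm1 (by linarith)
    have i2 := rows x y h (by linarith) (m + 1) (by push_cast; linarith) (by push_cast; linarith)
    have := D.uniq2 hU i1 i2
    omega
  have hr3 : ∀ x : ℤ, D.F x 3 0 → ∃ k, x = 3 * k ∧ D.I (k + 1 : ℤ) (1 : ℤ) := by
    intro x h
    obtain ⟨k, hk⟩ : ∃ k, k = x / 3 := ⟨_, rfl⟩
    have i1 := rows x 3 h (by norm_num) (k + 1)
    have i2 := rows x 3 h (by norm_num) (k + 2)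
    have e : 3 * k ≤ x ∧ x ≤ 3 * k + 2 := by omega
    have e1 : 3 * (k : ℝ) ≤ x := by exact_mod_cast e.1
    have e2 : (x : ℝ) ≤ 3 * k + 2 := by exact_mod_cast e.2
    have i1 := i1 (by push_cast; linarith) (by push_cast; linarith)
    refine ⟨k, ?_, i1⟩
    by_contra hne
    have e3 : 3 * (k : ℝ) + 1 ≤ x := by exact_mod_cast (by omega : 3 * k + 1 ≤ x)
    have i2 := i2 (by push_cast; linarith) (by push_cast; linarith)
    have := D.uniq2 hU i1 i2
    omega
  by_cases hH : ∃ x : ℤ, D.F x 3 0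
  · right
    obtain ⟨x, hx⟩ := hH
    obtain ⟨k, rfl, hk⟩ := hr3 x hx
    rw [← D.map_N (shear k)]
    refine (D.map (shear k)).s1_tri (D.Uniq_map _ hU) ?_ ?_ ?_ ?_ ?_ ?_
    · rw [shear_F]; simpa using h0
    · rw [shear_F]; simpa using h3
    · rw [shear_F]; convert hx using 1; push_cast; ring
    · intro u v h
      rw [shear_F] at h
      exact hy0 (u + k * v) v (by push_cast; exact h)
    · intro u v h
      rw [shear_F] at h
      exact hy3 (u + k * v) v (by push_cast; exact h)
    · intro u h
      rw [shear_F] at h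
      obtain ⟨k', hk', hk2⟩ := hr3 (u + k * 3) (by push_cast; exact h)
      have := D.uniq2 hU hk hk2
      omega
  · left
    push Not at hH
    refine D.W2_of_y' 0 fun x y h => ⟨hy0 x y h, ?_⟩
    have := hy3 x y h
    have : y ≠ 3 := by
      rintro rfl; exact hH x (by simpa using h)
    omega

lemma s1_norm2 (hU : D.Uniq) (h0 : D.F 0 0 0) (h3 : D.F 3 0 0) : D.W2 ∨ D.N ≤ 54 := by
  rcases lt_trichotomy D.sa2 0 with h | h | h
  · have := (D.map rY).s1_norm (D.Uniq_map _ hU) (by rw [rY_F]; simpa) (by rw [rY_F]; simpa) (by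
      show 0 < rY.Y' D.sa1 D.sa2
      simp [rY, Aff.Y']; exact h)
    rw [map_N] at this
    rcases this with h | h
    · exact Or.inl (D.W2_map _ h)
    · exact Or.inr h
  · exfalso
    have := D.isa
    rw [h] at this
    exact D.row3_no hU h0 h3 (by simpa using this)
  · exact D.s1_norm hU h0 h3 h

lemma f_r (hU : D.Uniq) {z1 z2 q1 q2 : ℤ} (hz : D.F z1 z2 0) (hq : D.F q1 q2 0)
    (hd : 2 ≤ |(z1 - D.sa1) * (q2 - D.sa2) - (z2 - D.sa2) * (q1 - D.sa1)|) :
    ∃ (ψ : Aff) (h k : ℤ), 1 ≤ h ∧ h < k ∧ ψ.X 0 0 = z1 ∧ ψ.Y 0 0 = z2 ∧ ψ.X k 0 = q1 ∧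
      ψ.Y k 0 = q2 ∧ ¬ (D.map ψ).I h 0 := by
  obtain ⟨x, y, α, β, hα, hβ, hab, hx, hy, n1, n2, n3⟩ := tri _ _ _ _ hd
  push_cast at hx hy
  have hni : ¬ D.I (D.sa1 + x : ℤ) (D.sa2 + y : ℤ) := by
    intro hi
    have := hU _ _ hi
    apply n1; omega
  have hab1 : α + β = 1 := by
    by_contra hne
    apply hni
    refine D.imix3 D.isa hz hq (s := 1 - α - β) (t := α) (u := β) ?_ hα hβ (by ring) ?_ ?_
    · rcases hab.lt_or_eq with h | h
      · linarith
      · exact (hne h).elim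
    · push_cast; rw [hx]; ring
    · push_cast; rw [hy]; ring
  have hα1 : α = 1 - β := by linarith
  have hβ1 : β ≠ 1 := by
    rintro rfl
    rw [hα1] at hx hy
    apply n3
    constructor
    · have : (x : ℝ) = q1 - D.sa1 := by linarith
      exact_mod_cast this
    · have : (y : ℝ) = q2 - D.sa2 := by linarith
      exact_mod_cast this
  have hβ0 : β ≠ 0 := by
    rintro rfl
    rw [hα1] at hx hy
    apply n2
    constructor
    · have : (x : ℝ) = z1 - D.sa1 := by linarith
      exact_mod_cast this
    · have : (y : ℝ) = z2 - D.sa2 := by linarith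
      exact_mod_cast this
  have hβp : 0 < β := lt_of_le_of_ne hβ (Ne.symm hβ0)
  have hβl : β < 1 := lt_of_le_of_ne (by linarith) hβ1
  obtain ⟨ψ, h, hh, e1, e2, e3, e4⟩ := exists_aff z1 z2 (D.sa1 + x) (D.sa2 + y) (by
    by_contra hc
    apply n2; omega)
  have k1 := ψ.XX' q1 q2
  have k2 := ψ.YY' q1 q2
  set k := ψ.X' q1 q2
  set k' := ψ.Y' q1 q2
  -- real equations
  have hxr : ((D.sa1 + x : ℤ) : ℝ) = (1 - β) * z1 + β * q1 := by push_cast; rw [hx, hα1]; ring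
  have hyr : ((D.sa2 + y : ℤ) : ℝ) = (1 - β) * z2 + β * q2 := by push_cast; rw [hy, hα1]; ring
  rw [← e3, ← e1, ← k1] at hxr
  rw [← e4, ← e2, ← k2] at hyr
  simp only [Aff.X, Aff.Y] at hxr hyr
  push_cast at hxr hyr
  have hdet : ((ψ.a : ℝ) * ψ.d - ψ.b * ψ.c) ≠ 0 := by
    have : (ψ.a * ψ.d - ψ.b * ψ.c : ℤ) ≠ 0 := by
      rcases ψ.det with h | h <;> rw [h] <;> norm_num
    exact_mod_cast this
  have m1 : (h : ℝ) = β * k := by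
    apply mul_left_cancel₀ hdet
    linear_combination ψ.d * hxr - ψ.b * hyr
  have m2 : β * (k' : ℝ) = 0 := by
    apply mul_left_cancel₀ hdet
    linear_combination ψ.c * hxr - ψ.a * hyr
  have hk'0 : k' = 0 := by
    have := (mul_eq_zero.1 m2).resolve_left hβ0
    exact_mod_cast this
  have hhr : (0 : ℝ) < h := by exact_mod_cast hh
  have hkp : (0 : ℝ) < k := by
    rw [m1] at hhr
    exact (pos_iff_pos_of_mul_pos hhr).1 hβp
  refine ⟨ψ, h, k, hh, ?_, e1, e2, ?_, ?_, ?_⟩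
  · have : (h : ℝ) < k := by rw [m1]; nlinarith
    exact_mod_cast this
  · rw [← k1, hk'0]
  · rw [← k2, hk'0]
  · have e : ((0 : ℤ) : ℝ) = 0 := by norm_num
    rw [← e, map_I, e3, e4]; exact hni

/-- Sub2: a non-interior midpoint -/
lemma s2 (hU : D.Uniq) {p1 p2 z1 z2 r1 r2 : ℤ} (hp : D.F p1 p2 0) (hr : D.F r1 r2 0)
    (e1 : p1 + r1 = 2 * z1) (e2 : p2 + r2 = 2 * z2) (hne : p1 ≠ r1 ∨ p2 ≠ r2)
    (hz : z1 ≠ D.sa1 ∨ z2 ≠ D.sa2) : D.W2 ∨ D.N ≤ 54 := by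
  have hzF : D.F z1 z2 0 := by
    have e1r : (p1 : ℝ) + r1 = 2 * z1 := by exact_mod_cast e1
    have e2r : (p2 : ℝ) + r2 = 2 * z2 := by exact_mod_cast e2
    exact D.mix2 hp hr (s := 1 / 2) (t := 1 / 2) (by norm_num) (by norm_num) (by norm_num)
      (by linarith) (by linarith) le_rfl (by norm_num)
  by_cases hq : ∃ q1 q2 : ℤ, D.F q1 q2 0 ∧
    2 ≤ |(z1 - D.sa1) * (q2 - D.sa2) - (z2 - D.sa2) * (q1 - D.sa1)|
  · obtain ⟨q1, q2, hq, hd⟩ := hq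
    obtain ⟨ψ, h, k, hh, hk, k1, k2, k3, k4, hni⟩ := D.f_r hU hzF hq hd
    set D' := D.map ψ with hD'
    have F0 : D'.F (0 : ℤ) (0 : ℤ) 0 := by rw [hD', map_F, k1, k2]; exact hzF
    have Fk : D'.F k (0 : ℤ) 0 := by rw [hD', map_F, k3, k4]; exact hq
    have Fp : D'.F (ψ.X' p1 p2 : ℤ) (ψ.Y' p1 p2 : ℤ) 0 := by
      rw [hD', map_F, ψ.XX', ψ.YY']; exact hp
    have Fr : D'.F (ψ.X' r1 r2 : ℤ) (ψ.Y' r1 r2 : ℤ) 0 := by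
      rw [hD', map_F, ψ.XX', ψ.YY']; exact hr
    have sx : ψ.X' r1 r2 = - ψ.X' p1 p2 := by
      simp only [Aff.X, Aff.Y] at k1 k2
      simp only [Aff.X']
      linear_combination (ψ.a * ψ.d - ψ.b * ψ.c) * (ψ.d * e1 - ψ.b * e2 - 2 * ψ.d * k1 + 2 * ψ.b * k2)
    have sy : ψ.Y' r1 r2 = - ψ.Y' p1 p2 := by
      simp only [Aff.X, Aff.Y] at k1 k2
      simp only [Aff.Y']
      linear_combination (ψ.a * ψ.d - ψ.b * ψ.c) * (-ψ.c * e1 + ψ.a * e2 + 2 * ψ.c * k1 - 2 * ψ.a * k2)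
    have hne' : ψ.X' p1 p2 ≠ 0 ∨ ψ.Y' p1 p2 ≠ 0 := by
      by_contra hc
      push Not at hc
      have a1 := ψ.XX' p1 p2
      have a2 := ψ.YY' p1 p2
      have b1 := ψ.XX' r1 r2
      have b2 := ψ.YY' r1 r2
      rw [sx, sy, hc.1, hc.2] at b1 b2
      rw [hc.1, hc.2] at a1 a2
      simp only [neg_zero] at b1 b2
      omega
    rw [sx, sy] at Fr
    set x := ψ.X' p1 p2
    set y := ψ.Y' p1 p2
    push_cast at F0 Fk Fr
    have hhr : (1 : ℝ) ≤ h := by exact_mod_cast hh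
    have hkr : (h : ℝ) < k := by exact_mod_cast hk
    obtain ⟨α, β, hI, hF⟩ := D'.supp' hni
    have a1 := hF _ _ _ F0
    have a2 := hF _ _ _ Fk
    have a3 := hF _ _ _ Fp
    have a4 := hF _ _ _ Fr
    have hα : α = 0 := by
      have : 0 ≤ α := by
        by_contra hc; push Not at hc; nlinarith
      have : α ≤ 0 := by
        by_contra hc; push Not at hc; nlinarith
      linarith
    subst hα
    have hβ : β ≠ 0 := by
      rintro rfl
      have := hI _ _ D'.isa
      simp at this
    have hy : (y : ℝ) = 0 := by
      have : β * (y : ℝ) = 0 := by linarith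
      exact (mul_eq_zero.1 this).resolve_left hβ
    have hy0 : y = 0 := by exact_mod_cast hy
    have hx0 : x ≠ 0 := by omega
    rw [hy] at Fp Fr
    rw [neg_zero] at Fr
    have Fm : D'.F (-1) 0 0 := by
      rcases lt_or_gt_of_ne hx0 with h' | h'
      · have : (x : ℝ) ≤ -1 := by exact_mod_cast (by omega : x ≤ -1)
        exact D'.rowF Fp Fr this (by linarith)
      · have : (1 : ℝ) ≤ x := by exact_mod_cast h'
        exact D'.rowF Fr Fp (by linarith) (by linarith)
    have hk2 : (2 : ℝ) ≤ k := by exact_mod_cast (by omega : 2 ≤ k)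
    have F2 : D'.F 2 0 0 := D'.rowF F0 Fk (by norm_num) hk2
    let τ : Aff := ⟨1, 0, 0, 1, -1, 0, by norm_num⟩
    have := (D'.map τ).s1_norm2 (D'.Uniq_map _ (D.Uniq_map _ hU))
      (by simpa [map, τ] using Fm)
      (by
        have : (D'.map τ).F 3 0 0 ↔ D'.F 2 0 0 := by simp [map, τ]; norm_num
        rw [this]; exact F2)
    rw [map_N, hD', map_N] at this
    rcases this with h | h
    · exact Or.inl (D.W2_map _ ((D.map ψ).W2_map _ h))
    · exact Or.inr h
  · left
    push Not at hq
    obtain ⟨ψ, g, hg, h1, h2, h3, h4⟩ := exists_aff D.sa1 D.sa2 z1 z2 (by omega)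
    refine D.W2_of_y ψ (-1) fun x y h => ?_
    rw [map_F] at h
    have := hq _ _ h
    have e : (z1 - D.sa1) * (ψ.Y x y - D.sa2) - (z2 - D.sa2) * (ψ.X x y - D.sa1) =
        (ψ.a * ψ.d - ψ.b * ψ.c) * (g * y) := by
      rw [← h1, ← h2, ← h3, ← h4]; simp only [Aff.X, Aff.Y]; ring
    rw [e, abs_mul] at this
    have e' : |ψ.a * ψ.d - ψ.b * ψ.c| = 1 := by
      rcases ψ.det with h | h <;> rw [h] <;> simp
    rw [e', one_mul, abs_mul, abs_of_pos hg] at this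
    have : |y| < 2 := by nlinarith [abs_nonneg y]
    rw [abs_lt] at this
    omega

/-- Step 2 (f) -/
lemma f_main (hU : D.Uniq) : D.W2 ∨ D.N ≤ 54 := by
  obtain ⟨z1, z2, hz, hlt⟩ := D.push (α := 1) (β := 0) D.isa (by norm_num)
  have hz1 : D.sa1 < z1 := by
    have : (D.sa1 : ℝ) < z1 := by linarith
    exact_mod_cast this
  by_cases hq : ∃ q1 q2 : ℤ, D.F q1 q2 0 ∧
    2 ≤ |(z1 - D.sa1) * (q2 - D.sa2) - (z2 - D.sa2) * (q1 - D.sa1)|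
  · obtain ⟨q1, q2, hq, hd⟩ := hq
    obtain ⟨ψ, h, k, hh, hk, k1, k2, k3, k4, hni⟩ := D.f_r hU hz hq hd
    set D' := D.map ψ with hD'
    have F0 : D'.F (0 : ℤ) (0 : ℤ) 0 := by rw [hD', map_F, k1, k2]; exact hz
    have Fk : D'.F k (0 : ℤ) 0 := by rw [hD', map_F, k3, k4]; exact hq
    have hhr : (1 : ℝ) ≤ h := by exact_mod_cast hh
    have hkr : (h : ℝ) < k := by exact_mod_cast hk
    have hk2 : (2 : ℝ) ≤ k := by exact_mod_cast (by omega : 2 ≤ k)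
    have F2 : D'.F (2 : ℤ) (0 : ℤ) 0 := D'.rowF F0 Fk (by norm_num) (by push_cast; exact hk2)
    have := D'.s2 (D.Uniq_map _ hU) (z1 := 1) (z2 := 0) F0 F2 (by norm_num) (by norm_num)
      (by norm_num) (by
        by_contra hc
        push Not at hc
        have hi := D'.isa
        rw [← hc.1, ← hc.2] at hi
        apply hni
        have hkp : (0 : ℝ) < k - 1 := by linarith
        refine D'.imix2 hi Fk (s := (k - h) / (k - 1)) (t := (h - 1) / (k - 1))
          (div_pos (by linarith) hkp) (div_nonneg (by linarith) hkp.le) (by field_simp; ring) ?_ ?_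
        · push_cast; field_simp; ring
        · simp)
    rw [hD', map_N] at this
    rcases this with h | h
    · exact Or.inl (D.W2_map _ h)
    · exact Or.inr h
  · left
    push Not at hq
    obtain ⟨ψ, g, hg, h1, h2, h3, h4⟩ := exists_aff D.sa1 D.sa2 z1 z2 (by omega)
    refine D.W2_of_y ψ (-1) fun x y h => ?_
    rw [map_F] at h
    have := hq _ _ h
    have e : (z1 - D.sa1) * (ψ.Y x y - D.sa2) - (z2 - D.sa2) * (ψ.X x y - D.sa1) =
        (ψ.a * ψ.d - ψ.b * ψ.c) * (g * y) := by
      rw [← h1, ← h2, ← h3, ← h4]; simp only [Aff.X, Aff.Y]; ring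
    rw [e, abs_mul] at this
    have e' : |ψ.a * ψ.d - ψ.b * ψ.c| = 1 := by
      rcases ψ.det with h | h <;> rw [h] <;> simp
    rw [e', one_mul, abs_mul, abs_of_pos hg] at this
    have : |y| < 2 := by nlinarith [abs_nonneg y]
    rw [abs_lt] at this
    omega

/-- Step 2 for one direction of coincidences -/
theorem W2_or_small (hbig : 9 ≤ D.big) : D.W2 ∨ D.N ≤ 54 := by
  rcases D.W2_or_Coll hbig with h | hC
  · exact Or.inl h
  · by_cases hU : D.Uniq
    · exact D.f_main hU
    · left
      unfold Uniq at hU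
      push Not at hU
      obtain ⟨x, y, hi, hne⟩ := hU
      refine D.e_main hC hi D.isa ?_
      by_contra hc
      push Not at hc
      exact hne hc.1 hc.2

end Dat

namespace Dat

variable (D : Dat)

open Classical in
/-- length of a fibre -/
def flen (x y : ℝ) : ℝ := if h : D.F x y 0 then (D.len h).choose else 0

lemma flen_spec {x y : ℝ} (h : D.F x y 0) : D.F x y (D.flen x y) := by
  unfold flen; rw [dif_pos h]; exact (D.len h).choose_spec.1

lemma flen_max {x y l : ℝ} (h : D.F x y l) : l ≤ D.flen x y := by
  have h0 := D.zero h
  unfold flen; rw [dif_pos h0]; exact (D.len h0).choose_spec.2 l h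

lemma flen_nonneg {x y : ℝ} (h : D.F x y 0) : 0 ≤ D.flen x y := D.flen_max h

/-- twice the fibre length on the middle line -/
def H (s : ℤ) : ℝ := 2 * D.flen 1 (s / 2)

/-- membership on the middle line -/
def M (s : ℤ) : Prop := D.F 1 (s / 2) 0

lemma H_nonneg {s : ℤ} (h : D.M s) : 0 ≤ D.H s := by
  have := D.flen_nonneg h; unfold H; linarith

lemma H_F {s : ℤ} (h : D.M s) : D.F 1 (s / 2) (D.H s / 2) := by
  have := D.flen_spec h
  unfold H
  rwa [mul_div_cancel_left₀ _ (by norm_num : (2 : ℝ) ≠ 0)]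

lemma le_H {s : ℤ} {l : ℝ} (h : D.F 1 (s / 2) l) : 2 * l ≤ D.H s := by
  have := D.flen_max h; unfold H; linarith

lemma H_conc {r s t : ℤ} (hr : D.M r) (ht : D.M t) (h1 : r ≤ s) (h2 : s ≤ t) :
    D.M s ∧ ((t : ℝ) - s) * D.H r + ((s : ℝ) - r) * D.H t ≤ ((t : ℝ) - r) * D.H s := by
  have h1r : (r : ℝ) ≤ s := by exact_mod_cast h1
  have h2r : (s : ℝ) ≤ t := by exact_mod_cast h2
  rcases eq_or_lt_of_le (h1r.trans h2r) with h | h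
  · have e1 : r = s := by
      have : (r : ℝ) = s := by linarith
      exact_mod_cast this
    have e2 : t = s := by
      have : (t : ℝ) = s := by linarith
      exact_mod_cast this
    subst e1; subst e2
    exact ⟨hr, by linarith⟩
  · have hp : (0 : ℝ) < t - r := by linarith
    have n1 := D.H_nonneg hr
    have n2 := D.H_nonneg ht
    have key : D.F 1 (s / 2) (((t : ℝ) - s) / (t - r) * (D.H r / 2) +
        ((s : ℝ) - r) / (t - r) * (D.H t / 2)) := by
      have a1 : 0 ≤ ((t : ℝ) - s) / (t - r) := div_nonneg (by linarith) hp.le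
      have a2 : 0 ≤ ((s : ℝ) - r) / (t - r) := div_nonneg (by linarith) hp.le
      refine D.mix2 (D.H_F hr) (D.H_F ht) a1 a2
        ?_ ?_ ?_ ?_ le_rfl
      · field_simp; ring
      · field_simp; ring
      · field_simp; ring
      · exact add_nonneg (mul_nonneg a1 (by linarith)) (mul_nonneg a2 (by linarith))
    refine ⟨D.zero key, ?_⟩
    have := D.le_H key
    have e : ((t : ℝ) - s) * D.H r + ((s : ℝ) - r) * D.H t = (t - r) * (2 * (((t : ℝ) - s) / (t - r) * (D.H r / 2) +
        ((s : ℝ) - r) / (t - r) * (D.H t / 2))) := by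
      field_simp
    rw [e]
    exact mul_le_mul_of_nonneg_left this hp.le

lemma H_sum {y y' : ℤ} {l l' : ℝ} (h : D.F 0 y l) (h' : D.F 2 y' l') :
    D.M (y + y') ∧ l + l' ≤ D.H (y + y') := by
  have n1 := D.nonneg h
  have n2 := D.nonneg h'
  have key : D.F 1 ((y + y' : ℤ) / 2) ((l + l') / 2) :=
    D.mix2 h h' (s := 1 / 2) (t := 1 / 2) (by norm_num) (by norm_num) (by norm_num)
      (by norm_num) (by push_cast; ring) (by linarith) (by linarith)
  refine ⟨D.zero key, ?_⟩
  have := D.le_H key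
  linarith

lemma M_two {y : ℤ} : D.M (2 * y) ↔ D.F 1 y 0 := by
  unfold M; push_cast; rw [mul_div_cancel_left₀ _ (by norm_num : (2 : ℝ) ≠ 0)]

lemma H_two {y : ℤ} {l : ℝ} (h : D.F 1 y l) : 2 * l ≤ D.H (2 * y) := by
  apply D.le_H; push_cast; rwa [mul_div_cancel_left₀ _ (by norm_num : (2 : ℝ) ≠ 0)]

lemma H_two' {y : ℤ} (h : D.F 1 y 0) : D.F 1 y (D.H (2 * y) / 2) := by
  have := D.H_F (D.M_two.2 h)
  push_cast at this; rwa [mul_div_cancel_left₀ _ (by norm_num : (2 : ℝ) ≠ 0)] at this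

/-- normalised coordinates for three rows -/
structure Nm (i : ℤ) : Prop where
  W : ∀ x y : ℤ, D.F x y 0 → 0 ≤ x ∧ x ≤ 2
  hI : ∀ y : ℤ, D.I 1 y ↔ 1 ≤ y ∧ y ≤ i
  hi : 1 ≤ i
  sa : D.sa1 = 1

lemma sa_one (W : ∀ x y : ℤ, D.F x y 0 → 0 ≤ x ∧ x ≤ 2) {x y : ℤ} (hi : D.I x y) : x = 1 := by
  obtain ⟨p, q, h1, h2⟩ := D.push (α := 1) (β := 0) hi (by norm_num)
  obtain ⟨r, s, h3, h4⟩ := D.push (α := -1) (β := 0) hi (by norm_num)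
  have a1 : x < p := by
    have : (x : ℝ) < p := by linarith
    exact_mod_cast this
  have a2 : r < x := by
    have : (r : ℝ) < x := by linarith
    exact_mod_cast this
  have := W _ _ h1
  have := W _ _ h3
  omega

lemma exNm (h : D.W2) : ∃ (ψ : Aff) (i : ℤ), (D.map ψ).Nm i := by
  obtain ⟨ψ, W⟩ := h
  set D' := D.map ψ with hD'
  have hfin : {y : ℤ | D'.I 1 y}.Finite := by
    have := D'.fin.preimage (f := fun y : ℤ => ((1 : ℤ), y)) (by
      intro a _ b _ hab; simpa using hab)
    refine this.subset ?_
    intro y hy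
    simp only [Set.mem_preimage, Set.mem_ofPred_eq, Int.cast_one] at hy ⊢
    exact D'.iF hy
  have hs1 : D'.sa1 = 1 := D'.sa_one W D'.isa
  have hne : {y : ℤ | D'.I 1 y}.Nonempty := ⟨D'.sa2, by
    have := D'.isa
    rw [hs1] at this
    simpa using this⟩
  obtain ⟨m, hm, hmin⟩ := hfin.exists_minimal hne
  obtain ⟨k, hk, hmax⟩ := hfin.exists_maximal hne
  simp only [Set.mem_ofPred_eq] at hm hk hmin hmax
  have hIy : ∀ y : ℤ, D'.I 1 y ↔ m ≤ y ∧ y ≤ k := by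
    intro y
    constructor
    · intro hy
      have := hmin hy
      have := hmax hy
      omega
    · rintro ⟨h1, h2⟩
      rcases eq_or_lt_of_le h1 with h | h
      · rw [← h]; exact hm
      · have h1r : (m : ℝ) < y := by exact_mod_cast h
        have h2r : (y : ℝ) ≤ k := by exact_mod_cast h2
        have hp : (0 : ℝ) < k - m := by linarith
        refine D'.imix2 hk (D'.iF hm) (s := (y - m) / (k - m)) (t := (k - y) / (k - m))
          (div_pos (by linarith) hp) (div_nonneg (by linarith) hp.le) ?_ ?_ ?_ <;>
        · field_simp; ring
  let φ : Aff := ⟨1, 0, 0, 1, 0, m - 1, by norm_num⟩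
  have tr : ∀ x y l : ℝ, (D'.map φ).F x y l ↔ D'.F x (y + (m - 1)) l := by
    intro x y l; simp [map, φ]
  have tI : ∀ x y : ℝ, (D'.map φ).I x y ↔ D'.I x (y + (m - 1)) := by
    intro x y; simp [map, φ]
  have main : (D'.map φ).Nm (k - m + 1) := by
    have W' : ∀ x y : ℤ, (D'.map φ).F x y 0 → 0 ≤ x ∧ x ≤ 2 := by
      intro x y h
      rw [tr] at h
      exact W x (y + (m - 1)) (by push_cast; exact h)
    refine ⟨W', ?_, ?_, ?_⟩
    · intro y
      rw [tI]
      have := hIy (y + (m - 1))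
      push_cast at this
      rw [this]; omega
    · have := (hIy m).1 hm; omega
    · exact (D'.map φ).sa_one W' (D'.map φ).isa
  refine ⟨ψ.comp φ, k - m + 1, ?_⟩
  have eF : ∀ x y l : ℝ, (D.map (ψ.comp φ)).F x y l ↔ (D'.map φ).F x y l := by
    intro x y l
    simp only [hD', map, Aff.comp, φ]; push_cast
    constructor <;> intro h <;> convert h using 1 <;> ring
  have eI : ∀ x y : ℝ, (D.map (ψ.comp φ)).I x y ↔ (D'.map φ).I x y := by
    intro x y
    simp only [hD', map, Aff.comp, φ]; push_cast
    constructor <;> intro h <;> convert h using 1 <;> ring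
  have W'' : ∀ x y : ℤ, (D.map (ψ.comp φ)).F x y 0 → 0 ≤ x ∧ x ≤ 2 :=
    fun x y h => main.W x y ((eF _ _ _).1 h)
  exact ⟨W'', fun y => by rw [eI]; exact main.hI y, main.hi, sa_one _ W'' (D.map (ψ.comp φ)).isa⟩

variable {D}

namespace Nm

variable {i : ℤ}

lemma row2 (h : D.Nm i) : ∃ y : ℤ, D.F 2 y 0 := by
  obtain ⟨p, q, h1, h2⟩ := D.push (α := 1) (β := 0) ((h.hI 1).2 ⟨le_rfl, h.hi⟩) (by norm_num)
  have a1 : 1 < p := by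
    have : (1 : ℝ) < p := by linarith
    exact_mod_cast this
  have := h.W _ _ h1
  have : p = 2 := by omega
  subst this
  exact ⟨q, by simpa using h1⟩

lemma row0 (h : D.Nm i) : ∃ y : ℤ, D.F 0 y 0 := by
  obtain ⟨p, q, h1, h2⟩ := D.push (α := -1) (β := 0) ((h.hI 1).2 ⟨le_rfl, h.hi⟩) (by norm_num)
  have a1 : p < 1 := by
    have : (p : ℝ) < 1 := by linarith
    exact_mod_cast this
  have := h.W _ _ h1
  have : p = 0 := by omega
  subst this
  exact ⟨q, by simpa using h1⟩

lemma rowfin (_h : D.Nm i) (x : ℤ) : {y : ℤ | D.F x y 0}.Finite :=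
  D.fin.preimage (f := fun y : ℤ => (x, y)) (by intro a _ b _ hab; simpa using hab)

lemma rng (h : D.Nm i) {s : ℤ} (hs : D.M s) : 0 ≤ s ∧ s ≤ 2 * i + 2 := by
  have I1 := (h.hI 1).2 ⟨le_rfl, h.hi⟩
  have Ii := (h.hI i).2 ⟨h.hi, le_rfl⟩
  constructor
  · by_contra hc
    have hsr : (s : ℝ) < 0 := by exact_mod_cast (by omega : s < 0)
    have : D.I 1 (0 : ℤ) := by
      have hp : (0 : ℝ) < 2 - s := by linarith
      refine D.imix2 I1 hs (s := -s / (2 - s)) (t := 2 / (2 - s))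
        (div_pos (by linarith) hp) (by positivity) ?_ ?_ ?_
      · field_simp; ring
      · field_simp; ring
      · push_cast; field_simp; ring
    have := (h.hI 0).1 this
    omega
  · by_contra hc
    have hsr : (2 * i + 2 : ℝ) < s := by exact_mod_cast (by omega : 2 * i + 2 < s)
    have : D.I 1 (i + 1 : ℤ) := by
      have hp : (0 : ℝ) < s - 2 * i := by linarith
      refine D.imix2 Ii hs (s := (s - 2 * i - 2) / (s - 2 * i)) (t := 2 / (s - 2 * i))
        (div_pos (by linarith) hp) (by positivity) ?_ ?_ ?_
      · field_simp; ring
      · field_simp; ring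
      · push_cast; have hne := hp.ne'; rw [div_mul_eq_mul_div, div_mul_eq_mul_div, ← add_div, eq_div_iff hne]; ring
    have := (h.hI (i + 1)).1 this
    omega

lemma top (h : D.Nm i) : D.M (2 * i + 1) := by
  obtain ⟨y2, hy2⟩ := h.row2
  obtain ⟨b, hb, hmax⟩ := (h.rowfin 2).exists_maximal ⟨y2, by simpa using hy2⟩
  simp only [Set.mem_ofPred_eq] at hb hmax
  have Ii := (h.hI i).2 ⟨h.hi, le_rfl⟩
  have Mi : D.M (2 * i) := D.M_two.2 (D.iF Ii)
  obtain ⟨p, q, h1, h2⟩ := D.push (α := -(b - i : ℝ)) (β := 1) Ii (by norm_num)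
  have hW := h.W _ _ h1
  have h3 : 0 < q - i - (b - i) * (p - 1) := by
    have : (0 : ℝ) < q - i - (b - i) * (p - 1) := by linarith
    exact_mod_cast this
  rcases (by omega : p = 0 ∨ p = 1 ∨ p = 2) with rfl | rfl | rfl
  · have := (D.H_sum (by simpa using h1) (by simpa using hb)).1
    exact (D.H_conc Mi this (by omega) (by linarith)).1
  · have : D.M (2 * q) := D.M_two.2 (by simpa using h1)
    exact (D.H_conc Mi this (by omega) (by linarith)).1
  · have := hmax h1
    omega

lemma refl_F (j : ℤ) (x y l : ℝ) :
    (D.map ⟨1, 0, 0, -1, 0, j, by norm_num⟩).F x y l ↔ D.F x (j - y) l := by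
  simp only [map]; push_cast
  constructor <;> intro h <;> convert h using 1 <;> ring

lemma refl_I (j : ℤ) (x y : ℝ) :
    (D.map ⟨1, 0, 0, -1, 0, j, by norm_num⟩).I x y ↔ D.I x (j - y) := by
  simp only [map]; push_cast
  constructor <;> intro h <;> convert h using 1 <;> ring

lemma refl (h : D.Nm i) : (D.map ⟨1, 0, 0, -1, 0, i + 1, by norm_num⟩).Nm i := by
  have W' : ∀ x y : ℤ, (D.map ⟨1, 0, 0, -1, 0, i + 1, by norm_num⟩).F x y 0 → 0 ≤ x ∧ x ≤ 2 := by
    intro x y hF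
    rw [refl_F] at hF
    exact h.W x (i + 1 - y) (by push_cast at hF ⊢; exact hF)
  refine ⟨W', ?_, h.hi, sa_one _ W' (D.map ⟨1, 0, 0, -1, 0, i + 1, by norm_num⟩).isa⟩
  intro y
  rw [refl_I]
  have := h.hI (i + 1 - y)
  push_cast at this ⊢
  rw [this]; omega

lemma refl_M (s : ℤ) : (D.map ⟨1, 0, 0, -1, 0, i + 1, by norm_num⟩).M s ↔ D.M (2 * i + 2 - s) := by
  unfold M; rw [refl_F]; push_cast
  constructor <;> intro h <;> convert h using 1 <;> ring

lemma refl_H (s : ℤ) : (D.map ⟨1, 0, 0, -1, 0, i + 1, by norm_num⟩).H s = D.H (2 * i + 2 - s) := by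
  have e : ((i + 1 : ℤ) : ℝ) - s / 2 = (2 * i + 2 - s : ℤ) / 2 := by push_cast; ring
  by_cases hM : D.M (2 * i + 2 - s)
  · have hM' := (refl_M s).2 hM
    apply le_antisymm
    · have := (refl_F _ _ _ _).1 (H_F _ hM')
      rw [e] at this
      have := D.le_H this
      linarith
    · have := H_F _ hM
      rw [← e, ← refl_F] at this
      have := le_H _ this
      linarith
  · have hM' : ¬ (D.map ⟨1, 0, 0, -1, 0, i + 1, by norm_num⟩).M s := fun h => hM ((refl_M s).1 h)
    unfold H flen
    unfold M at hM hM'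
    rw [dif_neg hM, dif_neg hM']

lemma bot (h : D.Nm i) : D.M 1 := by
  have := h.refl.top
  rw [refl_M] at this
  convert this using 1; ring

lemma mid (h : D.Nm i) {s : ℤ} (h1 : 1 ≤ s) (h2 : s ≤ 2 * i + 1) : D.M s :=
  (D.H_conc h.bot h.top h1 h2).1

/-- caps on the middle line -/
lemma caps (h : D.Nm i) : ∃ p q : ℤ, (1 ≤ p ∧ p ≤ i) ∧ (1 ≤ q ∧ q ≤ i) ∧
    ∀ y : ℤ, 1 ≤ y → y ≤ i → D.H (2 * y) ≤ 2 + 2 * (if y = p then 1 else 0) +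
      2 * (if y = q then 1 else 0) := by
  have hsa : 1 ≤ D.sa2 ∧ D.sa2 ≤ i := by
    rw [← h.hI]
    have := D.isa
    rw [h.sa] at this
    simpa using this
  have key : ∀ y : ℤ, 1 ≤ y → y ≤ i → D.H (2 * y) ≤ 2 + 2 * (if y = D.sa2 then 1 else 0) +
      2 * (if 1 = D.sb1 ∧ y = D.sb2 then 1 else 0) := by
    intro y h1 h2
    have hI := (h.hI y).2 ⟨h1, h2⟩
    have := D.cap (x := 1) (y := y) (by simpa using hI) (by simpa using D.H_two' (D.iF hI))
    simp only [h.sa, true_and] at this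
    linarith
  by_cases hb : 1 = D.sb1 ∧ 1 ≤ D.sb2 ∧ D.sb2 ≤ i
  · refine ⟨D.sa2, D.sb2, hsa, hb.2, fun y h1 h2 => ?_⟩
    have := key y h1 h2
    simpa [hb.1] using this
  · refine ⟨D.sa2, D.sa2, hsa, hsa, fun y h1 h2 => ?_⟩
    have := key y h1 h2
    have hnb : ¬ (1 = D.sb1 ∧ y = D.sb2) := by
      intro hc; exact hb ⟨hc.1, by omega⟩
    rw [if_neg hnb] at this
    split_ifs at this ⊢ <;> linarith

/-- a long fibre over the middle line -/
lemma exs (h : D.Nm i) {x y : ℤ} (hz : D.F x y 5) : ∃ s, D.M s ∧ 5 ≤ D.H s := by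
  have := h.W _ _ (D.zero hz)
  rcases (by omega : x = 0 ∨ x = 1 ∨ x = 2) with rfl | rfl | rfl
  · obtain ⟨y', hy'⟩ := h.row2
    have := D.H_sum (by simpa using hz) hy'
    exact ⟨_, this.1, by linarith⟩
  · have hz' : D.F 1 y 5 := by simpa using hz
    exact ⟨2 * y, D.M_two.2 (D.zero hz'), by linarith [D.H_two hz']⟩
  · obtain ⟨y', hy'⟩ := h.row0
    have := D.H_sum hy' (by simpa using hz)
    exact ⟨_, this.1, by linarith⟩

lemma cross3 {p q y : ℤ} {a b c : ℝ}
    (ha : a ≤ 2 + 2 * (if y = p then 1 else 0) + 2 * (if y = q then 1 else 0))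
    (hb : b ≤ 2 + 2 * (if y + 1 = p then 1 else 0) + 2 * (if y + 1 = q then 1 else 0))
    (hc : c ≤ 2 + 2 * (if y + 2 = p then 1 else 0) + 2 * (if y + 2 = q then 1 else 0))
    (h1 : 2 < a) (h2 : 2 < b) (h3 : 2 < c) : False := by
  split_ifs at ha hb hc <;> first | omega | linarith

lemma i_le (h : D.Nm i) {s : ℤ} (hs : D.M s) (h5 : 5 ≤ D.H s) (hsi : s ≤ i + 1) : i ≤ 4 := by
  by_contra hi
  push Not at hi
  obtain ⟨p, q, -, -, hcap⟩ := h.caps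
  have n := fun {s : ℤ} (h1 : 1 ≤ s) (h2 : s ≤ 2 * i + 1) => D.H_nonneg (h.mid h1 h2)
  have h0 := (h.rng hs).1
  have conc := fun {r s t : ℤ} hr ht h1 h2 => (D.H_conc (r := r) (s := s) (t := t) hr ht h1 h2).2
  rcases (by omega : s = 0 ∨ s = 1 ∨ (s % 2 = 0 ∧ 2 ≤ s) ∨ (s % 2 = 1 ∧ 3 ≤ s)) with
    hh | hh | hh | hh
  · subst hh
    have m := h.mid (s := 11) (by norm_num) (by omega)
    have nn := D.H_nonneg m
    have a := conc (s := 2) hs m (by norm_num) (by norm_num)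
    have b := conc (s := 4) hs m (by norm_num) (by norm_num)
    have c := conc (s := 6) hs m (by norm_num) (by norm_num)
    push_cast at a b c
    exact cross3 (hcap 1 (by omega) (by omega)) (hcap 2 (by omega) (by omega))
      (hcap 3 (by omega) (by omega)) (by norm_num; linarith) (by norm_num; linarith)
      (by norm_num; linarith)
  · subst hh
    have m := h.mid (s := 11) (by norm_num) (by omega)
    have nn := D.H_nonneg m
    have a := conc (s := 2) hs m (by norm_num) (by norm_num)
    have b := conc (s := 4) hs m (by norm_num) (by norm_num)
    have c := conc (s := 6) hs m (by norm_num) (by norm_num)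
    push_cast at a b c
    exact cross3 (hcap 1 (by omega) (by omega)) (hcap 2 (by omega) (by omega))
      (hcap 3 (by omega) (by omega)) (by norm_num; linarith) (by norm_num; linarith)
      (by norm_num; linarith)
  · obtain ⟨y, rfl⟩ : ∃ y, s = 2 * y := ⟨s / 2, by omega⟩
    have m := h.mid (s := 2 * y + 5) (by omega) (by omega)
    have nn := D.H_nonneg m
    have b := conc (s := 2 * (y + 1)) hs m (by omega) (by omega)
    push_cast at b
    have c1 := hcap y (by omega) (by omega)
    have c2 := hcap (y + 1) (by omega) (by omega)
    have b' : 2 < D.H (2 * (y + 1)) := by linarith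
    split_ifs at c1 c2 <;> first | omega | linarith
  · obtain ⟨y, rfl⟩ : ∃ y, s = 2 * y + 1 := ⟨s / 2, by omega⟩
    have m := h.mid (s := 2 * y + 7) (by omega) (by omega)
    have m' := h.mid (s := 2 * y - 1) (by omega) (by omega)
    have nn := D.H_nonneg m
    have nn' := D.H_nonneg m'
    have a := conc (s := 2 * y) m' hs (by omega) (by omega)
    have b := conc (s := 2 * (y + 1)) hs m (by omega) (by omega)
    have c := conc (s := 2 * (y + 2)) hs m (by omega) (by omega)
    push_cast at a b c
    exact cross3 (hcap y (by omega) (by omega)) (hcap (y + 1) (by omega) (by omega))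
      (hcap (y + 2) (by omega) (by omega)) (by linarith) (by linarith) (by linarith)

end Nm

end Dat

lemma sum_shift (a b c : ℤ) (f : ℤ → ℝ) :
    ∑ y ∈ Finset.Icc a b, f (y + c) = ∑ s ∈ Finset.Icc (a + c) (b + c), f s := by
  rw [← Finset.map_add_right_Icc, Finset.sum_map]; rfl

lemma path_sum {a0 b0 a2 b2 : ℤ} (h0 : a0 ≤ b0) (h2 : a2 ≤ b2) (p q c : ℤ → ℝ)
    (hp : ∀ y y', a0 ≤ y → y ≤ b0 → a2 ≤ y' → y' ≤ b2 → p y ≤ c (y + y'))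
    (hq : ∀ y y', a0 ≤ y → y ≤ b0 → a2 ≤ y' → y' ≤ b2 → q y' ≤ c (y + y'))
    (hpq : ∀ y y', a0 ≤ y → y ≤ b0 → a2 ≤ y' → y' ≤ b2 → p y + q y' ≤ c (y + y') + 1) :
    ∑ y ∈ Finset.Icc a0 b0, p y + ∑ y ∈ Finset.Icc a2 b2, q y ≤
      1 + ∑ s ∈ Finset.Icc (a0 + a2) (b0 + b2), c s := by
  have e1 : Finset.Icc a0 b0 = Insert.insert b0 (Finset.Icc a0 (b0 - 1)) := by
    ext y; simp; omega
  have e2 : Finset.Icc a2 b2 = Insert.insert a2 (Finset.Icc (a2 + 1) b2) := by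
    ext y; simp; omega
  have e3 : Finset.Icc (a0 + a2) (b0 + b2) = Insert.insert (b0 + a2)
      (Finset.Icc (a0 + a2) (b0 - 1 + a2) ∪ Finset.Icc (a2 + 1 + b0) (b2 + b0)) := by
    ext y; simp; omega
  rw [e1, e2, e3, Finset.sum_insert (by simp), Finset.sum_insert (by simp),
    Finset.sum_insert (by simp; omega), Finset.sum_union (by
      rw [Finset.disjoint_left]; intro x; simp; omega), ← sum_shift, ← sum_shift]
  have k1 : ∑ y ∈ Finset.Icc a0 (b0 - 1), p y ≤ ∑ y ∈ Finset.Icc a0 (b0 - 1), c (y + a2) := by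
    apply Finset.sum_le_sum; intro y hy; rw [Finset.mem_Icc] at hy
    exact hp _ _ hy.1 (by omega) le_rfl h2
  have k2 : ∑ y ∈ Finset.Icc (a2 + 1) b2, q y ≤ ∑ y ∈ Finset.Icc (a2 + 1) b2, c (y + b0) := by
    apply Finset.sum_le_sum; intro y hy; rw [Finset.mem_Icc] at hy
    rw [add_comm]
    exact hq _ _ h0 le_rfl (by omega) hy.2
  have := hpq b0 a2 h0 le_rfl le_rfl h2
  linarith

namespace Dat

variable {D : Dat}

lemma n_zero {x y : ℤ} (h : ¬ D.F x y 0) : D.n x y = 0 := by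
  by_contra hc
  exact h (D.zero (D.nF (by omega)))

namespace Nm

variable {i : ℤ}

lemma exrow (h : D.Nm i) {x y : ℤ} (hy : D.F x y 0) : ∃ a b : ℤ, a ≤ b ∧
    ∀ z : ℤ, D.F x z 0 ↔ a ≤ z ∧ z ≤ b := by
  obtain ⟨b, hb, hmax⟩ := (h.rowfin x).exists_maximal ⟨y, hy⟩
  obtain ⟨a, ha, hmin⟩ := (h.rowfin x).exists_minimal ⟨y, hy⟩
  simp only [Set.mem_ofPred_eq] at hb hmax ha hmin
  have m1 := hmin hy
  have m2 := hmax hy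
  refine ⟨a, b, by omega, fun z => ⟨fun hz => ?_, fun hz => ?_⟩⟩
  · have := hmin hz
    have := hmax hz
    omega
  · have := (D.map sw).rowF (A := a) (B := b) (x := z) (y := x) (l := 0) (by rwa [sw_F])
      (by rwa [sw_F]) (by exact_mod_cast hz.1) (by exact_mod_cast hz.2)
    rwa [sw_F] at this

lemma Nrow (h : D.Nm i) : ∃ B : ℤ, (∀ x y : ℤ, D.F x y 0 → -B ≤ y ∧ y ≤ B) ∧
    D.N = ∑ y ∈ Finset.Icc (-B) B, D.n 0 y + ∑ y ∈ Finset.Icc (-B) B, D.n 1 y +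
      ∑ y ∈ Finset.Icc (-B) B, D.n 2 y := by
  obtain ⟨B, hB⟩ : ∃ B : ℤ, ∀ x y : ℤ, D.F x y 0 → -B ≤ y ∧ y ≤ B := by
    refine ⟨∑ w ∈ D.fin.toFinset, |w.2|, fun x y hF => ?_⟩
    have := Finset.single_le_sum (f := fun w : ℤ × ℤ => |w.2|) (s := D.fin.toFinset)
      (fun w _ => abs_nonneg _) (a := (x, y)) (by simpa using hF)
    exact abs_le.1 this
  refine ⟨B, hB, ?_⟩
  have hsub : Function.support (fun w : ℤ × ℤ => D.n w.1 w.2) ⊆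
      ((Finset.Icc (0 : ℤ) 2 ×ˢ Finset.Icc (-B) B : Finset (ℤ × ℤ)) : Set (ℤ × ℤ)) := by
    intro w hw
    have hF : D.F w.1 w.2 0 := by
      by_contra hc; exact hw (n_zero hc)
    have := h.W _ _ hF
    have := hB _ _ hF
    rw [Finset.mem_coe, Finset.mem_product, Finset.mem_Icc, Finset.mem_Icc]
    exact ⟨by omega, by omega⟩
  unfold N
  rw [finsum_eq_sum_of_support_subset _ hsub, Finset.sum_product]
  have : Finset.Icc (0 : ℤ) 2 = {0, 1, 2} := by decide
  rw [this]; simp; ring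

lemma restrict {B a b : ℤ} (x : ℤ) (hB : ∀ x y : ℤ, D.F x y 0 → -B ≤ y ∧ y ≤ B)
    (hab : ∀ y : ℤ, D.F x y 0 → a ≤ y ∧ y ≤ b) :
    ∑ y ∈ Finset.Icc (-B) B, D.n x y = ∑ y ∈ Finset.Icc a b, D.n x y := by
  have k : ∀ y, D.n x y ≠ 0 → D.F x y 0 := by
    intro y hy; by_contra hc; exact hy (n_zero hc)
  rw [← Finset.sum_filter_ne_zero, ← Finset.sum_filter_ne_zero (s := Finset.Icc a b)]
  congr 1
  ext y
  simp only [Finset.mem_filter, Finset.mem_Icc]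
  constructor
  · rintro ⟨-, hy⟩; exact ⟨hab y (k y hy), hy⟩
  · rintro ⟨-, hy⟩; exact ⟨hB _ y (k y hy), hy⟩

/-- rows -/
structure Rows (D : Dat) (i a0 b0 a2 b2 : ℤ) : Prop where
  h0 : a0 ≤ b0
  h2 : a2 ≤ b2
  r0 : ∀ z : ℤ, D.F 0 z 0 ↔ a0 ≤ z ∧ z ≤ b0
  r2 : ∀ z : ℤ, D.F 2 z 0 ↔ a2 ≤ z ∧ z ≤ b2
  N : D.N = ∑ y ∈ Finset.Icc a0 b0, D.n 0 y + ∑ y ∈ Finset.Icc 0 (i + 1), D.n 1 y +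
      ∑ y ∈ Finset.Icc a2 b2, D.n 2 y

lemma exRows (h : D.Nm i) : ∃ a0 b0 a2 b2, Rows D i a0 b0 a2 b2 := by
  obtain ⟨y0, hy0⟩ := h.row0
  obtain ⟨y2, hy2⟩ := h.row2
  obtain ⟨a0, b0, h0, r0⟩ := h.exrow (x := 0) (by simpa using hy0)
  obtain ⟨a2, b2, h2, r2⟩ := h.exrow (x := 2) (by simpa using hy2)
  obtain ⟨B, hB, hN⟩ := h.Nrow
  refine ⟨a0, b0, a2, b2, h0, h2, by simpa using r0, by simpa using r2, ?_⟩
  rw [hN, restrict 0 hB (fun y => (r0 y).1), restrict 2 hB (fun y => (r2 y).1),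
    restrict (a := 0) (b := i + 1) 1 hB]
  intro y hy
  have := h.rng (D.M_two.2 (by simpa using hy))
  omega

lemma Rows.pair {a0 b0 a2 b2 : ℤ} (R : Rows D i a0 b0 a2 b2) {y y' : ℤ} (h1 : a0 ≤ y)
    (h2 : y ≤ b0) (h3 : a2 ≤ y') (h4 : y' ≤ b2) : D.M (y + y') ∧
    (D.n 0 y : ℝ) ≤ D.H (y + y') + 1 ∧ (D.n 2 y' : ℝ) ≤ D.H (y + y') + 1 ∧
    (D.n 0 y : ℝ) + D.n 2 y' ≤ D.H (y + y') + 2 := by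
  obtain ⟨l, hl, hn⟩ := D.nb (x := 0) (by simpa using (R.r0 y).2 ⟨h1, h2⟩)
  obtain ⟨l', hl', hn'⟩ := D.nb (x := 2) (by simpa using (R.r2 y').2 ⟨h3, h4⟩)
  have n1 := D.nonneg hl
  have n2 := D.nonneg hl'
  have := D.H_sum (by simpa using hl) (by simpa using hl')
  exact ⟨this.1, by linarith, by linarith, by linarith⟩

lemma n1_le {y : ℤ} (hy : D.F 1 y 0) : (D.n 1 y : ℝ) ≤ D.H (2 * y) / 2 + 1 := by
  obtain ⟨l, hl, hn⟩ := D.nb (x := 1) (by simpa using hy)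
  have := D.H_two (y := y) (by simpa using hl)
  linarith

open Classical in
/-- contribution of a half-lattice point of the middle line -/
def c (D : Dat) (s : ℤ) : ℝ := if D.M s then D.H s + 1 else 0

open Classical in
/-- contribution of a lattice point of the middle line -/
def e (D : Dat) (y : ℤ) : ℝ := if D.M (2 * y) then D.H (2 * y) / 2 + 1 else 0

lemma Nle (h : D.Nm i) : (D.N : ℝ) ≤ 1 + ∑ s ∈ Finset.Icc 0 (2 * i + 2), c D s +
    ∑ y ∈ Finset.Icc 0 (i + 1), e D y := by
  obtain ⟨a0, b0, a2, b2, R⟩ := h.exRows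
  have hN := R.N
  have k1 : (∑ y ∈ Finset.Icc 0 (i + 1), (D.n 1 y : ℝ)) ≤ ∑ y ∈ Finset.Icc 0 (i + 1), e D y := by
    apply Finset.sum_le_sum
    intro y _
    unfold e
    split_ifs with hM
    · exact n1_le (D.M_two.1 hM)
    · have : D.n 1 y = 0 := n_zero (by
        intro hc; exact hM (D.M_two.2 (by simpa using hc)))
      rw [this]; simp
  have cM : ∀ s, D.M s → c D s = D.H s + 1 := fun s hs => by unfold c; rw [if_pos hs]
  have k2 := path_sum R.h0 R.h2 (fun y => (D.n 0 y : ℝ)) (fun y => (D.n 2 y : ℝ)) (c D)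
    (by
      intro y y' h1 h2 h3 h4
      have := R.pair h1 h2 h3 h4
      rw [cM _ this.1]; exact this.2.1)
    (by
      intro y y' h1 h2 h3 h4
      have := R.pair h1 h2 h3 h4
      rw [cM _ this.1]; exact this.2.2.1)
    (by
      intro y y' h1 h2 h3 h4
      have := R.pair h1 h2 h3 h4
      rw [cM _ this.1]; linarith [this.2.2.2])
  have k3 : ∑ s ∈ Finset.Icc (a0 + a2) (b0 + b2), c D s ≤ ∑ s ∈ Finset.Icc 0 (2 * i + 2), c D s := by
    have m1 := h.rng (R.pair le_rfl R.h0 le_rfl R.h2).1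
    have m2 := h.rng (R.pair R.h0 le_rfl R.h2 le_rfl).1
    apply Finset.sum_le_sum_of_subset_of_nonneg
    · apply Finset.Icc_subset_Icc <;> omega
    · intro s _ _
      unfold c
      split_ifs with hs
      · linarith [D.H_nonneg hs]
      · exact le_rfl
  rw [hN]
  push_cast
  linarith

end Nm

end Dat

namespace Dat

variable {D : Dat}

namespace Nm

lemma conc1 {a b c : ℤ} (h1 : D.M a) (h2 : D.M c) (hab : a = b - 1) (hbc : c = b + 1) :
    D.H a + D.H c ≤ 2 * D.H b := by
  subst hab hbc
  have := (D.H_conc (s := b) h1 h2 (by omega) (by omega)).2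
  push_cast at this
  linarith

lemma caps' {i : ℤ} (h : D.Nm i) : ∃ p q : ℤ, p ≤ q ∧ (1 ≤ p ∧ p ≤ i) ∧ (1 ≤ q ∧ q ≤ i) ∧
    ∀ y : ℤ, 1 ≤ y → y ≤ i → D.H (2 * y) ≤ 2 + 2 * (if y = p then 1 else 0) +
      2 * (if y = q then 1 else 0) := by
  obtain ⟨p, q, hp, hq, hc⟩ := h.caps
  rcases le_total p q with h | h
  · exact ⟨p, q, h, hp, hq, hc⟩
  · exact ⟨q, p, h, hq, hp, fun y h1 h2 => by linarith [hc y h1 h2]⟩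

set_option maxHeartbeats 4000000 in
lemma num2 (h : D.Nm 2) {s : ℤ} (hs : D.M s) (h5 : 5 ≤ D.H s)
    (hsi : s ≤ 2 + 1) : (D.N : ℝ) < 55 := by
  have hN := h.Nle
  obtain ⟨p, q, hpq, ⟨hp1, hp2⟩, ⟨hq1, hq2⟩, hcap⟩ := h.caps'
  have hr := h.rng hs
  have c1 := hcap 1 (by norm_num) (by norm_num)
  have c2 := hcap 2 (by norm_num) (by norm_num)
  have M1 : D.M 1 := h.mid (by norm_num) (by norm_num)
  have M2 : D.M 2 := h.mid (by norm_num) (by norm_num)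
  have M3 : D.M 3 := h.mid (by norm_num) (by norm_num)
  have M4 : D.M 4 := h.mid (by norm_num) (by norm_num)
  have M5 : D.M 5 := h.mid (by norm_num) (by norm_num)
  have t2 := conc1 (b := 2) M1 M3 (by norm_num) (by norm_num)
  have t3 := conc1 (b := 3) M2 M4 (by norm_num) (by norm_num)
  have t4 := conc1 (b := 4) M3 M5 (by norm_num) (by norm_num)
  have n1 := D.H_nonneg M1
  have n5 := D.H_nonneg M5
  have E1 : Finset.Icc (0 : ℤ) (2 * 2 + 2) = {0, 1, 2, 3, 4, 5, 6} := by decide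
  have E2 : Finset.Icc (0 : ℤ) (2 + 1) = {0, 1, 2, 3} := by decide
  rw [E1, E2] at hN
  clear hcap E1 E2
  have L : (c D 0 = 0 ∧ e D 0 = 0 ∧ ¬ D.M 0) ∨ (0 ≤ D.H 0 ∧ D.H 0 + D.H 2 ≤ 2 * D.H 1 ∧
      c D 0 = D.H 0 + 1 ∧ e D 0 = D.H 0 / 2 + 1) := by
    by_cases hM : D.M 0
    · right
      exact ⟨D.H_nonneg hM, conc1 hM M2 (by norm_num) (by norm_num), by simp [c, hM],
        by simp [e, hM]⟩
    · left; simp [c, e, hM]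
  have U : (c D 6 = 0 ∧ e D 3 = 0 ∧ ¬ D.M 6) ∨ (0 ≤ D.H 6 ∧
      D.H 4 + D.H 6 ≤ 2 * D.H 5 ∧
      c D 6 = D.H 6 + 1 ∧ e D 3 = D.H 6 / 2 + 1) := by
    by_cases hM : D.M 6
    · right
      exact ⟨D.H_nonneg hM, conc1 M4 hM (by norm_num) (by norm_num), by simp [c, hM],
        by simp [e, hM]⟩
    · left; simp [c, e, hM]
  have k1 : c D 1 = D.H 1 + 1 := by simp [c, M1]
  have k2 : c D 2 = D.H 2 + 1 := by simp [c, M2]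
  have k3 : c D 3 = D.H 3 + 1 := by simp [c, M3]
  have k4 : c D 4 = D.H 4 + 1 := by simp [c, M4]
  have k5 : c D 5 = D.H 5 + 1 := by simp [c, M5]
  have l1 : e D 1 = D.H 2 / 2 + 1 := by simp [e, M2]
  have l2 : e D 2 = D.H 4 / 2 + 1 := by simp [e, M4]
  simp [k1, k2, k3, k4, k5, l1, l2] at hN
  norm_num at c1 c2
  clear k1 k2 k3 k4 k5 l1 l2 h
  obtain ⟨hr1, hr2⟩ := hr
  clear hr2
  norm_num at hsi
  have hs0 : s = 0 → 0 ≤ D.H 0 ∧ D.H 0 + D.H 2 ≤ 2 * D.H 1 := by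
    intro h0; subst h0
    rcases L with ⟨-, -, L3⟩ | ⟨L1, L2, -, -⟩
    · exact absurd hs L3
    · exact ⟨L1, L2⟩
  have hsM : s = 0 → ¬ D.M 0 → False := fun h0 hM => hM (h0 ▸ hs)
  clear hs
  interval_cases s <;> first | (have q1 := hs0 rfl; have q2 := hsM rfl; simp only [q2, and_false, false_or] at L; obtain ⟨q3, q4⟩ := q1) | skip
  all_goals
    clear hs0 hsM
    interval_cases p <;> interval_cases q <;> (try omega) <;>
      norm_num at c1 c2 <;>
      first
      | (exfalso; linarith)
      | (rcases U with ⟨U1, U2, -⟩ | ⟨U1, U2, U3, U4⟩ <;>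
          first
          | (obtain ⟨L1, L2, L3, L4⟩ := L; linarith)
          | (rcases L with ⟨L1, L2, -⟩ | ⟨L1, L2, L3, L4⟩ <;> linarith))

set_option maxHeartbeats 4000000 in
lemma num3 (h : D.Nm 3) {s : ℤ} (hs : D.M s) (h5 : 5 ≤ D.H s)
    (hsi : s ≤ 3 + 1) : (D.N : ℝ) < 55 := by
  have hN := h.Nle
  obtain ⟨p, q, hpq, ⟨hp1, hp2⟩, ⟨hq1, hq2⟩, hcap⟩ := h.caps'
  have hr := h.rng hs
  have c1 := hcap 1 (by norm_num) (by norm_num)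
  have c2 := hcap 2 (by norm_num) (by norm_num)
  have c3 := hcap 3 (by norm_num) (by norm_num)
  have M1 : D.M 1 := h.mid (by norm_num) (by norm_num)
  have M2 : D.M 2 := h.mid (by norm_num) (by norm_num)
  have M3 : D.M 3 := h.mid (by norm_num) (by norm_num)
  have M4 : D.M 4 := h.mid (by norm_num) (by norm_num)
  have M5 : D.M 5 := h.mid (by norm_num) (by norm_num)
  have M6 : D.M 6 := h.mid (by norm_num) (by norm_num)
  have M7 : D.M 7 := h.mid (by norm_num) (by norm_num)
  have t2 := conc1 (b := 2) M1 M3 (by norm_num) (by norm_num)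
  have t3 := conc1 (b := 3) M2 M4 (by norm_num) (by norm_num)
  have t4 := conc1 (b := 4) M3 M5 (by norm_num) (by norm_num)
  have t5 := conc1 (b := 5) M4 M6 (by norm_num) (by norm_num)
  have t6 := conc1 (b := 6) M5 M7 (by norm_num) (by norm_num)
  have n1 := D.H_nonneg M1
  have n7 := D.H_nonneg M7
  have E1 : Finset.Icc (0 : ℤ) (2 * 3 + 2) = {0, 1, 2, 3, 4, 5, 6, 7, 8} := by decide
  have E2 : Finset.Icc (0 : ℤ) (3 + 1) = {0, 1, 2, 3, 4} := by decide
  rw [E1, E2] at hN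
  clear hcap E1 E2
  have L : (c D 0 = 0 ∧ e D 0 = 0 ∧ ¬ D.M 0) ∨ (0 ≤ D.H 0 ∧ D.H 0 + D.H 2 ≤ 2 * D.H 1 ∧
      c D 0 = D.H 0 + 1 ∧ e D 0 = D.H 0 / 2 + 1) := by
    by_cases hM : D.M 0
    · right
      exact ⟨D.H_nonneg hM, conc1 hM M2 (by norm_num) (by norm_num), by simp [c, hM],
        by simp [e, hM]⟩
    · left; simp [c, e, hM]
  have U : (c D 8 = 0 ∧ e D 4 = 0 ∧ ¬ D.M 8) ∨ (0 ≤ D.H 8 ∧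
      D.H 6 + D.H 8 ≤ 2 * D.H 7 ∧
      c D 8 = D.H 8 + 1 ∧ e D 4 = D.H 8 / 2 + 1) := by
    by_cases hM : D.M 8
    · right
      exact ⟨D.H_nonneg hM, conc1 M6 hM (by norm_num) (by norm_num), by simp [c, hM],
        by simp [e, hM]⟩
    · left; simp [c, e, hM]
  have k1 : c D 1 = D.H 1 + 1 := by simp [c, M1]
  have k2 : c D 2 = D.H 2 + 1 := by simp [c, M2]
  have k3 : c D 3 = D.H 3 + 1 := by simp [c, M3]
  have k4 : c D 4 = D.H 4 + 1 := by simp [c, M4]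
  have k5 : c D 5 = D.H 5 + 1 := by simp [c, M5]
  have k6 : c D 6 = D.H 6 + 1 := by simp [c, M6]
  have k7 : c D 7 = D.H 7 + 1 := by simp [c, M7]
  have l1 : e D 1 = D.H 2 / 2 + 1 := by simp [e, M2]
  have l2 : e D 2 = D.H 4 / 2 + 1 := by simp [e, M4]
  have l3 : e D 3 = D.H 6 / 2 + 1 := by simp [e, M6]
  simp [k1, k2, k3, k4, k5, k6, k7, l1, l2, l3] at hN
  norm_num at c1 c2 c3
  clear k1 k2 k3 k4 k5 k6 k7 l1 l2 l3 h
  obtain ⟨hr1, hr2⟩ := hr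
  clear hr2
  norm_num at hsi
  have hs0 : s = 0 → 0 ≤ D.H 0 ∧ D.H 0 + D.H 2 ≤ 2 * D.H 1 := by
    intro h0; subst h0
    rcases L with ⟨-, -, L3⟩ | ⟨L1, L2, -, -⟩
    · exact absurd hs L3
    · exact ⟨L1, L2⟩
  have hsM : s = 0 → ¬ D.M 0 → False := fun h0 hM => hM (h0 ▸ hs)
  clear hs
  interval_cases s <;> first | (have q1 := hs0 rfl; have q2 := hsM rfl; simp only [q2, and_false, false_or] at L; obtain ⟨q3, q4⟩ := q1) | skip
  all_goals
    clear hs0 hsM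
    interval_cases p <;> interval_cases q <;> (try omega) <;>
      norm_num at c1 c2 c3 <;>
      first
      | (exfalso; linarith)
      | (rcases U with ⟨U1, U2, -⟩ | ⟨U1, U2, U3, U4⟩ <;>
          first
          | (obtain ⟨L1, L2, L3, L4⟩ := L; linarith)
          | (rcases L with ⟨L1, L2, -⟩ | ⟨L1, L2, L3, L4⟩ <;> linarith))

set_option maxHeartbeats 4000000 in
lemma num4 (h : D.Nm 4) {s : ℤ} (hs : D.M s) (h5 : 5 ≤ D.H s)
    (hsi : s ≤ 4 + 1) : (D.N : ℝ) < 55 := by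
  have hN := h.Nle
  obtain ⟨p, q, hpq, ⟨hp1, hp2⟩, ⟨hq1, hq2⟩, hcap⟩ := h.caps'
  have hr := h.rng hs
  have c1 := hcap 1 (by norm_num) (by norm_num)
  have c2 := hcap 2 (by norm_num) (by norm_num)
  have c3 := hcap 3 (by norm_num) (by norm_num)
  have c4 := hcap 4 (by norm_num) (by norm_num)
  have M1 : D.M 1 := h.mid (by norm_num) (by norm_num)
  have M2 : D.M 2 := h.mid (by norm_num) (by norm_num)
  have M3 : D.M 3 := h.mid (by norm_num) (by norm_num)
  have M4 : D.M 4 := h.mid (by norm_num) (by norm_num)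
  have M5 : D.M 5 := h.mid (by norm_num) (by norm_num)
  have M6 : D.M 6 := h.mid (by norm_num) (by norm_num)
  have M7 : D.M 7 := h.mid (by norm_num) (by norm_num)
  have M8 : D.M 8 := h.mid (by norm_num) (by norm_num)
  have M9 : D.M 9 := h.mid (by norm_num) (by norm_num)
  have t2 := conc1 (b := 2) M1 M3 (by norm_num) (by norm_num)
  have t3 := conc1 (b := 3) M2 M4 (by norm_num) (by norm_num)
  have t4 := conc1 (b := 4) M3 M5 (by norm_num) (by norm_num)
  have t5 := conc1 (b := 5) M4 M6 (by norm_num) (by norm_num)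
  have t6 := conc1 (b := 6) M5 M7 (by norm_num) (by norm_num)
  have t7 := conc1 (b := 7) M6 M8 (by norm_num) (by norm_num)
  have t8 := conc1 (b := 8) M7 M9 (by norm_num) (by norm_num)
  have n1 := D.H_nonneg M1
  have n9 := D.H_nonneg M9
  have E1 : Finset.Icc (0 : ℤ) (2 * 4 + 2) = {0, 1, 2, 3, 4, 5, 6, 7, 8, 9, 10} := by decide
  have E2 : Finset.Icc (0 : ℤ) (4 + 1) = {0, 1, 2, 3, 4, 5} := by decide
  rw [E1, E2] at hN
  clear hcap E1 E2
  have L : (c D 0 = 0 ∧ e D 0 = 0 ∧ ¬ D.M 0) ∨ (0 ≤ D.H 0 ∧ D.H 0 + D.H 2 ≤ 2 * D.H 1 ∧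
      c D 0 = D.H 0 + 1 ∧ e D 0 = D.H 0 / 2 + 1) := by
    by_cases hM : D.M 0
    · right
      exact ⟨D.H_nonneg hM, conc1 hM M2 (by norm_num) (by norm_num), by simp [c, hM],
        by simp [e, hM]⟩
    · left; simp [c, e, hM]
  have U : (c D 10 = 0 ∧ e D 5 = 0 ∧ ¬ D.M 10) ∨ (0 ≤ D.H 10 ∧
      D.H 8 + D.H 10 ≤ 2 * D.H 9 ∧
      c D 10 = D.H 10 + 1 ∧ e D 5 = D.H 10 / 2 + 1) := by
    by_cases hM : D.M 10
    · right
      exact ⟨D.H_nonneg hM, conc1 M8 hM (by norm_num) (by norm_num), by simp [c, hM],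
        by simp [e, hM]⟩
    · left; simp [c, e, hM]
  have k1 : c D 1 = D.H 1 + 1 := by simp [c, M1]
  have k2 : c D 2 = D.H 2 + 1 := by simp [c, M2]
  have k3 : c D 3 = D.H 3 + 1 := by simp [c, M3]
  have k4 : c D 4 = D.H 4 + 1 := by simp [c, M4]
  have k5 : c D 5 = D.H 5 + 1 := by simp [c, M5]
  have k6 : c D 6 = D.H 6 + 1 := by simp [c, M6]
  have k7 : c D 7 = D.H 7 + 1 := by simp [c, M7]
  have k8 : c D 8 = D.H 8 + 1 := by simp [c, M8]
  have k9 : c D 9 = D.H 9 + 1 := by simp [c, M9]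
  have l1 : e D 1 = D.H 2 / 2 + 1 := by simp [e, M2]
  have l2 : e D 2 = D.H 4 / 2 + 1 := by simp [e, M4]
  have l3 : e D 3 = D.H 6 / 2 + 1 := by simp [e, M6]
  have l4 : e D 4 = D.H 8 / 2 + 1 := by simp [e, M8]
  simp [k1, k2, k3, k4, k5, k6, k7, k8, k9, l1, l2, l3, l4] at hN
  norm_num at c1 c2 c3 c4
  clear k1 k2 k3 k4 k5 k6 k7 k8 k9 l1 l2 l3 l4 h
  obtain ⟨hr1, hr2⟩ := hr
  clear hr2
  norm_num at hsi
  have hs0 : s = 0 → 0 ≤ D.H 0 ∧ D.H 0 + D.H 2 ≤ 2 * D.H 1 := by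
    intro h0; subst h0
    rcases L with ⟨-, -, L3⟩ | ⟨L1, L2, -, -⟩
    · exact absurd hs L3
    · exact ⟨L1, L2⟩
  have hsM : s = 0 → ¬ D.M 0 → False := fun h0 hM => hM (h0 ▸ hs)
  clear hs
  interval_cases s <;> first | (have q1 := hs0 rfl; have q2 := hsM rfl; simp only [q2, and_false, false_or] at L; obtain ⟨q3, q4⟩ := q1) | skip
  all_goals
    clear hs0 hsM
    interval_cases p <;> interval_cases q <;> (try omega) <;>
      norm_num at c1 c2 c3 c4 <;>
      first
      | (exfalso; linarith)
      | (rcases U with ⟨U1, U2, -⟩ | ⟨U1, U2, U3, U4⟩ <;>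
          first
          | (obtain ⟨L1, L2, L3, L4⟩ := L; linarith)
          | (rcases L with ⟨L1, L2, -⟩ | ⟨L1, L2, L3, L4⟩ <;> linarith))

end Nm

end Dat

namespace Dat

/-- the extremal configuration -/
def Table (D : Dat) : Prop := ∃ ψ : Aff, 19 ≤ (D.map ψ).n 0 0 ∧ 13 ≤ (D.map ψ).n 0 1 ∧
  1 ≤ (D.map ψ).n 0 3 ∧ 10 ≤ (D.map ψ).n 1 0 ∧ 1 ≤ (D.map ψ).n 2 0 ∧
  (∀ l, (D.map ψ).F (0 : ℤ) (1 : ℤ) l → l ≤ 12) ∧ (∀ l, (D.map ψ).F (1 : ℤ) (0 : ℤ) l → l ≤ 9)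

variable {D : Dat}

lemma Table_map (φ : Aff) (h : (D.map φ).Table) : D.Table := by
  obtain ⟨ψ, h⟩ := h
  refine ⟨φ.comp ψ, ?_⟩
  simp only [map_n, map_F, Aff.comp_X, Aff.comp_Y] at h ⊢
  exact h

namespace Nm

lemma sum_Icc0 (a : ℤ) (f : ℤ → ℕ) : ∑ y ∈ Finset.Icc a (a + 0), f y = f a := by simp

lemma sum_IccS (a k : ℤ) (hk : -1 ≤ k) (f : ℤ → ℕ) : ∑ y ∈ Finset.Icc a (a + (k + 1)), f y =
    (∑ y ∈ Finset.Icc a (a + k), f y) + f (a + (k + 1)) := by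
  have : Finset.Icc a (a + (k + 1)) = Insert.insert (a + (k + 1)) (Finset.Icc a (a + k)) := by
    ext y; simp; omega
  rw [this, Finset.sum_insert (by simp), add_comm]

lemma sum_Icc1 (a : ℤ) (f : ℤ → ℕ) : ∑ y ∈ Finset.Icc a (a + 1), f y = f a + f (a + 1) := by
  have := sum_IccS a 0 (by norm_num) f
  rw [sum_Icc0] at this
  simpa using this

lemma sum_Icc2 (a : ℤ) (f : ℤ → ℕ) :
    ∑ y ∈ Finset.Icc a (a + 2), f y = f a + f (a + 1) + f (a + 2) := by
  have := sum_IccS a 1 (by norm_num) f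
  rw [sum_Icc1] at this
  simpa using this

lemma sum_Icc3 (a : ℤ) (f : ℤ → ℕ) :
    ∑ y ∈ Finset.Icc a (a + 3), f y = f a + f (a + 1) + f (a + 2) + f (a + 3) := by
  have := sum_IccS a 2 (by norm_num) f
  rw [sum_Icc2] at this
  simpa using this

lemma one (h : D.Nm 1) (M0 : D.M 0) (M4 : ¬ D.M 4) : D.N ≤ 54 ∨ (D.N = 55 ∧ D.Table) := by
  by_contra hcon
  push Not at hcon
  obtain ⟨hN, hT⟩ := hcon
  have hNle := h.Nle
  have M1 : D.M 1 := h.mid (by norm_num) (by norm_num)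
  have M2 : D.M 2 := h.mid (by norm_num) (by norm_num)
  have M3 : D.M 3 := h.mid (by norm_num) (by norm_num)
  obtain ⟨p, q, -, -, hcap⟩ := h.caps
  have c2 := hcap 1 (by norm_num) (by norm_num)
  norm_num at c2
  have c2' : D.H 2 ≤ 6 := by split_ifs at c2 <;> linarith
  have t1 := (D.H_conc (s := 2) M0 M3 (by norm_num) (by norm_num)).2
  have t2 := (D.H_conc (s := 2) M1 M3 (by norm_num) (by norm_num)).2
  have n3 := D.H_nonneg M3
  norm_num at t1 t2
  have E1 : Finset.Icc (0 : ℤ) (2 * 1 + 2) = {0, 1, 2, 3, 4} := by decide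
  have E2 : Finset.Icc (0 : ℤ) (1 + 1) = {0, 1, 2} := by decide
  rw [E1, E2] at hNle
  simp [c, e, M0, M1, M2, M3, M4] at hNle
  have hNr : (55 : ℝ) ≤ D.N := by exact_mod_cast hN
  have H3 : D.H 3 = 0 := by linarith
  have H2 : D.H 2 = 6 := by linarith
  have H1 : D.H 1 = 12 := by linarith
  have H0 : D.H 0 = 18 := by linarith
  have N55 : D.N = 55 := by
    have : (D.N : ℝ) ≤ 55 := by linarith
    have : D.N ≤ 55 := by exact_mod_cast this
    omega
  apply hT N55
  obtain ⟨a0, b0, a2, b2, R⟩ := h.exRows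
  have m1 := h.rng (R.pair le_rfl R.h0 le_rfl R.h2).1
  have m2M := (R.pair R.h0 le_rfl R.h2 le_rfl).1
  have m2 := h.rng m2M
  have m2' : b0 + b2 ≠ 4 := by intro hc; rw [hc] at m2M; exact M4 m2M
  have hR0 := R.h0
  have hR2 := R.h2
  have n10 : (D.n 1 0 : ℝ) ≤ 10 := by
    have := n1_le (y := 0) (D := D) (D.M_two.1 (by simpa using M0))
    simp [H0] at this; linarith
  have n11 : (D.n 1 1 : ℝ) ≤ 4 := by
    have := n1_le (y := 1) (D := D) (D.M_two.1 (by simpa using M2))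
    simp [H2] at this; linarith
  have n12 : D.n 1 2 = 0 := n_zero (by
    intro hc; exact M4 (by
      have := (D.M_two (y := 2)).2 (by simpa using hc)
      simpa using this))
  have HN := R.N
  have E3 : ∑ y ∈ Finset.Icc (0 : ℤ) (1 + 1), D.n 1 y = D.n 1 0 + D.n 1 1 := by
    rw [E2]; simp [n12]
  rw [E3, N55] at HN
  have pr := fun (j k : ℤ) (h1 : 0 ≤ j) (h2 : a0 + j ≤ b0) (h3 : 0 ≤ k) (h4 : a2 + k ≤ b2) =>
    (R.pair (y := a0 + j) (y' := a2 + k) (by omega) h2 (by omega) h4).2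
  have F0 := R.r0
  have F2 := R.r2
  clear R hcap hNle hNr
  obtain ⟨w, rfl⟩ : ∃ w, a2 = -a0 + w := ⟨a0 + a2, by ring⟩
  obtain ⟨u, rfl⟩ : ∃ u, b0 = a0 + u := ⟨b0 - a0, by ring⟩
  obtain ⟨v, rfl⟩ : ∃ v, b2 = -a0 + w + v := ⟨b2 - (-a0 + w), by ring⟩
  have e1 : ∀ j k : ℤ, a0 + j + (-a0 + w + k) = w + j + k := fun j k => by ring
  simp only [e1] at pr
  have hw : 0 ≤ w := by omega
  have hu : 0 ≤ u := by omega
  have hv : 0 ≤ v := by omega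
  have hs : w + u + v ≤ 3 := by omega
  have hw3 : w ≤ 3 := by omega
  have hu3 : u ≤ 3 := by omega
  have hv3 : v ≤ 3 := by omega
  have key : (u = 3 ∧ v = 0 ∧ w = 0) ∨ (u = 0 ∧ v = 3 ∧ w = 0) := by
    have A : ∀ j, 0 ≤ j → j ≤ u → (D.n 0 (a0 + j) : ℝ) ≤ D.H (w + j + 0) + 1 :=
      fun j h1 h2 => (pr j 0 h1 (by omega) le_rfl (by omega)).1
    have B : ∀ k, 0 ≤ k → k ≤ v → (D.n 2 (-a0 + w + k) : ℝ) ≤ D.H (w + u + k) + 1 :=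
      fun k h1 h2 => (pr u k (by omega) (by omega) h1 (by omega)).2.1
    have C := (pr u 0 (by omega) (by omega) le_rfl (by omega)).2.2
    have C0 := (pr 0 0 (by omega) (by omega) le_rfl (by omega)).2.2
    have C1 : 1 ≤ u → 1 ≤ v → _ := fun h1 h2 =>
      (pr 1 1 (by omega) (by omega) (by omega) (by omega)).2.2
    have HNr : (55 : ℝ) = ((∑ y ∈ Finset.Icc a0 (a0 + u), D.n 0 y) + (D.n 1 0 + D.n 1 1) +
      ∑ y ∈ Finset.Icc (-a0 + w) (-a0 + w + v), D.n 2 y : ℕ) := by exact_mod_cast HN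
    clear pr F0 F2 HN m1 m2 m2' m2M hR0 hR2 hT
    have x0 := A 0 le_rfl hu
    have x1 := A 1 (by norm_num)
    have x2 := A 2 (by norm_num)
    have x3 := A 3 (by norm_num)
    have z0 := B 0 le_rfl hv
    have z1 := B 1 (by norm_num)
    have z2 := B 2 (by norm_num)
    have z3 := B 3 (by norm_num)
    clear A B
    rw [add_zero] at C0 z0
    clear hN N55 M0 M1 M2 M3 M4 c2 t1 t2 c2' n3 n12 E3 E1 E2 e1
    interval_cases u <;> interval_cases v <;> (try omega) <;> interval_cases w <;> (try omega) <;>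
    first
    | (left; exact ⟨rfl, rfl, rfl⟩)
    | (right; exact ⟨rfl, rfl, rfl⟩)
    | (exfalso
       simp only [sum_Icc0, sum_Icc1, sum_Icc2, sum_Icc3] at HNr
       push_cast at HNr
       norm_num [H0, H1, H2, H3] at x0 x1 x2 x3 z0 z1 z2 z3 C C0 C1 HNr
       norm_cast at x0 x1 x2 x3 z0 z1 z2 z3 C C0 C1 HNr n10 n11
       omega)
  rcases key with ⟨rfl, rfl, rfl⟩ | ⟨rfl, rfl, rfl⟩
  · have HNr : (55 : ℝ) = ((∑ y ∈ Finset.Icc a0 (a0 + 3), D.n 0 y) + (D.n 1 0 + D.n 1 1) +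
      ∑ y ∈ Finset.Icc (-a0 + 0) (-a0 + 0 + 0), D.n 2 y : ℕ) := by exact_mod_cast HN
    rw [sum_Icc0, sum_Icc3] at HNr
    have x0 := (pr 0 0 (by omega) (by omega) (by omega) (by omega))
    have x1 := (pr 1 0 (by omega) (by omega) (by omega) (by omega))
    have x2 := (pr 2 0 (by omega) (by omega) (by omega) (by omega))
    have x3 := (pr 3 0 (by omega) (by omega) (by omega) (by omega))
    push_cast at HNr
    norm_num [H0, H1, H2, H3] at x0 x1 x2 x3 HNr
    norm_cast at x0 x1 x2 x3 HNr n10 n11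
    obtain ⟨x01, x02, x03⟩ := x0
    obtain ⟨x11, x12, x13⟩ := x1
    obtain ⟨x21, x22, x23⟩ := x2
    obtain ⟨x31, x32, x33⟩ := x3
    refine ⟨⟨1, 0, -a0, 1, 0, a0, by norm_num⟩, ?_⟩
    simp only [map_n, map_F, Aff.X, Aff.Y]
    norm_num
    have hF2 : D.F 2 (-a0 : ℤ) 0 := (F2 (-a0)).2 (by omega)
    refine ⟨?_, ?_, ?_, ?_, ?_, ?_, ?_⟩
    · have : 19 ≤ D.n 0 a0 := by omega
      exact this
    · have : 13 ≤ D.n 0 (a0 + 1) := by omega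
      rw [add_comm]
      exact this
    · have : 1 ≤ D.n 0 (a0 + 3) := by omega
      rw [add_comm]
      exact this
    · have : 10 ≤ D.n 1 0 := by omega
      exact this
    · have : 1 ≤ D.n 2 (-a0) := by omega
      have e : -(a0 * 2) + a0 = -a0 := by ring
      rw [e]
      exact this
    · intro l hl
      have := (D.H_sum (y := a0 + 1) (y' := -a0) (by push_cast; rwa [add_comm]) hF2).2
      have e : a0 + 1 + -a0 = 1 := by ring
      rw [e, H1] at this
      linarith
    · intro l hl
      have := D.H_two (y := 0) (by simpa using hl)
      rw [mul_zero, H0] at this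
      linarith
  · have HNr : (55 : ℝ) = ((∑ y ∈ Finset.Icc a0 (a0 + 0), D.n 0 y) + (D.n 1 0 + D.n 1 1) +
      ∑ y ∈ Finset.Icc (-a0 + 0) (-a0 + 0 + 3), D.n 2 y : ℕ) := by exact_mod_cast HN
    rw [sum_Icc0, sum_Icc3] at HNr
    have x0 := (pr 0 0 (by omega) (by omega) (by omega) (by omega))
    have x1 := (pr 0 1 (by omega) (by omega) (by omega) (by omega))
    have x2 := (pr 0 2 (by omega) (by omega) (by omega) (by omega))
    have x3 := (pr 0 3 (by omega) (by omega) (by omega) (by omega))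
    push_cast at HNr
    norm_num [H0, H1, H2, H3] at x0 x1 x2 x3 HNr
    norm_cast at x0 x1 x2 x3 HNr n10 n11
    obtain ⟨x01, x02, x03⟩ := x0
    obtain ⟨x11, x12, x13⟩ := x1
    obtain ⟨x21, x22, x23⟩ := x2
    obtain ⟨x31, x32, x33⟩ := x3
    refine ⟨⟨-1, 0, a0, 1, 2, -a0, by norm_num⟩, ?_⟩
    simp only [map_n, map_F, Aff.X, Aff.Y]
    norm_num
    have hF0 : D.F 0 (a0 : ℤ) 0 := (F0 a0).2 (by omega)
    refine ⟨?_, ?_, ?_, ?_, ?_, ?_, ?_⟩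
    · have : 19 ≤ D.n 2 (-a0) := by omega
      exact this
    · have : 13 ≤ D.n 2 (-a0 + 1) := by omega
      have e : 1 + -a0 = -a0 + 1 := by ring
      first | rw [e] | skip
      exact this
    · have : 1 ≤ D.n 2 (-a0 + 3) := by omega
      have e : 3 + -a0 = -a0 + 3 := by ring
      first | rw [e] | skip
      exact this
    · have : 10 ≤ D.n 1 0 := by omega
      exact this
    · have : 1 ≤ D.n 0 a0 := by omega
      have e : a0 * 2 + -a0 = a0 := by ring
      rw [e]
      exact this
    · intro l hl
      have := (D.H_sum (y := a0) (y' := 1 + -a0) hF0 (by push_cast; exact hl)).2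
      have e : a0 + (1 + -a0) = 1 := by ring
      rw [e, H1] at this
      linarith
    · intro l hl
      have := D.H_two (y := 0) (by simpa using hl)
      rw [mul_zero, H0] at this
      linarith

lemma i_one (h : D.Nm 1) : D.N ≤ 54 ∨ (D.N = 55 ∧ D.Table) := by
  by_cases M0 : D.M 0 <;> by_cases M4 : D.M 4
  · left
    have hNle := h.Nle
    have M1 : D.M 1 := h.mid (by norm_num) (by norm_num)
    have M2 : D.M 2 := h.mid (by norm_num) (by norm_num)
    have M3 : D.M 3 := h.mid (by norm_num) (by norm_num)
    obtain ⟨p, q, -, -, hcap⟩ := h.caps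
    have c2 := hcap 1 (by norm_num) (by norm_num)
    norm_num at c2
    have c2' : D.H 2 ≤ 6 := by split_ifs at c2 <;> linarith
    have t1 := (D.H_conc (s := 2) M0 M4 (by norm_num) (by norm_num)).2
    have t2 := (D.H_conc (s := 2) M1 M3 (by norm_num) (by norm_num)).2
    norm_num at t1 t2
    have E1 : Finset.Icc (0 : ℤ) (2 * 1 + 2) = {0, 1, 2, 3, 4} := by decide
    have E2 : Finset.Icc (0 : ℤ) (1 + 1) = {0, 1, 2} := by decide
    rw [E1, E2] at hNle
    simp [c, e, M0, M1, M2, M3, M4] at hNle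
    have : (D.N : ℝ) ≤ 54 := by linarith
    exact_mod_cast this
  · exact h.one M0 M4
  · have := h.refl.one (by rw [refl_M]; simpa using M4) (by rw [refl_M]; simpa using M0)
    rw [map_N] at this
    rcases this with h | h
    · exact Or.inl h
    · exact Or.inr ⟨h.1, Table_map _ h.2⟩
  · left
    have hNle := h.Nle
    have M1 : D.M 1 := h.mid (by norm_num) (by norm_num)
    have M2 : D.M 2 := h.mid (by norm_num) (by norm_num)
    have M3 : D.M 3 := h.mid (by norm_num) (by norm_num)
    obtain ⟨p, q, -, -, hcap⟩ := h.caps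
    have c2 := hcap 1 (by norm_num) (by norm_num)
    norm_num at c2
    have c2' : D.H 2 ≤ 6 := by split_ifs at c2 <;> linarith
    have t2 := (D.H_conc (s := 2) M1 M3 (by norm_num) (by norm_num)).2
    norm_num at t2
    have E1 : Finset.Icc (0 : ℤ) (2 * 1 + 2) = {0, 1, 2, 3, 4} := by decide
    have E2 : Finset.Icc (0 : ℤ) (1 + 1) = {0, 1, 2} := by decide
    rw [E1, E2] at hNle
    simp [c, e, M0, M1, M2, M3, M4] at hNle
    have : (D.N : ℝ) ≤ 54 := by linarith
    exact_mod_cast this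

lemma i_two {i : ℤ} (h : D.Nm i) (hi : 2 ≤ i) {s : ℤ} (hs : D.M s) (h5 : 5 ≤ D.H s)
    (hsi : s ≤ i + 1) : D.N ≤ 54 := by
  have h4 := h.i_le hs h5 hsi
  have key : (D.N : ℝ) < 55 := by
    interval_cases i
    · exact h.num2 hs h5 hsi
    · exact h.num3 hs h5 hsi
    · exact h.num4 hs h5 hsi
  have : D.N < 55 := by exact_mod_cast key
  omega

lemma fin {i : ℤ} (h : D.Nm i) {x y : ℤ} (hz : D.F x y 5) :
    D.N ≤ 54 ∨ (D.N = 55 ∧ D.Table) := by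
  have hi := h.hi
  rcases eq_or_lt_of_le hi with h1 | h1
  · subst h1; exact h.i_one
  · left
    obtain ⟨s, hs, h5⟩ := h.exs hz
    rcases le_or_gt s (i + 1) with h2 | h2
    · exact h.i_two h1 hs h5 h2
    · have := h.refl.i_two h1 (s := 2 * i + 2 - s) (by rw [refl_M]; simpa using hs)
        (by rw [refl_H]; simpa using h5) (by omega)
      rwa [map_N] at this

end Nm

/-- Step 4 -/
theorem step4 (hW : D.W2) {x y : ℤ} (hz : D.F x y 5) : D.N ≤ 54 ∨ (D.N = 55 ∧ D.Table) := by
  obtain ⟨ψ, i, h⟩ := D.exNm hW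
  have := h.fin (x := ψ.X' x y) (y := ψ.Y' x y) (by rw [map_F, ψ.XX', ψ.YY']; exact hz)
  rw [map_N] at this
  rcases this with h | h
  · exact Or.inl h
  · exact Or.inr ⟨h.1, Table_map _ h.2⟩

theorem main_big (hbig : 9 ≤ D.big) : D.N ≤ 54 ∨ (D.N = 55 ∧ D.Table) := by
  rcases D.W2_or_small hbig with h | h
  · obtain ⟨w, hw⟩ : ∃ w : ℤ × ℤ, D.n w.1 w.2 - 5 ≠ 0 := by
      by_contra hc
      push Not at hc
      unfold big at hbig
      simp [hc] at hbig
    have h6 : 6 ≤ D.n w.1 w.2 := by omega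
    have h6r : (6 : ℝ) ≤ D.n w.1 w.2 := by exact_mod_cast h6
    have h5 := D.nF (x := w.1) (y := w.2) (by omega)
    exact step4 h (D.mono h5 (by norm_num) (by linarith : (5 : ℝ) ≤ _))
  · exact Or.inl h

theorem main_nonpar {p q r s x0 h0 u v : ℤ} (hp : D.F p q 0) (hr : D.F r s 0) (hu : r = p + 5 * u)
    (hv : s = q + 5 * v) (hne : u ≠ 0 ∨ v ≠ 0) (hz : D.F x0 h0 5) :
    D.N ≤ 54 ∨ (D.N = 55 ∧ D.Table) :=
  step4 (D.nonpar hp hr hu hv hne hz) hz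

end Dat

/-- Points of the fibre over `(x,y)`. -/
def Fib (P : Set (Fin 3 → ℝ)) (x y : ℝ) : Set ℝ := {z | ![x, y, z] ∈ P}

namespace Fr

variable {P : Set (Fin 3 → ℝ)}

lemma vec_comb (s t x y z x' y' z' : ℝ) : s • ![x, y, z] + t • ![x', y', z'] =
    ![s * x + t * x', s * y + t * y', s * z + t * z'] := by
  ext i; fin_cases i <;> simp

lemma cast_vec (x y z : ℤ) : castPt ![x, y, z] = ![(x : ℝ), y, z] := by
  ext i; fin_cases i <;> simp [castPt]

lemma vec_eta {α : Type*} (v : Fin 3 → α) : ![v 0, v 1, v 2] = v := by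
  ext i; fin_cases i <;> simp

lemma convex_P (h : IsLatticePolytope P) : Convex ℝ P := by
  obtain ⟨V, -, rfl⟩ := h
  exact convex_convexHull ℝ _

lemma compact_P (h : IsLatticePolytope P) : IsCompact P := by
  obtain ⟨V, -, rfl⟩ := h
  exact (V.finite_toSet.image _).isCompact_convexHull ℝ

lemma comb (h : Convex ℝ P) {s t x y z x' y' z' : ℝ} (h1 : ![x, y, z] ∈ P) (h2 : ![x', y', z'] ∈ P)
    (hs : 0 ≤ s) (ht : 0 ≤ t) (hst : s + t = 1) :
    ![s * x + t * x', s * y + t * y', s * z + t * z'] ∈ P := by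
  rw [← vec_comb]; exact h h1 h2 hs ht hst

lemma convex_Fib (h : Convex ℝ P) (x y : ℝ) : Convex ℝ (Fib P x y) := by
  intro z hz z' hz' s t hs ht hst
  have := comb h hz hz' hs ht hst
  rw [← add_mul, ← add_mul, hst, one_mul, one_mul] at this
  exact this

lemma btw (h : Convex ℝ P) {x y z z1 z2 : ℝ} (h1 : ![x, y, z1] ∈ P) (h2 : ![x, y, z2] ∈ P)
    (h3 : z1 ≤ z) (h4 : z ≤ z2) : ![x, y, z] ∈ P :=
  (convex_Fib h x y).ordConnected.out h1 h2 ⟨h3, h4⟩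

lemma cont_z (x y : ℝ) : Continuous fun z : ℝ => ![x, y, z] := by
  refine continuous_pi fun i => ?_
  fin_cases i <;> simp <;> fun_prop

lemma cont_xy (z : ℝ) : Continuous fun w : ℝ × ℝ => ![w.1, w.2, z] := by
  refine continuous_pi fun i => ?_
  fin_cases i <;> simp <;> fun_prop

lemma bdd (h : IsLatticePolytope P) : ∃ R : ℤ, ∀ p ∈ P, ∀ i, |p i| ≤ R := by
  obtain ⟨R, hR⟩ := (compact_P h).isBounded.exists_norm_le
  refine ⟨⌈R⌉, fun p hp i => ?_⟩
  have := (norm_le_pi_norm p i).trans (hR p hp)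
  rw [Real.norm_eq_abs] at this
  exact this.trans (Int.le_ceil R)

lemma compact_Fib (h : IsLatticePolytope P) (x y : ℝ) : IsCompact (Fib P x y) := by
  have hc : IsClosed (Fib P x y) := (compact_P h).isClosed.preimage (cont_z x y)
  obtain ⟨R, hR⟩ := bdd h
  refine IsCompact.of_isClosed_subset (isCompact_Icc (a := -(R : ℝ)) (b := R)) hc ?_
  intro z hz
  have := hR _ hz 2
  simpa [abs_le] using this

/-- integer fibre -/
def ZF (P : Set (Fin 3 → ℝ)) (x y : ℤ) : Set ℤ := {z | ![(x : ℝ), y, z] ∈ P}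

lemma ZF_fin (h : IsLatticePolytope P) (x y : ℤ) : (ZF P x y).Finite := by
  obtain ⟨R, hR⟩ := bdd h
  refine (Set.finite_Icc (-R) R).subset ?_
  intro z hz
  have := hR _ hz 2
  simp [abs_le] at this
  exact ⟨by exact_mod_cast this.1, by exact_mod_cast this.2⟩

lemma ZF_exists (h : IsLatticePolytope P) {x y : ℤ} (hn : 1 ≤ (ZF P x y).ncard) :
    ∃ p, p ∈ ZF P x y ∧ p + ((ZF P x y).ncard - 1 : ℤ) ∈ ZF P x y ∧ ∀ q ∈ ZF P x y, p ≤ q := by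
  have hf := ZF_fin h x y
  have hne : (ZF P x y).Nonempty := by
    rw [← Set.ncard_pos hf]; omega
  obtain ⟨p, hp, hpm⟩ := hf.exists_minimalFor id _ hne
  obtain ⟨q, hq, hqm⟩ := hf.exists_maximalFor id _ hne
  have h1 : ∀ z ∈ ZF P x y, p ≤ z := fun z hz => by
    rcases le_total p z with h | h
    · exact h
    · exact hpm hz h
  have h2 : ∀ z ∈ ZF P x y, z ≤ q := fun z hz => by
    rcases le_total z q with h | h
    · exact h
    · exact hqm hz h
  refine ⟨p, hp, ?_, h1⟩
  have hsub : ZF P x y ⊆ (Finset.Icc p q : Finset ℤ) := fun z hz => by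
    simp; exact ⟨h1 z hz, h2 z hz⟩
  have hc := Set.ncard_le_ncard hsub (Finset.finite_toSet _)
  rw [Set.ncard_coe_finset, Int.card_Icc] at hc
  have hpq := h1 q hq
  have hb := btw (convex_P h) (z := ((p + ((ZF P x y).ncard - 1 : ℤ) : ℤ) : ℝ)) hp hq
    (by exact_mod_cast (by omega)) (by exact_mod_cast (by omega))
  exact hb

end Fr

namespace Fr

variable {P : Set (Fin 3 → ℝ)}

/-- chord predicate -/
def FF (P : Set (Fin 3 → ℝ)) (x y l : ℝ) : Prop := 0 ≤ l ∧ ∃ z, ![x, y, z] ∈ P ∧ ![x, y, z + l] ∈ P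

/-- interior of the projection -/
def II (P : Set (Fin 3 → ℝ)) (x y : ℝ) : Prop := ∃ z, ![x, y, z] ∈ interior P

lemma F_conv (hP : IsLatticePolytope P) {x y l x' y' l' s t : ℝ} (h1 : FF P x y l)
    (h2 : FF P x' y' l') (hs : 0 ≤ s) (ht : 0 ≤ t) (hst : s + t = 1) :
    FF P (s * x + t * x') (s * y + t * y') (s * l + t * l') := by
  obtain ⟨l0, z, hz, hzl⟩ := h1
  obtain ⟨l0', z', hz', hzl'⟩ := h2
  refine ⟨by positivity, s * z + t * z', comb (convex_P hP) hz hz' hs ht hst, ?_⟩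
  have := comb (convex_P hP) hzl hzl' hs ht hst
  have e : s * z + t * z' + (s * l + t * l') = s * (z + l) + t * (z' + l') := by ring
  rw [e]; exact this

lemma F_mono (hP : IsLatticePolytope P) {x y l l' : ℝ} (h1 : FF P x y l) (h0 : 0 ≤ l')
    (hl : l' ≤ l) : FF P x y l' := by
  obtain ⟨l0, z, hz, hzl⟩ := h1
  exact ⟨h0, z, hz, btw (convex_P hP) hz hzl (by linarith) (by linarith)⟩

lemma I_mix (hP : IsLatticePolytope P) {x y x' y' l' s t : ℝ} (h1 : II P x y)
    (h2 : FF P x' y' l') (hs : 0 < s) (ht : 0 ≤ t) (hst : s + t = 1) :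
    II P (s * x + t * x') (s * y + t * y') := by
  obtain ⟨z, hz⟩ := h1
  obtain ⟨-, z', hz', -⟩ := h2
  refine ⟨s * z + t * z', ?_⟩
  rw [← vec_comb]
  exact (convex_P hP).combo_interior_self_mem_interior hz hz' hs ht hst

lemma I_pos {x y : ℝ} (h : II P x y) : ∃ l, 0 < l ∧ FF P x y l := by
  obtain ⟨z, hz⟩ := h
  have ho : IsOpen ((fun z : ℝ => ![x, y, z]) ⁻¹' interior P) := isOpen_interior.preimage (cont_z x y)
  obtain ⟨ε, he, hb⟩ := Metric.isOpen_iff.1 ho z hz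
  refine ⟨ε / 2, by positivity, by positivity, z, interior_subset hz, ?_⟩
  have : z + ε / 2 ∈ Metric.ball z ε := by
    rw [Metric.mem_ball, Real.dist_eq]
    rw [abs_of_pos] <;> linarith
  exact interior_subset (hb this)

lemma I_supp (hP : IsLatticePolytope P) {x y : ℝ} (h : ¬ II P x y) :
    ∃ α β : ℝ, ∀ x' y', II P x' y' → α * x' + β * y' < α * x + β * y := by
  let J : Set (ℝ × ℝ) := {w | II P w.1 w.2}
  have hJo : IsOpen J := by
    have : J = ⋃ z : ℝ, (fun w : ℝ × ℝ => ![w.1, w.2, z]) ⁻¹' interior P := by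
      ext w; simp [J, II]
    rw [this]
    exact isOpen_iUnion fun z => isOpen_interior.preimage (cont_xy z)
  have hJc : Convex ℝ J := by
    rintro ⟨x1, y1⟩ ⟨z1, h1⟩ ⟨x2, y2⟩ ⟨z2, h2⟩ s t hs ht hst
    refine ⟨s * z1 + t * z2, ?_⟩
    have := (convex_P hP).interior h1 h2 hs ht hst
    rw [vec_comb] at this
    simpa using this
  obtain ⟨f, hf⟩ := geometric_hahn_banach_open_point hJc hJo (x := (x, y)) h
  have key : ∀ x y : ℝ, f (x, y) = f (1, 0) * x + f (0, 1) * y := by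
    intro x y
    have : ((x, y) : ℝ × ℝ) = x • (1, 0) + y • (0, 1) := by simp
    rw [this, map_add, map_smul, map_smul]; simp; ring
  refine ⟨f (1, 0), f (0, 1), fun x' y' h' => ?_⟩
  rw [← key, ← key]
  exact hf (x', y') h'

lemma I_push (hP : IsLatticePolytope P) {x y α β : ℝ} (h : II P x y) (hab : α ≠ 0 ∨ β ≠ 0) :
    ∃ p q : ℤ, FF P p q 0 ∧ α * x + β * y < α * p + β * q := by
  obtain ⟨z, hz⟩ := h
  obtain ⟨V, hV, hPV⟩ := hP
  by_contra hcon
  push Not at hcon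
  have hVP : ∀ v ∈ V, castPt v ∈ P := fun v hv => by
    rw [hPV]; exact subset_convexHull ℝ _ ⟨v, hv, rfl⟩
  have hsub : P ⊆ {p | α * p 0 + β * p 1 ≤ α * x + β * y} := by
    rw [hPV]
    refine convexHull_min ?_ ?_
    · rintro _ ⟨v, hv, rfl⟩
      refine hcon (v 0) (v 1) ⟨le_rfl, v 2, ?_, ?_⟩
      · rw [← cast_vec, vec_eta]; exact hVP v hv
      · rw [add_zero, ← cast_vec, vec_eta]; exact hVP v hv
    · intro p hp q hq s t hs ht hst
      simp only [Set.mem_ofPred_eq, Pi.add_apply, Pi.smul_apply, smul_eq_mul] at hp hq ⊢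
      calc _ = s * (α * p 0 + β * p 1) + t * (α * q 0 + β * q 1) := by ring
        _ ≤ s * (α * x + β * y) + t * (α * x + β * y) := by gcongr
        _ = _ := by rw [← add_mul, hst, one_mul]
  have hc : Continuous fun e : ℝ => ![x + e * α, y + e * β, z] := by
    refine continuous_pi fun i => ?_
    fin_cases i <;> simp <;> fun_prop
  have ho := isOpen_interior.preimage (t := interior P) hc
  obtain ⟨ε, he, hb⟩ := Metric.isOpen_iff.1 ho 0 (by simpa using hz)
  have hm : ε / 2 ∈ Metric.ball (0 : ℝ) ε := by
    rw [Metric.mem_ball, Real.dist_eq, sub_zero, abs_of_pos] <;> linarith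
  have := hsub (interior_subset (hb hm))
  simp at this
  have hpos : 0 < α * α + β * β := by
    rcases hab with h | h
    · have := mul_self_pos.2 h; nlinarith [mul_self_nonneg β]
    · have := mul_self_pos.2 h; nlinarith [mul_self_nonneg α]
  have : 0 < ε / 2 * (α * α + β * β) := by positivity
  nlinarith

lemma I_len (hP : IsLatticePolytope P) {x y : ℝ} (h : FF P x y 0) :
    ∃ l, FF P x y l ∧ ∀ l', FF P x y l' → l' ≤ l := by
  obtain ⟨-, z, hz, -⟩ := h
  have hc := compact_Fib hP x y
  obtain ⟨p, hp, hpm⟩ := hc.exists_isLeast ⟨z, hz⟩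
  obtain ⟨q, hq, hqm⟩ := hc.exists_isGreatest ⟨z, hz⟩
  refine ⟨q - p, ⟨sub_nonneg.2 (hpm hq), p, hp, by rw [add_sub_cancel]; exact hq⟩, ?_⟩
  rintro l' ⟨-, z', hz', hz''⟩
  have h1 := hpm (show z' ∈ Fib P x y from hz')
  have h2 := hqm (show z' + l' ∈ Fib P x y from hz'')
  linarith

lemma fib_int (hP : IsLatticePolytope P) {x y z z1 z2 : ℝ} (h : II P x y) (h1 : ![x, y, z1] ∈ P)
    (h2 : ![x, y, z2] ∈ P) (h3 : z1 < z) (h4 : z < z2) : ![x, y, z] ∈ interior P := by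
  obtain ⟨c, hc⟩ := h
  have aux : ∀ w, ![x, y, w] ∈ P → (w < z ∧ z ≤ c ∨ c ≤ z ∧ z < w) →
      ![x, y, z] ∈ interior P := by
    intro w hw hcase
    have hd : c - w ≠ 0 := by
      intro hd
      rcases hcase with h | h <;> linarith [h.1, h.2]
    have hs : 0 < (z - w) / (c - w) := by
      rcases hcase with h | h
      · exact div_pos (by linarith) (by linarith [h.1, h.2])
      · exact div_pos_of_neg_of_neg (by linarith) (by linarith [h.1, h.2])
    have ht : 0 ≤ (c - z) / (c - w) := by
      rcases hcase with h | h
      · exact div_nonneg (by linarith) (by linarith [h.1, h.2])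
      · exact div_nonneg_of_nonpos (by linarith) (by linarith [h.1, h.2])
    have hst : (z - w) / (c - w) + (c - z) / (c - w) = 1 := by field_simp; ring
    have := (convex_P hP).combo_interior_self_mem_interior hc hw hs ht hst
    rw [vec_comb, ← add_mul, ← add_mul, hst, one_mul, one_mul] at this
    have e : (z - w) / (c - w) * c + (c - z) / (c - w) * w = z := by field_simp; ring
    rwa [e] at this
  rcases le_total z c with h | h
  · exact aux z1 h1 (Or.inl ⟨h3, h⟩)
  · exact aux z2 h2 (Or.inr ⟨h, h4⟩)

lemma I_cap (hP : IsLatticePolytope P) {a b : Fin 3 → ℤ} (hab : intLatPts P = {a, b})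
    {x y : ℤ} {l : ℝ} (hI : II P x y) (hF : FF P x y l) :
    l ≤ 1 + (if x = a 0 ∧ y = a 1 then 1 else 0) + (if x = b 0 ∧ y = b 1 then 1 else 0) := by
  obtain ⟨l0, z, hz, hzl⟩ := hF
  have key : ∀ k : ℤ, z < k → (k : ℝ) < z + l → ((x = a 0 ∧ y = a 1) ∧ k = a 2) ∨
      ((x = b 0 ∧ y = b 1) ∧ k = b 2) := by
    intro k h1 h2
    have h3 : ![x, y, k] ∈ intLatPts P := by
      show castPt _ ∈ interior P
      rw [cast_vec]
      exact fib_int hP hI hz hzl h1 h2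
    rw [hab] at h3
    rcases h3 with h | h
    · left; rw [← h]; simp
    · right; rw [show b = _ from h.symm]; simp
  by_contra hcon
  push Not at hcon
  have f1 := Int.lt_floor_add_one z
  have f2 := Int.floor_le z
  split_ifs at hcon with h1 h2 h2
  · have k1 := key (⌊z⌋ + 1) (by push_cast; linarith) (by push_cast; linarith)
    have k2 := key (⌊z⌋ + 2) (by push_cast; linarith) (by push_cast; linarith)
    have k3 := key (⌊z⌋ + 3) (by push_cast; linarith) (by push_cast; linarith)
    omega
  · have k1 := key (⌊z⌋ + 1) (by push_cast; linarith) (by push_cast; linarith)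
    have k2 := key (⌊z⌋ + 2) (by push_cast; linarith) (by push_cast; linarith)
    omega
  · have k1 := key (⌊z⌋ + 1) (by push_cast; linarith) (by push_cast; linarith)
    have k2 := key (⌊z⌋ + 2) (by push_cast; linarith) (by push_cast; linarith)
    omega
  · have k1 := key (⌊z⌋ + 1) (by push_cast; linarith) (by push_cast; linarith)
    omega

/-- The projection data of a polytope along the third axis. -/
def mk (hP : IsLatticePolytope P) (a b : Fin 3 → ℤ) (hab : intLatPts P = {a, b}) : Dat where
  F := FF P
  I := II P
  n x y := (ZF P x y).ncard
  sa1 := a 0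
  sa2 := a 1
  sb1 := b 0
  sb2 := b 1
  nonneg h := h.1
  mono := F_mono hP
  conv := F_conv hP
  imix := I_mix hP
  ipos := I_pos
  supp := I_supp hP
  push := I_push hP
  cap := I_cap hP hab
  isa := by
    have : a ∈ intLatPts P := by rw [hab]; simp
    refine ⟨a 2, ?_⟩
    rw [← cast_vec, vec_eta]; exact this
  len := I_len hP
  nF {x y} h := by
    obtain ⟨p, hp, hq, -⟩ := ZF_exists hP h
    refine ⟨?_, p, hp, ?_⟩
    · have : (1 : ℝ) ≤ (ZF P x y).ncard := by exact_mod_cast h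
      linarith
    · have : ![(x : ℝ), y, ((p + ((ZF P x y).ncard - 1 : ℤ) : ℤ) : ℝ)] ∈ P := hq
      push_cast at this
      exact this
  fin := by
    obtain ⟨R, hR⟩ := bdd hP
    refine ((Set.finite_Icc (-R) R).prod (Set.finite_Icc (-R) R)).subset ?_
    rintro ⟨x, y⟩ ⟨-, z, hz, -⟩
    have h0 := hR _ hz 0
    have h1 := hR _ hz 1
    simp [abs_le] at h0 h1
    refine ⟨⟨?_, ?_⟩, ⟨?_, ?_⟩⟩
    · exact_mod_cast h0.1
    · exact_mod_cast h0.2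
    · exact_mod_cast h1.1
    · exact_mod_cast h1.2

end Fr

namespace Fr

variable {P : Set (Fin 3 → ℝ)} {a b : Fin 3 → ℤ}

lemma rule (hP : IsLatticePolytope P) (hab : intLatPts P = {a, b}) {u1 u2 w : Fin 3 → ℤ}
    (h1 : castPt (a + u1) ∈ P) (h2 : castPt (a + u2) ∈ P) (k1 k2 m : ℤ) (hk1 : 0 ≤ k1)
    (hk2 : 0 ≤ k2) (hm : k1 + k2 < m) (hw : ∀ i, m * w i = k1 * u1 i + k2 * u2 i) :
    w = 0 ∨ w = b - a := by
  have hm0 : 0 < m := by omega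
  rcases eq_or_lt_of_le (show 0 ≤ k1 + k2 by omega) with h0 | h0
  · left
    have e1 : k1 = 0 := by omega
    have e2 : k2 = 0 := by omega
    subst e1 e2
    ext i
    have := hw i
    simp at this
    rcases this with h | h
    · omega
    · exact h
  have ha : castPt a ∈ interior P := by
    have : a ∈ intLatPts P := by rw [hab]; simp
    exact this
  have hk1r : (0 : ℝ) ≤ k1 := by exact_mod_cast hk1
  have hk2r : (0 : ℝ) ≤ k2 := by exact_mod_cast hk2
  have hkr : (0 : ℝ) < k1 + k2 := by exact_mod_cast h0
  have hmr : (0 : ℝ) < m := by exact_mod_cast hm0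
  have hkm : (k1 + k2 : ℝ) < m := by exact_mod_cast hm
  have hq : (k1 / (k1 + k2) : ℝ) • castPt (a + u1) + (k2 / (k1 + k2) : ℝ) • castPt (a + u2) ∈ P :=
    convex_P hP h1 h2 (by positivity) (by positivity) (by field_simp)
  have hp := (convex_P hP).combo_interior_self_mem_interior ha hq
    (a := 1 - (k1 + k2) / m) (b := (k1 + k2) / m)
    (by rw [sub_pos, div_lt_one hmr]; exact hkm) (by positivity) (by ring)
  have e : (1 - (k1 + k2) / m : ℝ) • castPt a + ((k1 + k2) / m : ℝ) •
      ((k1 / (k1 + k2) : ℝ) • castPt (a + u1) + (k2 / (k1 + k2) : ℝ) • castPt (a + u2)) =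
      castPt (a + w) := by
    ext i
    have hi : (m : ℝ) * w i = k1 * u1 i + k2 * u2 i := by exact_mod_cast hw i
    simp only [castPt, Pi.add_apply, Pi.smul_apply, smul_eq_mul, Int.cast_add]
    field_simp
    linear_combination - hi
  rw [e] at hp
  have hmem : a + w ∈ intLatPts P := hp
  rw [hab] at hmem
  rcases hmem with h | h
  · left; simpa using h
  · right; rw [← show a + w = b from h]; simp

/-- reduction mod `p` -/
def md (p : ℕ) (u : Fin 3 → ℤ) : Fin 3 → ZMod p := fun i => (u i : ZMod p)

lemma md_eq {p : ℕ} {u v : Fin 3 → ℤ} (h : md p u = md p v) : ∃ w : Fin 3 → ℤ, ∀ i,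
    u i - v i = p * w i := by
  have : ∀ i, ∃ w : ℤ, u i - v i = p * w := fun i => by
    have := congrFun h i
    simp only [md] at this
    rw [← sub_eq_zero, ← Int.cast_sub, ZMod.intCast_zmod_eq_zero_iff_dvd] at this
    exact this
  choose w hw using this
  exact ⟨w, hw⟩

lemma md_neg (p : ℕ) (u : Fin 3 → ℤ) : md p (-u) = - md p u := by
  ext i; simp [md]

lemma md_add (p : ℕ) (u v : Fin 3 → ℤ) : md p (u + v) = md p u + md p v := by
  ext i; simp [md]

lemma md_zero (p : ℕ) : md p 0 = 0 := by
  ext i; simp [md]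

lemma md_eq' {p : ℕ} {u v : Fin 3 → ℤ} {w : Fin 3 → ℤ} (h : ∀ i, u i - v i = p * w i) :
    md p u = md p v := by
  ext i
  have := congrArg (Int.cast : ℤ → ZMod p) (h i)
  simp at this
  simpa [md, sub_eq_zero] using this

section
variable (hP : IsLatticePolytope P) (hab : intLatPts P = {a, b}) (hne : a ≠ b)

lemma beta_ne (hne : a ≠ b) : ∃ i, b i - a i ≠ 0 := by
  by_contra h
  push Not at h
  exact hne (funext fun i => by linarith [h i])

lemma ne_two (hne : a ≠ b) {w : Fin 3 → ℤ} (k : ℤ) (hk : k ≠ 0) (hk1 : k ≠ 1)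
    (hw : ∀ i, w i = k * (b i - a i)) : ¬ (w = 0 ∨ w = b - a) := by
  obtain ⟨i, hi⟩ := beta_ne hne
  rintro (h | h)
  · have := hw i
    rw [h] at this
    simp at this
    rcases this with h | h <;> contradiction
  · have := hw i
    rw [h] at this
    simp at this
    have h2 : (k - 1) * (b i - a i) = 0 := by linarith
    rcases mul_eq_zero.1 h2 with h | h
    · omega
    · exact hi h

lemma c0 (hP : IsLatticePolytope P) (hab : intLatPts P = {a, b}) (hne : a ≠ b) {x : Fin 3 → ℤ}
    (hx : castPt (a + x) ∈ P) (h : md 5 x = 0) : x = 0 := by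
  rw [← md_zero] at h
  obtain ⟨w, hw⟩ := md_eq h
  simp at hw
  rcases rule hP hab hx hx 1 0 5 (by norm_num) (by norm_num) (by norm_num) (w := w)
    (fun i => by rw [hw i]; ring) with h1 | h1
  · ext i; rw [hw i, h1]; simp
  · exfalso
    refine ne_two hne 2 (by norm_num) (by norm_num) (w := fun i => 2 * (b i - a i)) (fun i => rfl) ?_
    refine rule hP hab hx hx 2 0 5 (by norm_num) (by norm_num) (by norm_num) (fun i => ?_)
    rw [hw i, h1, Pi.sub_apply]; ring

lemma cneg (hP : IsLatticePolytope P) (hab : intLatPts P = {a, b}) (hne : a ≠ b)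
    {x y : Fin 3 → ℤ} (hx : castPt (a + x) ∈ P) (hy : castPt (a + y) ∈ P)
    (h : md 5 y = - md 5 x) : y = -x := by
  rw [← md_neg] at h
  obtain ⟨w, hw⟩ := md_eq h
  simp at hw
  rcases rule hP hab hx hy 1 1 5 (by norm_num) (by norm_num) (by norm_num) (w := w)
    (fun i => by rw [← hw i]; ring) with h1 | h1
  · ext i
    have := hw i
    rw [h1] at this
    simp at this
    simp; linarith
  · exfalso
    refine ne_two hne 2 (by norm_num) (by norm_num) (w := fun i => 2 * (b i - a i)) (fun i => rfl) ?_
    refine rule hP hab hx hy 2 2 5 (by norm_num) (by norm_num) (by norm_num) (fun i => ?_)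
    have := hw i
    rw [h1, Pi.sub_apply] at this
    linarith

lemma ctwo (hP : IsLatticePolytope P) (hab : intLatPts P = {a, b}) (hne : a ≠ b)
    {x y : Fin 3 → ℤ} (hx : castPt (a + x) ∈ P) (hy : castPt (a + y) ∈ P) (hx0 : x ≠ 0)
    (h : md 5 y = md 5 x + md 5 x) :
    (x = (b - a) + (b - a) ∧ y = -(b - a)) ∨ (x = b - a ∧ y = (b - a) + (b - a)) := by
  rw [← md_add] at h
  obtain ⟨w, hw⟩ := md_eq h
  simp at hw
  have r1 := rule hP hab hx hy 3 1 5 (by norm_num) (by norm_num) (by norm_num) (w := x + w)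
    (fun i => by simp only [Pi.add_apply]; linarith [hw i])
  have r2 := rule hP hab hx hy 1 2 5 (by norm_num) (by norm_num) (by norm_num) (w := x + w + w)
    (fun i => by simp only [Pi.add_apply]; linarith [hw i])
  rcases r1 with r1 | r1 <;> rcases r2 with r2 | r2
  · exfalso
    apply hx0
    ext i
    have h1 := congrFun r1 i
    have h2 := congrFun r2 i
    simp at h1 h2 ⊢
    linarith
  · exfalso
    refine ne_two hne 2 (by norm_num) (by norm_num) (w := fun i => 2 * (b i - a i)) (fun i => rfl) ?_
    refine rule hP hab hy hy 2 0 3 (by norm_num) (by norm_num) (by norm_num) (fun i => ?_)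
    have h1 := congrFun r1 i
    have h2 := congrFun r2 i
    have h3 := hw i
    simp at h1 h2 ⊢
    linarith
  · left
    constructor <;> ext i <;> (
      have h1 := congrFun r1 i
      have h2 := congrFun r2 i
      have h3 := hw i
      simp at h1 h2 ⊢
      linarith)
  · right
    constructor <;> ext i <;> (
      have h1 := congrFun r1 i
      have h2 := congrFun r2 i
      have h3 := hw i
      simp at h1 h2 ⊢
      linarith)

lemma c3 (hP : IsLatticePolytope P) (hab : intLatPts P = {a, b}) (hne : a ≠ b)
    {x y : Fin 3 → ℤ} (hx : castPt (a + x) ∈ P) (hy : castPt (a + y) ∈ P)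
    (hx' : castPt (a + -x) ∈ P) (hy' : castPt (a + -y) ∈ P) (h : md 3 x = md 3 y) : x = y := by
  obtain ⟨w, hw⟩ := md_eq h
  simp at hw
  have r1 := rule hP hab hx hy' 1 1 3 (by norm_num) (by norm_num) (by norm_num) (w := w)
    (fun i => by simp only [Pi.neg_apply]; linarith [hw i])
  have r2 := rule hP hab hx' hy 1 1 3 (by norm_num) (by norm_num) (by norm_num) (w := -w)
    (fun i => by simp only [Pi.neg_apply]; linarith [hw i])
  rcases r1 with r1 | r1
  · ext i
    have := hw i
    rw [r1] at this
    simp at this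
    linarith
  · exfalso
    refine ne_two hne (-1) (by norm_num) (by norm_num) (w := -w) (fun i => ?_) r2
    rw [r1]; simp

theorem classes (hP : IsLatticePolytope P) (hab : intLatPts P = {a, b}) (hne : a ≠ b)
    (T : Finset (Fin 3 → ℤ)) (hT : ∀ x ∈ T, castPt (a + x) ∈ P) (hT0 : 0 ∉ T) :
    (T.image (md 5)).card ≤ 45 := by
  classical
  set C := T.image (md 5) with hC
  set C2 := C.image (fun c => -c) with hC2
  set D := C ∪ C2 with hD
  set D2 := D.image (fun c => c + c) with hD2
  have cC2 : C2.card = C.card := Finset.card_image_of_injective _ neg_injective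
  have cD2 : D2.card = D.card := by
    refine Finset.card_image_of_injective _ ?_
    intro c d h
    have : ∀ x y : ZMod 5, x + x = y + y → x = y := by decide
    exact funext fun i => this _ _ (congrFun h i)
  have hD_mem : ∀ d ∈ D, ∃ x ∈ T, d = md 5 x ∨ d = - md 5 x := by
    intro d hd
    rcases Finset.mem_union.1 hd with h | h
    · obtain ⟨x, hx, rfl⟩ := Finset.mem_image.1 h
      exact ⟨x, hx, Or.inl rfl⟩
    · obtain ⟨c, hc, rfl⟩ := Finset.mem_image.1 h
      obtain ⟨x, hx, rfl⟩ := Finset.mem_image.1 hc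
      exact ⟨x, hx, Or.inr rfl⟩
  have hn0 : ∀ x ∈ T, md 5 x ≠ 0 := fun x hx h =>
    hT0 (by rw [← c0 hP hab hne (hT x hx) h]; exact hx)
  have hD0 : ∀ d ∈ D, d ≠ 0 := by
    intro d hd
    obtain ⟨x, hx, rfl | rfl⟩ := hD_mem d hd
    · exact hn0 x hx
    · simpa using hn0 x hx
  have e5 : ∀ x y : ZMod 5, x + x = y ↔ x = -(y + y) := by decide
  have e5' : ∀ x y : Fin 3 → ZMod 5, x + x = y ↔ x = -(y + y) := by
    intro x y
    constructor
    · intro h; exact funext fun i => (e5 _ _).1 (congrFun h i)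
    · intro h; exact funext fun i => (e5 _ _).2 (congrFun h i)
  set β := b - a with hβ
  have hsub : D ∩ D2 ⊆ {md 5 β, - md 5 β, md 5 (β + β), - md 5 (β + β)} := by
    intro d hd
    obtain ⟨h1, h2⟩ := Finset.mem_inter.1 hd
    obtain ⟨d', h3, h4⟩ := Finset.mem_image.1 h2
    obtain ⟨y, hy, hdy⟩ := hD_mem d h1
    obtain ⟨x, hx, hdx⟩ := hD_mem d' h3
    have hx0 : x ≠ 0 := fun h => hT0 (h ▸ hx)
    have hy0 : y ≠ 0 := fun h => hT0 (h ▸ hy)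
    have hcase : md 5 y = md 5 x + md 5 x ∨ md 5 x = md 5 y + md 5 y := by
      rcases hdy with rfl | rfl <;> rcases hdx with rfl | rfl
      · exact Or.inl h4.symm
      · right
        exact neg_injective ((e5' _ _).1 h4)
      · right
        have := (e5' _ _).1 h4
        simpa [add_comm] using this
      · left
        have := congrArg Neg.neg h4
        simp at this
        rw [← this]
    have hyβ : y = β ∨ y = -β ∨ y = β + β := by
      rcases hcase with h | h
      · rcases ctwo hP hab hne (hT x hx) (hT y hy) hx0 h with h | h
        · exact Or.inr (Or.inl h.2)
        · exact Or.inr (Or.inr h.2)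
      · rcases ctwo hP hab hne (hT y hy) (hT x hx) hy0 h with h | h
        · exact Or.inr (Or.inr h.1)
        · exact Or.inl h.1
    simp only [Finset.mem_insert, Finset.mem_singleton]
    rcases hdy with rfl | rfl <;> rcases hyβ with rfl | rfl | rfl <;> simp [md_neg]
  have hcap4 : (D ∩ D2).card ≤ 4 := (Finset.card_le_card hsub).trans Finset.card_le_four
  have hU : (D ∪ D2).card ≤ 124 := by
    have : D ∪ D2 ⊆ Finset.univ.erase 0 := by
      intro d hd
      refine Finset.mem_erase.2 ⟨?_, Finset.mem_univ _⟩
      rcases Finset.mem_union.1 hd with h | h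
      · exact hD0 d h
      · obtain ⟨d', h3, rfl⟩ := Finset.mem_image.1 h
        intro h
        have := (e5' _ _).1 h
        simp at this
        exact hD0 d' h3 this
    refine (Finset.card_le_card this).trans ?_
    rw [Finset.card_erase_of_mem (Finset.mem_univ _), Finset.card_univ]
    simp [ZMod.card]
  have u1 := Finset.card_union_add_card_inter D D2
  have u2 := Finset.card_union_add_card_inter C C2
  rw [← hD] at u2
  have hA : (C ∩ C2).card ≤ 26 := by
    set A := T.filter (fun x => castPt (a + -x) ∈ P) with hAdef
    have h1 : C ∩ C2 ⊆ A.image (md 5) := by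
      intro c hc
      obtain ⟨h1, h2⟩ := Finset.mem_inter.1 hc
      obtain ⟨x, hx, rfl⟩ := Finset.mem_image.1 h1
      obtain ⟨c', hc', h3⟩ := Finset.mem_image.1 h2
      obtain ⟨y, hy, rfl⟩ := Finset.mem_image.1 hc'
      refine Finset.mem_image_of_mem _ (Finset.mem_filter.2 ⟨hx, ?_⟩)
      have := cneg hP hab hne (hT x hx) (hT y hy) (by rw [← h3, neg_neg])
      rw [← this]; exact hT y hy
    have h2 : A.card = (A.image (md 3)).card := by
      refine (Finset.card_image_of_injOn ?_).symm
      intro x hx y hy h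
      have hx := Finset.mem_filter.1 hx
      have hy := Finset.mem_filter.1 hy
      exact c3 hP hab hne (hT x hx.1) (hT y hy.1) hx.2 hy.2 h
    have ha : castPt a ∈ P := by
      have : a ∈ intLatPts P := by rw [hab]; simp
      exact interior_subset this
    have h3 : A.image (md 3) ⊆ Finset.univ.erase 0 := by
      intro d hd
      refine Finset.mem_erase.2 ⟨?_, Finset.mem_univ _⟩
      obtain ⟨x, hx, rfl⟩ := Finset.mem_image.1 hd
      intro h
      have hx := Finset.mem_filter.1 hx
      have : x = 0 := c3 hP hab hne (hT x hx.1) (by simpa using ha) hx.2 (by simpa using ha)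
        (by rw [h, md_zero])
      exact hT0 (this ▸ hx.1)
    have h4 := Finset.card_le_card h3
    rw [Finset.card_erase_of_mem (Finset.mem_univ _), Finset.card_univ] at h4
    simp [ZMod.card] at h4
    have h5 := Finset.card_le_card h1
    have h6 : (A.image (md 5)).card ≤ A.card := Finset.card_image_le
    omega
  omega

theorem classes' (hP : IsLatticePolytope P) (hab : intLatPts P = {a, b}) (hne : a ≠ b)
    (S : Finset (Fin 3 → ℤ)) (hS : ∀ x ∈ S, castPt x ∈ P)
    (hinj : ∀ x ∈ S, ∀ y ∈ S, md 5 x = md 5 y → x = y) : S.card ≤ 46 := by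
  classical
  set T := (S.image (fun x => x - a)).erase 0 with hT
  have h1 := classes hP hab hne T (by
    intro x hx
    obtain ⟨y, hy, rfl⟩ := Finset.mem_image.1 (Finset.mem_of_mem_erase hx)
    simpa using hS y hy) (by simp [hT])
  have h2 : (T.image (md 5)).card = T.card := by
    refine Finset.card_image_of_injOn ?_
    intro x hx y hy h
    obtain ⟨x', hx', rfl⟩ := Finset.mem_image.1 (Finset.mem_of_mem_erase hx)
    obtain ⟨y', hy', rfl⟩ := Finset.mem_image.1 (Finset.mem_of_mem_erase hy)
    have : x' = y' := hinj x' hx' y' hy' (by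
      have e : ∀ u : Fin 3 → ℤ, md 5 u = md 5 (u - a) + md 5 a := fun u => by
        rw [← md_add]; simp
      rw [e x', e y']
      rw [h])
    rw [this]
  have h3 : (S.image (fun x => x - a)).card = S.card :=
    Finset.card_image_of_injective _ (sub_left_injective)
  have h4 := Finset.pred_card_le_card_erase (s := S.image (fun x => x - a)) (a := 0)
  rw [← hT, h3] at h4
  omega

end
end Fr

namespace Fr

variable {P : Set (Fin 3 → ℝ)} {a b : Fin 3 → ℤ}

/-- lattice points -/
def L (P : Set (Fin 3 → ℝ)) : Set (Fin 3 → ℤ) := {x | castPt x ∈ P}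

lemma L_fin (hP : IsLatticePolytope P) : (L P).Finite := by
  obtain ⟨R, hR⟩ := bdd hP
  refine (Set.Finite.pi (t := fun _ : Fin 3 => Set.Icc (-R) R) (fun _ => Set.finite_Icc _ _)).subset ?_
  intro x hx i _
  have := hR _ hx i
  simp [abs_le, castPt] at this
  exact ⟨by exact_mod_cast this.1, by exact_mod_cast this.2⟩

lemma count (S : Set (Fin 3 → ℤ)) (hS : S.Finite) :
    (Function.support fun w : ℤ × ℤ => {z : ℤ | ![w.1, w.2, z] ∈ S}.ncard).Finite ∧
    ∑ᶠ w : ℤ × ℤ, {z : ℤ | ![w.1, w.2, z] ∈ S}.ncard = S.ncard := by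
  classical
  set T := hS.toFinset with hT
  set g : (Fin 3 → ℤ) → ℤ × ℤ := fun x => (x 0, x 1) with hg
  have hsupp : (Function.support fun w : ℤ × ℤ => {z : ℤ | ![w.1, w.2, z] ∈ S}.ncard) ⊆
      (T.image g : Finset (ℤ × ℤ)) := by
    intro w hw
    have h0 : {z : ℤ | ![w.1, w.2, z] ∈ S}.ncard ≠ 0 := hw
    obtain ⟨z, hz⟩ := Set.nonempty_of_ncard_ne_zero h0
    refine Finset.mem_coe.2 (Finset.mem_image.2 ⟨![w.1, w.2, z], ?_, ?_⟩)
    · rw [hT, Set.Finite.mem_toFinset]; exact hz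
    · simp [hg]
  refine ⟨(Finset.finite_toSet _).subset hsupp, ?_⟩
  rw [finsum_eq_sum_of_support_subset _ hsupp, Set.ncard_eq_toFinset_card S hS, ← hT,
    Finset.card_eq_sum_card_fiberwise (f := g) (t := T.image g)
      (fun x hx => Finset.mem_coe.2 (Finset.mem_image_of_mem _ hx))]
  refine Finset.sum_congr rfl fun w _ => ?_
  rw [← Set.ncard_coe_finset]
  have : ((T.filter fun x => g x = w : Finset _) : Set (Fin 3 → ℤ)) =
      (fun z : ℤ => ![w.1, w.2, z]) '' {z : ℤ | ![w.1, w.2, z] ∈ S} := by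
    ext x
    simp only [Finset.coe_filter, Set.mem_ofPred_eq, Set.mem_image, hT, Set.Finite.mem_toFinset]
    constructor
    · rintro ⟨hx, rfl⟩
      refine ⟨x 2, ?_, ?_⟩
      · rw [show ![(g x).1, (g x).2, x 2] = x from vec_eta x]; exact hx
      · exact vec_eta x
    · rintro ⟨z, hz, rfl⟩
      exact ⟨hz, by simp [hg]⟩
  rw [this, Set.ncard_image_of_injective]
  intro z z' h
  have := congrFun h 2
  simpa using this

lemma ZF_eq (x y : ℤ) : ZF P x y = {z : ℤ | ![x, y, z] ∈ L P} := by
  ext z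
  simp only [ZF, L, Set.mem_ofPred_eq, cast_vec]

lemma N_eq (hP : IsLatticePolytope P) (hab : intLatPts P = {a, b}) :
    (mk hP a b hab).N = (L P).ncard := by
  rw [← (count (L P) (L_fin hP)).2]
  unfold Dat.N
  refine finsum_congr fun w => ?_
  show (ZF P w.1 w.2).ncard = _
  rw [ZF_eq]

lemma five (hP : IsLatticePolytope P) (x y : ℤ) :
    {z : ℤ | z ∈ ZF P x y ∧ z - 5 ∈ ZF P x y}.ncard ≤ (ZF P x y).ncard - 5 := by
  have hf := ZF_fin hP x y
  set S := {z : ℤ | z ∈ ZF P x y ∧ z - 5 ∈ ZF P x y} with hS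
  have hSf : S.Finite := hf.subset fun z hz => hz.1
  rcases S.eq_empty_or_nonempty with h | ⟨q, hq⟩
  · rw [h]; simp
  obtain ⟨p, hp, -, hpm⟩ := ZF_exists hP (x := x) (y := y)
    (Nat.one_le_iff_ne_zero.2 (Set.ncard_ne_zero_of_mem hq.1 hf))
  have hpq := hpm _ hq.2
  have hsub : S ∪ (Finset.Icc p (p + 4) : Finset ℤ) ⊆ ZF P x y := by
    rintro z (hz | hz)
    · exact hz.1
    · simp at hz
      exact btw (convex_P hP) hp hq.1 (by exact_mod_cast hz.1) (by exact_mod_cast (by omega))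
  have hd : Disjoint S (Finset.Icc p (p + 4) : Finset ℤ) := by
    rw [Set.disjoint_left]
    intro z hz hz'
    simp at hz'
    have := hpm _ hz.2
    omega
  have h1 := Set.ncard_le_ncard hsub hf
  rw [Set.ncard_union_eq hd hSf (Finset.finite_toSet _), Set.ncard_coe_finset, Int.card_Icc] at h1
  omega

lemma big_ge (hP : IsLatticePolytope P) (hab : intLatPts P = {a, b}) (hne : a ≠ b)
    (hN : 55 ≤ (L P).ncard)
    (hpar : ∀ x ∈ L P, ∀ y ∈ L P, md 5 x = md 5 y → x 0 = y 0 ∧ x 1 = y 1) :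
    9 ≤ (mk hP a b hab).big := by
  classical
  have hLf := L_fin hP
  set S : Set (Fin 3 → ℤ) := {x | x ∈ L P ∧ ![x 0, x 1, x 2 - 5] ∈ L P} with hS
  have hSL : S ⊆ L P := fun x hx => hx.1
  have hSf : S.Finite := hLf.subset hSL
  have hc := count S hSf
  have h1 : S.ncard ≤ (mk hP a b hab).big := by
    rw [← hc.2]
    unfold Dat.big
    refine finsum_le_finsum' ?_ ?_ ?_
    · exact hc.1
    · refine ((mk hP a b hab).fin).subset ?_
      intro w hw
      have : (mk hP a b hab).n w.1 w.2 - 5 ≠ 0 := hw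
      have h2 := (mk hP a b hab).nF (x := w.1) (y := w.2) (by omega)
      exact (mk hP a b hab).mono h2 le_rfl ((mk hP a b hab).nonneg h2)
    · intro w
      refine le_trans (le_of_eq ?_) (five hP w.1 w.2)
      rw [ZF_eq]
      congr 1
  have h2 : (L P \ S).ncard ≤ 46 := by
    have hf : (L P \ S).Finite := hLf.subset fun x hx => hx.1
    rw [Set.ncard_eq_toFinset_card _ hf]
    refine classes' hP hab hne _ ?_ ?_
    · intro x hx
      rw [Set.Finite.mem_toFinset] at hx
      exact hx.1
    · have aux : ∀ x ∈ L P \ S, ∀ y ∈ L P \ S, md 5 x = md 5 y → x 2 ≤ y 2 → x = y := by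
        intro x hx y hy h hle
        obtain ⟨e0, e1⟩ := hpar x hx.1 y hy.1 h
        obtain ⟨w, hw⟩ := md_eq h
        have hw2 := hw 2
        push_cast at hw2
        by_contra hne
        have hlt : x 2 < y 2 := by
          refine lt_of_le_of_ne hle fun h2 => hne ?_
          rw [← vec_eta x, ← vec_eta y, e0, e1, h2]
        apply hy.2
        refine ⟨hy.1, ?_⟩
        have hx1 : ![(y 0 : ℝ), y 1, x 2] ∈ P := by
          rw [← e0, ← e1, ← cast_vec, vec_eta]; exact hx.1
        have hy1 : ![(y 0 : ℝ), y 1, y 2] ∈ P := by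
          rw [← cast_vec, vec_eta]; exact hy.1
        show castPt _ ∈ P
        rw [cast_vec]
        refine btw (convex_P hP) hx1 hy1 ?_ ?_
        · exact_mod_cast (by omega)
        · exact_mod_cast (by omega)
      intro x hx y hy h
      rw [Set.Finite.mem_toFinset] at hx hy
      rcases le_total (x 2) (y 2) with h2 | h2
      · exact aux x hx y hy h h2
      · exact (aux y hy x hx h.symm h2).symm
  have h3 := Set.ncard_sdiff_add_ncard_of_subset hSL hLf
  omega

/-- If there is a coincidence mod 5 along the third axis, we are done. -/
theorem frame (hP : IsLatticePolytope P) (hab : intLatPts P = {a, b}) (hne : a ≠ b)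
    (hN : 55 ≤ (L P).ncard) {x y : Fin 3 → ℤ} {g : ℤ} (hx : x ∈ L P) (hy : y ∈ L P) (hg : 1 ≤ g)
    (h0 : y 0 = x 0) (h1 : y 1 = x 1) (h2 : y 2 = x 2 + 5 * g) :
    (mk hP a b hab).N = 55 ∧ (mk hP a b hab).Table := by
  have hz : (mk hP a b hab).F (x 0) (x 1) 5 := by
    have hx1 : ![(x 0 : ℝ), x 1, x 2] ∈ P := by
      rw [← cast_vec, vec_eta]; exact hx
    have hy1 : ![(x 0 : ℝ), x 1, y 2] ∈ P := by
      rw [← h0, ← h1, ← cast_vec, vec_eta]; exact hy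
    refine ⟨by norm_num, x 2, hx1, btw (convex_P hP) hx1 hy1 (by linarith) ?_⟩
    rw [h2]; push_cast
    have : (1 : ℝ) ≤ g := by exact_mod_cast hg
    linarith
  have hN' := N_eq hP hab
  have main : (mk hP a b hab).N ≤ 54 ∨ ((mk hP a b hab).N = 55 ∧ (mk hP a b hab).Table) := by
    by_cases hpar : ∀ x ∈ L P, ∀ y ∈ L P, md 5 x = md 5 y → x 0 = y 0 ∧ x 1 = y 1
    · exact Dat.main_big (big_ge hP hab hne hN hpar)
    · push Not at hpar
      obtain ⟨p, hp, q, hq, hpq, hd⟩ := hpar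
      obtain ⟨w, hw⟩ := md_eq hpq
      have hF : ∀ p ∈ L P, (mk hP a b hab).F (p 0) (p 1) 0 := by
        intro p hp
        have hp1 : ![(p 0 : ℝ), p 1, p 2] ∈ P := by
          rw [← cast_vec, vec_eta]; exact hp
        exact ⟨le_rfl, p 2, hp1, by simpa using hp1⟩
      have w0 := hw 0
      have w1 := hw 1
      push_cast at w0 w1
      refine Dat.main_nonpar (p := q 0) (q := q 1) (r := p 0) (s := p 1) (u := w 0) (v := w 1)
        (hF q hq) (hF p hp) (by linarith) (by linarith) ?_ hz
      by_contra hc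
      push Not at hc
      rw [hc.1] at w0
      rw [hc.2] at w1
      exact hd (by linarith) (by linarith)
  rcases main with h | h
  · omega
  · exact h

end Fr

namespace Fr

variable {P Q : Set (Fin 3 → ℝ)}

/-- real affine map -/
def U (A : Matrix (Fin 3) (Fin 3) ℤ) (b : Fin 3 → ℤ) (x : Fin 3 → ℝ) : Fin 3 → ℝ :=
  (A.map (Int.cast : ℤ → ℝ)).mulVec x + castPt b

/-- integral affine map -/
def Z (A : Matrix (Fin 3) (Fin 3) ℤ) (b : Fin 3 → ℤ) (x : Fin 3 → ℤ) : Fin 3 → ℤ :=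
  A.mulVec x + b

lemma U_cast (A : Matrix (Fin 3) (Fin 3) ℤ) (b x : Fin 3 → ℤ) :
    U A b (castPt x) = castPt (Z A b x) := by
  ext i
  simp [U, Z, castPt, Matrix.mulVec, dotProduct]

lemma castPt_inj : Function.Injective (castPt : (Fin 3 → ℤ) → Fin 3 → ℝ) := by
  intro x y h
  ext i
  have := congrFun h i
  simpa [castPt] using this

lemma U_comp (A B : Matrix (Fin 3) (Fin 3) ℤ) (b c : Fin 3 → ℤ) (x : Fin 3 → ℝ) :
    U A b (U B c x) = U (A * B) (Z A b c) x := by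
  have h1 : (A * B).map (Int.cast : ℤ → ℝ) = A.map Int.cast * B.map Int.cast := by
    have := Matrix.map_mul (L := A) (M := B) (f := Int.castRingHom ℝ)
    simpa using this
  have hc : castPt (Z A b c) = (A.map (Int.cast : ℤ → ℝ)).mulVec (castPt c) + castPt b :=
    (U_cast A b c).symm
  simp only [U, h1, hc, Matrix.mulVec_add, Matrix.mulVec_mulVec, add_assoc]

lemma U_one (x : Fin 3 → ℝ) : U 1 0 x = x := by
  have : (1 : Matrix (Fin 3) (Fin 3) ℤ).map (Int.cast : ℤ → ℝ) = 1 := by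
    simp
  ext i
  simp [U, this, castPt]

lemma U_inv (A : Matrix (Fin 3) (Fin 3) ℤ) (b : Fin 3 → ℤ) (h : IsUnit A.det) :
    ∃ A' b', IsUnit (Matrix.det A') ∧ (∀ x, U A' b' (U A b x) = x) ∧
      ∀ x, U A b (U A' b' x) = x := by
  refine ⟨A⁻¹, -(A⁻¹.mulVec b), Matrix.isUnit_nonsing_inv_det A h, fun x => ?_, fun x => ?_⟩
  · rw [U_comp, Matrix.nonsing_inv_mul A h]
    have : Z A⁻¹ (-(A⁻¹.mulVec b)) b = 0 := by simp [Z]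
    rw [this, U_one]
  · rw [U_comp, Matrix.mul_nonsing_inv A h]
    have : Z A b (-(A⁻¹.mulVec b)) = 0 := by
      simp [Z, Matrix.mulVec_neg, Matrix.mulVec_mulVec, Matrix.mul_nonsing_inv A h]
    rw [this, U_one]

lemma U_cont (A : Matrix (Fin 3) (Fin 3) ℤ) (b : Fin 3 → ℤ) : Continuous (U A b) := by
  unfold U
  fun_prop

/-- as a homeomorphism -/
def Uh (A A' : Matrix (Fin 3) (Fin 3) ℤ) (b b' : Fin 3 → ℤ) (h : ∀ x, U A' b' (U A b x) = x)
    (h' : ∀ x, U A b (U A' b' x) = x) : (Fin 3 → ℝ) ≃ₜ (Fin 3 → ℝ) where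
  toFun := U A b
  invFun := U A' b'
  left_inv := h
  right_inv := h'
  continuous_toFun := U_cont A b
  continuous_invFun := U_cont A' b'

lemma Z_inv {A A' : Matrix (Fin 3) (Fin 3) ℤ} {b b' : Fin 3 → ℤ} (h : ∀ x, U A' b' (U A b x) = x)
    (x : Fin 3 → ℤ) : Z A' b' (Z A b x) = x := by
  apply castPt_inj
  rw [← U_cast, ← U_cast, h]

/-- as an affine map -/
def Ua (A : Matrix (Fin 3) (Fin 3) ℤ) (b : Fin 3 → ℤ) : (Fin 3 → ℝ) →ᵃ[ℝ] (Fin 3 → ℝ) :=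
  (Matrix.mulVecLin (A.map (Int.cast : ℤ → ℝ))).toAffineMap + AffineMap.const ℝ _ (castPt b)

lemma Ua_eq (A : Matrix (Fin 3) (Fin 3) ℤ) (b : Fin 3 → ℤ) : (Ua A b : _ → _) = U A b := by
  ext x i
  simp [Ua, U]

lemma U_hull (A : Matrix (Fin 3) (Fin 3) ℤ) (b : Fin 3 → ℤ) (s : Set (Fin 3 → ℝ)) :
    U A b '' convexHull ℝ s = convexHull ℝ (U A b '' s) := by
  rw [← Ua_eq]
  exact AffineMap.image_convexHull _ _

lemma UE_iff : UnimodEquiv P Q ↔ ∃ (A : Matrix (Fin 3) (Fin 3) ℤ) (b : Fin 3 → ℤ),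
    IsUnit A.det ∧ U A b '' P = Q := Iff.rfl

lemma UE_symm (h : UnimodEquiv P Q) : UnimodEquiv Q P := by
  obtain ⟨A, b, hA, rfl⟩ := UE_iff.1 h
  obtain ⟨A', b', hA', h1, h2⟩ := U_inv A b hA
  refine UE_iff.2 ⟨A', b', hA', ?_⟩
  rw [Set.image_image]
  simp [h1]

lemma UE_trans {R : Set (Fin 3 → ℝ)} (h : UnimodEquiv P Q) (h' : UnimodEquiv Q R) :
    UnimodEquiv P R := by
  obtain ⟨A, b, hA, rfl⟩ := UE_iff.1 h
  obtain ⟨B, c, hB, rfl⟩ := UE_iff.1 h'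
  refine UE_iff.2 ⟨B * A, Z B c b, ?_, ?_⟩
  · rw [Matrix.det_mul]; exact hB.mul hA
  · rw [Set.image_image]
    simp [U_comp]

lemma img_lat {A A' : Matrix (Fin 3) (Fin 3) ℤ} {b b' : Fin 3 → ℤ}
    (h1 : ∀ x, U A' b' (U A b x) = x) (h2 : ∀ x, U A b (U A' b' x) = x) (X : Set (Fin 3 → ℝ)) :
    {x | castPt x ∈ U A b '' X} = Z A b '' {x | castPt x ∈ X} := by
  ext x
  constructor
  · rintro ⟨y, hy, hyx⟩
    refine ⟨Z A' b' x, ?_, Z_inv h2 x⟩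
    show castPt _ ∈ X
    rw [← U_cast, ← hyx, h1]; exact hy
  · rintro ⟨y, hy, rfl⟩
    exact ⟨castPt y, hy, U_cast A b y⟩

lemma Z_injective {A A' : Matrix (Fin 3) (Fin 3) ℤ} {b b' : Fin 3 → ℤ}
    (h1 : ∀ x, U A' b' (U A b x) = x) : Function.Injective (Z A b) :=
  Function.LeftInverse.injective (Z_inv h1)

lemma U_L (A : Matrix (Fin 3) (Fin 3) ℤ) (b : Fin 3 → ℤ) (hA : IsUnit A.det)
    (P : Set (Fin 3 → ℝ)) : L (U A b '' P) = Z A b '' L P ∧ (L (U A b '' P)).ncard = (L P).ncard ∧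
    (intLatPts (U A b '' P)).ncard = (intLatPts P).ncard := by
  obtain ⟨A', b', hA', h1, h2⟩ := U_inv A b hA
  have e1 : L (U A b '' P) = Z A b '' L P := img_lat h1 h2 P
  refine ⟨e1, ?_, ?_⟩
  · rw [e1, Set.ncard_image_of_injective _ (Z_injective h1)]
  · have e2 : interior (U A b '' P) = U A b '' interior P :=
      ((Uh A A' b b' h1 h2).image_interior P).symm
    have e3 : intLatPts (U A b '' P) = Z A b '' intLatPts P := by
      unfold intLatPts
      rw [e2]
      exact img_lat h1 h2 _
    rw [e3, Set.ncard_image_of_injective _ (Z_injective h1)]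

lemma U_poly (A : Matrix (Fin 3) (Fin 3) ℤ) (b : Fin 3 → ℤ) (h : IsLatticePolytope P) :
    IsLatticePolytope (U A b '' P) := by
  classical
  obtain ⟨V, hV, rfl⟩ := h
  refine ⟨V.image (Z A b), hV.image _, ?_⟩
  rw [U_hull, Set.image_image, Finset.coe_image, Set.image_image]
  simp [U_cast]

lemma bez (x y : ℤ) : ∃ G s t p q : ℤ, 0 ≤ G ∧ x = G * s ∧ y = G * t ∧ s * p + t * q = 1 := by
  by_cases h : x = 0 ∧ y = 0
  · exact ⟨0, 1, 0, 1, 0, le_rfl, by simp [h.1], by simp [h.2], by norm_num⟩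
  · have hG : Int.gcd x y ≠ 0 := by
      rw [Ne, Int.gcd_eq_zero_iff]; exact h
    obtain ⟨s, hs⟩ := Int.gcd_dvd_left (a := x) (b := y)
    obtain ⟨t, ht⟩ := Int.gcd_dvd_right (a := x) (b := y)
    have hb := Int.gcd_eq_gcd_ab x y
    refine ⟨Int.gcd x y, s, t, Int.gcdA x y, Int.gcdB x y, by positivity, hs, ht, ?_⟩
    have hG' : (Int.gcd x y : ℤ) ≠ 0 := by exact_mod_cast hG
    apply mul_left_cancel₀ hG'
    linear_combination (-Int.gcdA x y) * hs - Int.gcdB x y * ht - hb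

lemma exB {w : Fin 3 → ℤ} (hw : w ≠ 0) : ∃ (B : Matrix (Fin 3) (Fin 3) ℤ) (g : ℤ),
    IsUnit B.det ∧ 1 ≤ g ∧ B.mulVec w = ![0, 0, g] := by
  obtain ⟨G1, s, t, p, q, hG1, e1, e2, e3⟩ := bez (w 0) (w 1)
  obtain ⟨G2, s2, t2, p2, q2, hG2, e4, e5, e6⟩ := bez G1 (w 2)
  refine ⟨!![-t, s, 0; -t2 * p, -t2 * q, s2; p2 * p, p2 * q, q2], G2, ?_, ?_, ?_⟩
  · have : Matrix.det !![-t, s, 0; -t2 * p, -t2 * q, s2; p2 * p, p2 * q, q2] = 1 := by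
      rw [Matrix.det_fin_three]
      simp
      linear_combination (s2 * p2 + t2 * q2) * e3 + e6
    rw [this]; exact isUnit_one
  · rcases eq_or_lt_of_le hG2 with h | h
    · exfalso
      rw [← h] at e4 e5
      simp at e4 e5
      rw [e4] at e1 e2
      simp at e1 e2
      apply hw
      rw [← vec_eta w, e1, e2, e5]
      ext i; fin_cases i <;> simp
    · omega
  · ext i
    fin_cases i
    · simp [Matrix.mulVec, dotProduct, Fin.sum_univ_three]
      rw [e1, e2]; ring
    · simp [Matrix.mulVec, dotProduct, Fin.sum_univ_three]
      rw [e1, e2, e5]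
      linear_combination (-t2 * G1) * e3 - t2 * e4
    · simp [Matrix.mulVec, dotProduct, Fin.sum_univ_three]
      rw [e1, e2, e5]
      linear_combination (p2 * G1) * e3 + p2 * e4 + G2 * e6

end Fr

namespace Fr

variable {P Q : Set (Fin 3 → ℝ)} {a b : Fin 3 → ℤ}

lemma S23_mem (p : Fin 3 → ℝ) : p ∈ S23 ↔ 0 ≤ p 0 ∧ 0 ≤ p 1 ∧ 0 ≤ p 2 ∧
    9 * p 0 + 6 * p 1 + p 2 ≤ 18 := by
  constructor
  · intro hp
    have hsub : S23 ⊆ {p : Fin 3 → ℝ | 0 ≤ p 0 ∧ 0 ≤ p 1 ∧ 0 ≤ p 2 ∧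
        9 * p 0 + 6 * p 1 + p 2 ≤ 18} := by
      refine convexHull_min ?_ ?_
      · intro q hq
        simp only [Set.mem_insert_iff, Set.mem_singleton_iff] at hq
        rcases hq with rfl | rfl | rfl | rfl <;> simp <;> norm_num
      · rintro p ⟨h1, h2, h3, h4⟩ q ⟨k1, k2, k3, k4⟩ s t hs ht hst
        simp only [Set.mem_ofPred_eq, Pi.add_apply, Pi.smul_apply, smul_eq_mul]
        refine ⟨by positivity, by positivity, by positivity, ?_⟩
        calc _ = s * (9 * p 0 + 6 * p 1 + p 2) + t * (9 * q 0 + 6 * q 1 + q 2) := by ring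
          _ ≤ s * 18 + t * 18 := by gcongr
          _ = _ := by rw [← add_mul, hst, one_mul]
    exact hsub hp
  · rintro ⟨h1, h2, h3, h4⟩
    have hc : Convex ℝ S23 := convex_convexHull ℝ _
    have hv : ∀ q ∈ ({![0,0,0], ![2,0,0], ![0,3,0], ![0,0,18]} : Set (Fin 3 → ℝ)), q ∈ S23 :=
      fun q hq => subset_convexHull ℝ _ hq
    have := hc.sum_mem (t := (Finset.univ : Finset (Fin 4)))
      (w := ![1 - p 0 / 2 - p 1 / 3 - p 2 / 18, p 0 / 2, p 1 / 3, p 2 / 18])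
      (z := ![![0,0,0], ![2,0,0], ![0,3,0], ![0,0,18]])
      (by
        intro i _
        fin_cases i <;> simp <;> linarith)
      (by simp [Fin.sum_univ_four]; ring)
      (by
        intro i _
        fin_cases i <;> exact hv _ (by simp))
    convert this using 1
    ext i
    fin_cases i <;> simp [Fin.sum_univ_four]

/-- the lattice points of the simplex -/
def pts : Finset (ℤ × ℤ × ℤ) := (Finset.Icc 0 2 ×ˢ Finset.Icc 0 3 ×ˢ Finset.Icc 0 18).filter
  fun w => 9 * w.1 + 6 * w.2.1 + w.2.2 ≤ 18

lemma pts_card : pts.card = 55 := by decide +kernel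

lemma L_S23 : (L S23).ncard = 55 := by
  have : L S23 = (fun w : ℤ × ℤ × ℤ => ![w.1, w.2.1, w.2.2]) '' (pts : Set (ℤ × ℤ × ℤ)) := by
    ext x
    constructor
    · intro hx
      have hx : castPt x ∈ S23 := hx
      rw [S23_mem] at hx
      simp only [castPt] at hx
      obtain ⟨h1, h2, h3, h4⟩ := hx
      have h1 : 0 ≤ x 0 := by exact_mod_cast h1
      have h2 : 0 ≤ x 1 := by exact_mod_cast h2
      have h3 : 0 ≤ x 2 := by exact_mod_cast h3
      have h4 : 9 * x 0 + 6 * x 1 + x 2 ≤ 18 := by exact_mod_cast h4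
      refine ⟨(x 0, x 1, x 2), ?_, vec_eta x⟩
      simp [pts]
      omega
    · rintro ⟨⟨x, y, z⟩, hw, rfl⟩
      show castPt _ ∈ S23
      rw [S23_mem, cast_vec]
      simp [pts] at hw
      obtain ⟨⟨⟨h1, h1'⟩, ⟨h2, h2'⟩, h3, h3'⟩, h4⟩ := hw
      simp
      exact ⟨h1, h2, h3, by exact_mod_cast h4⟩
  rw [this, Set.ncard_image_of_injective, Set.ncard_coe_finset, pts_card]
  rintro ⟨x, y, z⟩ ⟨x', y', z'⟩ h
  have h0 := congrFun h 0
  have h1 := congrFun h 1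
  have h2 := congrFun h 2
  simp at h0 h1 h2
  simp [h0, h1, h2]

lemma ZF_ends (hP : IsLatticePolytope P) {x y : ℤ} (k : ℕ) (hn : k + 1 ≤ (ZF P x y).ncard) :
    ∃ p : ℤ, ![(x : ℝ), y, p] ∈ P ∧ ![(x : ℝ), y, p + k] ∈ P := by
  obtain ⟨p, hp, hq, -⟩ := ZF_exists hP (by omega : 1 ≤ (ZF P x y).ncard)
  refine ⟨p, hp, ?_⟩
  have hc : ((k : ℝ) + 1) ≤ (ZF P x y).ncard := by exact_mod_cast hn
  have hq' : ![(x : ℝ), y, ((p + ((ZF P x y).ncard - 1 : ℤ) : ℤ) : ℝ)] ∈ P := hq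
  refine btw (convex_P hP) hp hq' ?_ ?_
  · have : (0 : ℝ) ≤ k := by positivity
    linarith
  · push_cast; linarith

/-- A fibre of maximal length `l` containing two chords of length `l`. -/
lemma rigid {x y p q l : ℝ} (hl : 0 ≤ l) (hmax : ∀ l', FF P x y l' → l' ≤ l)
    (h1 : ![x, y, p] ∈ P) (h2 : ![x, y, p + l] ∈ P) (h3 : ![x, y, q] ∈ P)
    (h4 : ![x, y, q + l] ∈ P) : p = q := by
  rcases le_total p q with h | h
  · have := hmax (q + l - p) ⟨by linarith, p, h1, by rw [add_sub_cancel]; exact h4⟩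
    linarith
  · have := hmax (p + l - q) ⟨by linarith, q, h3, by rw [add_sub_cancel]; exact h2⟩
    linarith

theorem table (hP : IsLatticePolytope P) (hab : intLatPts P = {a, b})
    (hN : (L P).ncard = 55) (hT : (mk hP a b hab).Table) : UnimodEquiv P S23 := by
  obtain ⟨ψ, t00, t01, t03, t10, t20, t12, t9⟩ := hT
  simp only [Dat.map_n, Dat.map_F] at t00 t01 t03 t10 t20 t12 t9
  have hc := convex_P hP
  have t00' : 18 + 1 ≤ (ZF P (ψ.X 0 0) (ψ.Y 0 0)).ncard := t00
  have t01' : 12 + 1 ≤ (ZF P (ψ.X 0 1) (ψ.Y 0 1)).ncard := t01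
  have t03' : 0 + 1 ≤ (ZF P (ψ.X 0 3) (ψ.Y 0 3)).ncard := t03
  have t10' : 9 + 1 ≤ (ZF P (ψ.X 1 0) (ψ.Y 1 0)).ncard := t10
  have t20' : 0 + 1 ≤ (ZF P (ψ.X 2 0) (ψ.Y 2 0)).ncard := t20
  obtain ⟨z, hz, hz'⟩ := ZF_ends hP _ t00'
  obtain ⟨y1, hy1, hy1'⟩ := ZF_ends hP _ t01'
  obtain ⟨y3, hy3, -⟩ := ZF_ends hP _ t03'
  obtain ⟨x1, hx1, hx1'⟩ := ZF_ends hP _ t10'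
  obtain ⟨x2, hx2, -⟩ := ZF_ends hP _ t20'
  push_cast at hz' hy1' hx1'
  have d3 : (y1 : ℝ) = (2 * z + y3) / 3 := by
    have c1 := comb hc hz hy3 (s := 2 / 3) (t := 1 / 3) (by norm_num) (by norm_num) (by norm_num)
    have c2 := comb hc hz' hy3 (s := 2 / 3) (t := 1 / 3) (by norm_num) (by norm_num) (by norm_num)
    have e1 : 2 / 3 * (ψ.X 0 0 : ℝ) + 1 / 3 * (ψ.X 0 3 : ℝ) = ψ.X 0 1 := by
      simp [Aff.X]; ring
    have e2 : 2 / 3 * (ψ.Y 0 0 : ℝ) + 1 / 3 * (ψ.Y 0 3 : ℝ) = ψ.Y 0 1 := by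
      simp [Aff.Y]; ring
    rw [e1, e2] at c1 c2
    refine rigid (l := 12) (by norm_num) (fun l' h => t12 l' h) hy1 hy1' ?_ ?_
    · convert c1 using 4; ring
    · convert c2 using 4; ring
  have d2 : (x1 : ℝ) = (z + x2) / 2 := by
    have c1 := comb hc hz hx2 (s := 1 / 2) (t := 1 / 2) (by norm_num) (by norm_num) (by norm_num)
    have c2 := comb hc hz' hx2 (s := 1 / 2) (t := 1 / 2) (by norm_num) (by norm_num) (by norm_num)
    have e1 : 1 / 2 * (ψ.X 0 0 : ℝ) + 1 / 2 * (ψ.X 2 0 : ℝ) = ψ.X 1 0 := by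
      simp [Aff.X]; ring
    have e2 : 1 / 2 * (ψ.Y 0 0 : ℝ) + 1 / 2 * (ψ.Y 2 0 : ℝ) = ψ.Y 1 0 := by
      simp [Aff.Y]; ring
    rw [e1, e2] at c1 c2
    refine rigid (l := 9) (by norm_num) (fun l' h => t9 l' h) hx1 hx1' ?_ ?_
    · convert c1 using 4; ring
    · convert c2 using 4; ring
  set A : Matrix (Fin 3) (Fin 3) ℤ := !![ψ.a, ψ.b, 0; ψ.c, ψ.d, 0; x1 - z, y1 - z, 1] with hA
  set c : Fin 3 → ℤ := ![ψ.e, ψ.f, z] with hcc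
  have hdet : IsUnit A.det := by
    have : A.det = ψ.a * ψ.d - ψ.b * ψ.c := by
      rw [hA, Matrix.det_fin_three]; simp
    rw [this, Int.isUnit_iff]; exact ψ.det
  have hU : ∀ x y w : ℝ, U A c ![x, y, w] = ![ψ.a * x + ψ.b * y + ψ.e, ψ.c * x + ψ.d * y + ψ.f,
      (x1 - z) * x + (y1 - z) * y + w + z] := by
    intro x y w
    ext i
    fin_cases i <;> simp [U, hA, hcc, castPt, Matrix.mulVec, dotProduct, Fin.sum_univ_three]
  have hsub : U A c '' S23 ⊆ P := by
    unfold S23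
    rw [U_hull]
    refine convexHull_min ?_ hc
    rintro _ ⟨q, hq, rfl⟩
    simp only [Set.mem_insert_iff, Set.mem_singleton_iff] at hq
    rcases hq with rfl | rfl | rfl | rfl
    · rw [hU]; convert hz using 2 <;> simp [Aff.X, Aff.Y]
    · rw [hU]; convert hx2 using 2
      · simp [Aff.X]
      · congr 1
        · simp [Aff.Y]
        · congr 1
          rw [d2]; ring
    · rw [hU]; convert hy3 using 2
      · simp [Aff.X]
      · congr 1
        · simp [Aff.Y]
        · congr 1
          rw [d3]; ring
    · rw [hU]; convert hz' using 2
      · simp [Aff.X]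
      · congr 1
        · simp [Aff.Y]
        · congr 1
          ring
  have hL := U_L A c hdet S23
  have hLsub : L (U A c '' S23) ⊆ L P := fun x hx => hsub hx
  have heq : L (U A c '' S23) = L P :=
    Set.eq_of_subset_of_ncard_le hLsub (by rw [hL.2.1, L_S23, hN]) (L_fin hP)
  have hPs : P ⊆ U A c '' S23 := by
    obtain ⟨V, hV, hPV⟩ := hP
    have hconv : Convex ℝ (U A c '' S23) := by
      unfold S23
      rw [U_hull]; exact convex_convexHull ℝ _
    have hVL : ∀ v ∈ V, v ∈ L P := fun v hv => by
      show castPt v ∈ P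
      rw [hPV]; exact subset_convexHull ℝ _ ⟨v, hv, rfl⟩
    rw [hPV]
    refine convexHull_min ?_ hconv
    rintro _ ⟨v, hv, rfl⟩
    have := hVL v hv
    rw [← heq] at this
    exact this
  exact UE_symm (UE_iff.2 ⟨A, c, hdet, hsub.antisymm hPs⟩)

theorem final (hP : IsLatticePolytope P) (hI : (intLatPts P).ncard = 2) (hN : 55 ≤ (L P).ncard) :
    (L P).ncard = 55 ∧ UnimodEquiv P S23 := by
  obtain ⟨a, b, hne, hab⟩ := Set.ncard_eq_two.1 hI
  have hLf := L_fin hP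
  obtain ⟨x, hx, y, hy, hxy, hm⟩ : ∃ x ∈ L P, ∃ y ∈ L P, x ≠ y ∧ md 5 x = md 5 y := by
    by_contra hcon
    push Not at hcon
    have := classes' hP hab hne hLf.toFinset (fun x hx => by
      rw [Set.Finite.mem_toFinset] at hx; exact hx) (fun x hx y hy h => by
      rw [Set.Finite.mem_toFinset] at hx hy
      by_contra hxy
      exact hcon x hx y hy hxy h)
    rw [← Set.ncard_eq_toFinset_card _ hLf] at this
    omega
  obtain ⟨w, hw⟩ := md_eq hm
  have hxw : x = y + (5 : ℤ) • w := by
    ext i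
    have := hw i
    simp at this ⊢
    linarith
  have hw0 : w ≠ 0 := by
    rintro rfl
    apply hxy
    rw [hxw]; simp
  obtain ⟨B, g, hB, hg, hBw⟩ := exB hw0
  have hQ := U_poly B 0 hP
  have hL := U_L B 0 hB P
  rw [hI] at hL
  obtain ⟨a', b', hne', hab'⟩ := Set.ncard_eq_two.1 hL.2.2
  have hx' : Z B 0 x ∈ L (U B 0 '' P) := by rw [hL.1]; exact ⟨x, hx, rfl⟩
  have hy' : Z B 0 y ∈ L (U B 0 '' P) := by rw [hL.1]; exact ⟨y, hy, rfl⟩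
  have hd : Z B 0 x = Z B 0 y + (5 : ℤ) • ![0, 0, g] := by
    rw [← hBw, hxw]
    simp only [Z, Matrix.mulVec_add, Matrix.mulVec_smul, add_zero]
  have hfr := frame hQ hab' hne' (by rw [hL.2.1]; exact hN) hy' hx' hg
    (by rw [hd]; simp) (by rw [hd]; simp) (by rw [hd]; simp)
  have hNQ := hfr.1
  rw [N_eq] at hNQ
  refine ⟨by rw [← hL.2.1]; exact hNQ, ?_⟩
  exact UE_trans (UE_iff.2 ⟨B, 0, hB, rfl⟩) (table hQ hab' hNQ hfr.2)

end Fr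

/-- Every three-dimensional lattice polytope with exactly two interior lattice points
contains at most `55` lattice points, with equality if and only if it is unimodular
equivalent to `S₂³`. -/
theorem lattice_point_bound_two_point_three_polytopes (P : Set (Fin 3 → ℝ))
    (hP : IsKPoint3Polytope 2 P) :
    {x : Fin 3 → ℤ | castPt x ∈ P}.ncard ≤ 55 ∧
    ({x : Fin 3 → ℤ | castPt x ∈ P}.ncard = 55 ↔ UnimodEquiv P S23) := by
  obtain ⟨h1, -, h2⟩ := hP
  show (Fr.L P).ncard ≤ 55 ∧ ((Fr.L P).ncard = 55 ↔ _)
  refine ⟨?_, ?_, ?_⟩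
  · by_contra h
    have := (Fr.final h1 h2 (by omega)).1
    omega
  · intro h
    exact (Fr.final h1 h2 (by omega)).2
  · intro h
    obtain ⟨A, b, hA, hS⟩ := Fr.UE_iff.1 h
    have := (Fr.U_L A b hA P).2.1
    rw [hS, Fr.L_S23] at this
    exact this.symm
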